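/- arXiv:math/0306034 — 3 statements merged into one kernel-verified Lean document; each statement's English description precedes it below -/
import Mathlib

section
/- Let P ⊂ ℝ^n be an n-dimensional rational polytope. Then the interior lattice-point counting function is a quasipolynomial: there exist a positive integer p and polynomials q_0, …, q_{p-1} ∈ ℚ[x] such that for every positive integer t, the number of points of ℤ^n lying in the interior of the dilate tP = {t·x : x ∈ P} equals q_{t mod p}(t). -/
open Pointwise

namespace LatticePointCount

/-- The generators of the algebra of piecewise quasipolynomial functions on an abelian group:
rounded-down affine functions, and indicators of homogeneous closed half-spaces. -/
def generators (E : Type) [AddCommGroup E] : Set (E → ℚ) :=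
  {f | ∃ (l : E →+ ℤ) (k N : ℤ), 0 < N ∧ f = fun x => (((l x + k) / N : ℤ) : ℚ)} ∪
    {f | ∃ l : E →+ ℤ, f = fun x => if 0 ≤ l x then 1 else 0}

/-- Functions that are piecewise quasipolynomial with respect to homogeneous linear conditions. -/
def piecewiseQuasi (E : Type) [AddCommGroup E] : Subalgebra ℚ (E → ℚ) :=
  Algebra.adjoin ℚ (generators E)

variable {E : Type} [AddCommGroup E]

lemma floor_mem (l : E →+ ℤ) (k : ℤ) {N : ℤ} (hN : 0 < N) :
    (fun x => (((l x + k) / N : ℤ) : ℚ)) ∈ piecewiseQuasi E :=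
  Algebra.subset_adjoin (Or.inl ⟨l, k, N, hN, rfl⟩)

lemma indicator_nonneg_mem (l : E →+ ℤ) :
    (fun x => if 0 ≤ l x then (1 : ℚ) else 0) ∈ piecewiseQuasi E :=
  Algebra.subset_adjoin (Or.inr ⟨l, rfl⟩)

lemma indicator_pos_mem (l : E →+ ℤ) :
    (fun x => if 0 < l x then (1 : ℚ) else 0) ∈ piecewiseQuasi E := by
  convert sub_mem (one_mem (piecewiseQuasi E)) (indicator_nonneg_mem (-l)) using 1
  ext x
  by_cases h : 0 < l x
  · simp [h, not_le.mpr h]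
  · simp [h, not_lt.mp h]

lemma const_mem (c : ℚ) : (fun _ => c) ∈ piecewiseQuasi E :=
  (piecewiseQuasi E).algebraMap_mem c

lemma polynomial_comp_mem {f : E → ℚ} (hf : f ∈ piecewiseQuasi E) (p : Polynomial ℚ) :
    (fun x => p.eval (f x)) ∈ piecewiseQuasi E := by
  convert Polynomial.aeval_mem_adjoin_singleton ℚ (p := p) f |> fun h =>
    (Algebra.adjoin_le (Set.singleton_subset_iff.mpr hf)) h using 1
  ext x
  rw [← Polynomial.coe_aeval_eq_eval]
  exact (Polynomial.aeval_algHom_apply (Pi.evalAlgHom ℚ (fun _ : E => ℚ) x) f p)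

lemma comp_mem {E' : Type} [AddCommGroup E'] (φ : E' →+ E) {f : E → ℚ}
    (hf : f ∈ piecewiseQuasi E) : (fun x => f (φ x)) ∈ piecewiseQuasi E' := by
  induction hf using Algebra.adjoin_induction with
  | mem f hf =>
    rcases hf with ⟨l, k, N, hN, rfl⟩ | ⟨l, rfl⟩
    · exact floor_mem (l.comp φ) k hN
    · exact indicator_nonneg_mem (l.comp φ)
  | algebraMap r => exact const_mem r
  | add f g _ _ hf hg => exact add_mem hf hg
  | mul f g _ _ hf hg => exact mul_mem hf hg

lemma exists_polynomial_antidifference (p : Polynomial ℚ) :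
    ∃ P : Polynomial ℚ, ∀ x : ℚ, P.eval x - P.eval (x - 1) = p.eval x := by
  induction p using Polynomial.induction_on' with
  | add p q hp hq =>
    obtain ⟨P, hP⟩ := hp
    obtain ⟨Q, hQ⟩ := hq
    refine ⟨P + Q, fun x => ?_⟩
    simp only [Polynomial.eval_add, ← hP, ← hQ]
    ring
  | monomial n a =>
    refine ⟨Polynomial.C (a / (n + 1)) * (Polynomial.bernoulli (n + 1)).comp (1 + Polynomial.X),
      fun x => ?_⟩
    have h := Polynomial.bernoulli_eval_one_add (n + 1) x
    simp only [Polynomial.eval_mul, Polynomial.eval_C, Polynomial.eval_comp, Polynomial.eval_add,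
      Polynomial.eval_one, Polynomial.eval_X, Polynomial.eval_monomial, h, add_sub_cancel]
    have : (n : ℚ) + 1 ≠ 0 := by positivity
    push_cast
    field_simp
    ring

lemma sub_ediv_step {N : ℤ} (hN : 0 < N) (y r : ℤ) (hr : 0 ≤ r) (hrN : r < N) :
    (y - 1 - r) / N = if y % N = r then (y - r) / N - 1 else (y - r) / N := by
  have h1 := Int.emod_add_mul_ediv y N
  have h2 := Int.emod_nonneg y hN.ne'
  have h3 := Int.emod_lt_of_pos y hN
  have key : ∀ a q : ℤ, q * N ≤ a → a < (q + 1) * N → a / N = q := fun a q ha hb =>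
    le_antisymm (Int.lt_add_one_iff.mp ((Int.ediv_lt_iff_lt_mul hN).mpr hb))
      ((Int.le_ediv_iff_mul_le hN).mpr ha)
  split_ifs with h
  · rw [key (y - r) (y / N) (by linarith) (by linarith)]
    exact key _ _ (by linarith) (by linarith)
  · rcases lt_or_gt_of_ne h with h | h
    · rw [key (y - r) (y / N - 1) (by linarith) (by linarith)]
      exact key _ _ (by linarith) (by linarith)
    · have : r + 1 ≤ y % N := h
      rw [key (y - r) (y / N) (by linarith) (by linarith)]
      exact key _ _ (by linarith) (by linarith)

/-- An antidifference of a periodic function times a monomial, which remains piecewise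
quasipolynomial after substituting a rounded-down affine function. -/
lemma exists_antidifference_periodic {c : ℤ → ℚ} {N : ℤ} (hN : 0 < N)
    (hc : Function.Periodic c N) (j : ℕ) :
    ∃ G : ℤ → ℚ, (∀ y : ℤ, G y - G (y - 1) = c y * (y : ℚ) ^ j) ∧
      ∀ (E : Type) [AddCommGroup E] (l : E →+ ℤ) (k M : ℤ), 0 < M →
        (fun x => G ((l x + k) / M)) ∈ piecewiseQuasi E := by
  choose P hP using fun r : ℤ => exists_polynomial_antidifference
    ((Polynomial.C (N : ℚ) * Polynomial.X + Polynomial.C (r : ℚ)) ^ j)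
  refine ⟨fun y => ∑ r ∈ Finset.Ico 0 N, c r * (P r).eval (((y - r) / N : ℤ) : ℚ), ?_, ?_⟩
  · intro y
    rw [← Finset.sum_sub_distrib, Finset.sum_eq_single (y % N)]
    · have h0 := Int.emod_nonneg y hN.ne'
      have h1 := Int.emod_lt_of_pos y hN
      have hy : y - y % N = N * (y / N) := by linarith [Int.emod_add_mul_ediv y N]
      have hcy : c (y % N) = c y := by
        have h := hc.sub_zsmul_eq (x := y) (y / N)
        rw [smul_eq_mul] at h
        rw [← h]
        congr 1
        linarith [Int.emod_add_mul_ediv y N]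
      rw [sub_ediv_step hN y _ h0 h1, if_pos rfl, ← mul_sub, hy,
        Int.mul_ediv_cancel_left _ hN.ne', hcy]
      push_cast
      rw [hP]
      simp only [Polynomial.eval_pow, Polynomial.eval_add, Polynomial.eval_mul, Polynomial.eval_C,
        Polynomial.eval_X]
      congr 2
      exact_mod_cast (by linarith [Int.emod_add_mul_ediv y N] : N * (y / N) + y % N = y)
    · intro r hr hne
      rw [Finset.mem_Ico] at hr
      rw [sub_ediv_step hN y _ hr.1 hr.2, if_neg hne.symm, sub_self]
    · intro h
      exact absurd (Finset.mem_Ico.mpr ⟨Int.emod_nonneg y hN.ne', Int.emod_lt_of_pos y hN⟩) h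
  · intro E _ l k M hM
    have : (fun x => ∑ r ∈ Finset.Ico 0 N, c r * (P r).eval ((((l x + k) / M - r) / N : ℤ) : ℚ)) =
        ∑ r ∈ Finset.Ico 0 N, c r •
          fun x => (P r).eval (((l x + (k - M * r)) / (M * N) : ℤ) : ℚ) := by
      ext x
      simp only [Finset.sum_apply, Pi.smul_apply, smul_eq_mul]
      refine Finset.sum_congr rfl fun r _ => ?_
      rw [← Int.ediv_ediv_of_nonneg hM.le, ← add_sub_assoc, Int.sub_mul_ediv_left _ _ hM.ne']
    rw [this]
    exact sum_mem fun r _ => Subalgebra.smul_mem _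
      (polynomial_comp_mem (floor_mem l _ (mul_pos hM hN)) _) _

/-- The rounded-down functions `x ↦ ⌊l x / N⌋` and `x ↦ ⌈l x / N⌉ - 1`, bounding the solutions of
`l x < N y` and of `l x ≤ N y` from below. -/
def IsCut (z : E → ℤ) : Prop :=
  ∃ (l : E →+ ℤ) (k N : ℤ), 0 < N ∧ (k = 0 ∨ k = -1) ∧ z = fun x => (l x + k) / N

lemma cut_lt_mem {z : E → ℤ} (hz : IsCut z) :
    (fun p : E × ℤ => if z p.1 < p.2 then (1 : ℚ) else 0) ∈ piecewiseQuasi (E × ℤ) := by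
  obtain ⟨l, k, N, hN, rfl | rfl, rfl⟩ := hz
  · convert indicator_pos_mem (N • AddMonoidHom.snd E ℤ - l.comp (AddMonoidHom.fst E ℤ)) using 3
    simp [Int.ediv_lt_iff_lt_mul hN, mul_comm]
  · convert indicator_nonneg_mem (N • AddMonoidHom.snd E ℤ - l.comp (AddMonoidHom.fst E ℤ))
      using 3
    simp only [Int.ediv_lt_iff_lt_mul hN, mul_comm, AddMonoidHom.sub_apply, AddMonoidHom.smul_apply,
      smul_eq_mul, AddMonoidHom.comp_apply, AddMonoidHom.coe_snd, AddMonoidHom.coe_fst, sub_nonneg]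
    omega

/-- Two cuts can be compared by a homogeneous linear condition. -/
lemma exists_compare_cuts {z w : E → ℤ} (hz : IsCut z) (hw : IsCut w) :
    ∃ s : E → Prop, (∀ x, s x → w x ≤ z x) ∧ (∀ x, ¬ s x → z x ≤ w x) ∧
      ∃ g ∈ piecewiseQuasi E, (∀ x, s x → g x = 1) ∧ ∀ x, ¬ s x → g x = 0 := by
  have key : ∀ {l m k k' N M : ℤ}, 0 < N → 0 < M → (k = 0 ∨ k = -1) → (k' = 0 ∨ k' = -1) →
      (k' ≤ k ∧ N * m ≤ M * l ∨ N * m < M * l) → (m + k') / M ≤ (l + k) / N := by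
    intro l m k k' N M hN hM hk hk' h
    rw [← Int.lt_add_one_iff, Int.ediv_lt_iff_lt_mul hM]
    have h1 : l + k < ((l + k) / N + 1) * N :=
      (Int.ediv_lt_iff_lt_mul hN).mp (Int.lt_succ _)
    set q := (l + k) / N + 1
    by_contra hcon
    have h2 : l ≤ q * N := by omega
    have h3 : q * M ≤ m := by omega
    have h4 : M * l ≤ M * (q * N) := mul_le_mul_of_nonneg_left h2 hM.le
    have h5 : N * (q * M) ≤ N * m := mul_le_mul_of_nonneg_left h3 hN.le
    have h6 : M * (q * N) = N * (q * M) := by ring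
    rcases h with ⟨hkk, h⟩ | h
    · have h7 : M * l = M * (q * N) := by linarith
      have h8 : N * (q * M) = N * m := by linarith
      have h9 := mul_left_cancel₀ hM.ne' h7
      have h10 := mul_left_cancel₀ hN.ne' h8
      omega
    · linarith
  obtain ⟨l, k, N, hN, hk, rfl⟩ := hz
  obtain ⟨m, k', M, hM, hk', rfl⟩ := hw
  by_cases hkk : k' ≤ k
  · refine ⟨fun x => 0 ≤ (M • l - N • m) x, fun x hx => key hN hM hk hk' (Or.inl ⟨hkk, ?_⟩),
      fun x hx => key hM hN hk' hk (Or.inr ?_), _, indicator_nonneg_mem (M • l - N • m),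
      fun x hx => if_pos hx, fun x hx => if_neg hx⟩
    · simpa using hx
    · simpa using hx
  · refine ⟨fun x => 0 < (M • l - N • m) x, fun x hx => key hN hM hk hk' (Or.inr ?_),
      fun x hx => key hM hN hk' hk (Or.inl ⟨by omega, ?_⟩), _, indicator_pos_mem (M • l - N • m),
      fun x hx => if_pos hx, fun x hx => if_neg hx⟩
    · simpa using hx
    · simpa using hx

/-- The summands into which a piecewise quasipolynomial function on `E × ℤ` decomposes. -/
def terms (E : Type) [AddCommGroup E] : Set (E × ℤ → ℚ) :=
  {f | ∃ g ∈ piecewiseQuasi E, ∃ (c : ℤ → ℚ) (N : ℤ) (j : ℕ), 0 < N ∧ Function.Periodic c N ∧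
    ((f = fun p => g p.1 * (c p.2 * (p.2 : ℚ) ^ j)) ∨
      ∃ z, IsCut z ∧ f = fun p => g p.1 * (c p.2 * (p.2 : ℚ) ^ j) * if z p.1 < p.2 then 1 else 0)}

lemma exists_antidifference_of_term {f : E × ℤ → ℚ} (hf : f ∈ terms E) :
    ∃ F ∈ piecewiseQuasi (E × ℤ), ∀ x y, F (x, y) - F (x, y - 1) = f (x, y) := by
  obtain ⟨g, hg, c, N, j, hN, hc, hf⟩ := hf
  obtain ⟨G, hG, hGmem⟩ := exists_antidifference_periodic hN hc j
  have hg' := comp_mem (AddMonoidHom.fst E ℤ) hg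
  have hGs : (fun p : E × ℤ => G p.2) ∈ piecewiseQuasi (E × ℤ) := by
    simpa using hGmem (E × ℤ) (AddMonoidHom.snd E ℤ) 0 1 one_pos
  rcases hf with rfl | ⟨z, hz, rfl⟩
  · refine ⟨_, mul_mem hg' hGs, fun x y => ?_⟩
    simp [← mul_sub, hG]
  · have hGz : (fun p : E × ℤ => G (z p.1)) ∈ piecewiseQuasi (E × ℤ) := by
      obtain ⟨l, k, M, hM, -, rfl⟩ := hz
      exact hGmem (E × ℤ) (l.comp (AddMonoidHom.fst E ℤ)) k M hM
    refine ⟨_, mul_mem (mul_mem hg' (sub_mem hGs hGz)) (cut_lt_mem hz), fun x y => ?_⟩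
    simp only [Pi.mul_apply, Pi.sub_apply, AddMonoidHom.coe_fst, ← hG]
    by_cases h : z x < y
    · by_cases h' : z x < y - 1
      · simp only [h, h', if_true]
        ring
      · have : z x = y - 1 := by omega
        simp [this]
    · have h' : ¬ z x < y - 1 := by omega
      simp [h, h']

lemma periodic_mul {c d : ℤ → ℚ} {N M : ℤ} (hc : Function.Periodic c N)
    (hd : Function.Periodic d M) : Function.Periodic (fun y => d y * c y) (N * M) := by
  have h1 := hc.int_mul M
  have h2 := hd.int_mul N
  intro y
  simp only [Int.cast_id] at h1 h2
  beta_reduce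
  rw [h2 y, mul_comm N M, h1 y]

lemma mul_mem_terms {g : E → ℚ} (hg : g ∈ piecewiseQuasi E) {d : ℤ → ℚ} {M : ℤ} (hM : 0 < M)
    (hd : Function.Periodic d M) (i : ℕ) {f : E × ℤ → ℚ} (hf : f ∈ terms E) :
    (fun p => g p.1 * (d p.2 * (p.2 : ℚ) ^ i) * f p) ∈ terms E := by
  obtain ⟨g', hg', c, N, j, hN, hc, hf⟩ := hf
  refine ⟨_, mul_mem hg hg', _, _, i + j, mul_pos hN hM, periodic_mul hc hd, ?_⟩
  rcases hf with rfl | ⟨z, hz, rfl⟩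
  · left
    ext p
    simp only [Pi.mul_apply]
    ring
  · right
    refine ⟨z, hz, ?_⟩
    ext p
    simp only [Pi.mul_apply]
    ring

lemma mul_mem_terms_of_left {g : E → ℚ} (hg : g ∈ piecewiseQuasi E) {f : E × ℤ → ℚ}
    (hf : f ∈ terms E) : (fun p => g p.1 * f p) ∈ terms E := by
  have h : Function.Periodic (fun _ : ℤ => (1 : ℚ)) 1 := fun _ => rfl
  simpa using mul_mem_terms hg one_pos h 0 hf

lemma cut_mul_mem_span_terms {z : E → ℤ} (hz : IsCut z) {f : E × ℤ → ℚ} (hf : f ∈ terms E) :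
    (fun p => (if z p.1 < p.2 then 1 else 0) * f p) ∈ Submodule.span ℚ (terms E) := by
  obtain ⟨g, hg, c, N, j, hN, hc, rfl | ⟨w, hw, rfl⟩⟩ := hf
  · refine Submodule.subset_span ⟨g, hg, c, N, j, hN, hc, Or.inr ⟨z, hz, ?_⟩⟩
    ext p
    ring
  · obtain ⟨s, hs, hs', a, ha, ha1, ha0⟩ := exists_compare_cuts hz hw
    have h1 := mul_mem_terms_of_left ha ⟨g, hg, c, N, j, hN, hc, Or.inr ⟨z, hz, rfl⟩⟩
    have h2 := mul_mem_terms_of_left (sub_mem (one_mem _) ha)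
      ⟨g, hg, c, N, j, hN, hc, Or.inr ⟨w, hw, rfl⟩⟩
    convert add_mem (Submodule.subset_span (R := ℚ) h1) (Submodule.subset_span (R := ℚ) h2) using 1
    ext ⟨x, y⟩
    simp only [Pi.add_apply, Pi.sub_apply, Pi.one_apply]
    by_cases h : s x
    · have := hs x h
      rw [ha1 x h]
      by_cases hzy : z x < y
      · simp [hzy, this.trans_lt hzy]
      · simp [hzy]
    · have := hs' x h
      rw [ha0 x h]
      by_cases hwy : w x < y
      · simp [hwy, this.trans_lt hwy]
      · simp [hwy]

lemma hom_prod_int_apply (l : E × ℤ →+ ℤ) (x : E) (y : ℤ) :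
    l (x, y) = l.comp (AddMonoidHom.inl E ℤ) x + l (0, 1) * y := by
  have h : ((x, y) : E × ℤ) = (x, 0) + y • (0, 1) := by simp
  rw [h, map_add, map_zsmul]
  simp [mul_comm]

lemma periodic_emod_eq (N r : ℤ) :
    Function.Periodic (fun y : ℤ => if y % N = r then (1 : ℚ) else 0) N := fun y => by simp

lemma floor_mul_mem_span_terms (l : E × ℤ →+ ℤ) (k : ℤ) {N : ℤ} (hN : 0 < N) {f : E × ℤ → ℚ}
    (hf : f ∈ terms E) :
    (fun p => (((l p + k) / N : ℤ) : ℚ) * f p) ∈ Submodule.span ℚ (terms E) := by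
  set l₀ := l.comp (AddMonoidHom.inl E ℤ)
  set a := l (0, 1)
  have h1 : ∀ r : ℤ, (fun p : E × ℤ => (((l₀ p.1 + (a * r + k)) / N : ℤ) : ℚ) *
      ((if p.2 % N = r then 1 else 0) * (p.2 : ℚ) ^ 0) * f p) ∈ terms E := fun r =>
    mul_mem_terms (floor_mem l₀ (a * r + k) hN) hN (periodic_emod_eq N r) 0 hf
  have h2 : (fun p : E × ℤ => (a / N : ℚ) * (1 * (p.2 : ℚ) ^ 1) * f p) ∈ terms E :=
    mul_mem_terms (const_mem _) (d := fun _ => 1) one_pos (fun _ => rfl) 1 hf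
  have h3 : (fun p : E × ℤ => (-a / N : ℚ) * (((p.2 % N : ℤ) : ℚ) * (p.2 : ℚ) ^ 0) * f p) ∈
      terms E := mul_mem_terms (const_mem _) (d := fun y => ((y % N : ℤ) : ℚ)) hN
      (fun y => by simp) 0 hf
  convert add_mem (sum_mem (t := Finset.Ico 0 N) fun r _ => Submodule.subset_span (R := ℚ) (h1 r))
    (add_mem (Submodule.subset_span (R := ℚ) h2) (Submodule.subset_span (R := ℚ) h3)) using 1
  ext ⟨x, y⟩
  simp only [Pi.add_apply, Finset.sum_apply]
  rw [Finset.sum_eq_single (y % N) (by intro r _ hr; simp [hr.symm]) (fun h => absurd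
    (Finset.mem_Ico.mpr ⟨Int.emod_nonneg y hN.ne', Int.emod_lt_of_pos y hN⟩) h)]
  have h4 : (l (x, y) + k) / N = (l₀ x + (a * (y % N) + k)) / N + a * (y / N) := by
    rw [← Int.add_mul_ediv_left _ _ hN.ne', hom_prod_int_apply l x y]
    congr 1
    linear_combination -a * Int.emod_add_mul_ediv y N
  have h5 : (y : ℚ) = ((y % N : ℤ) : ℚ) + N * ((y / N : ℤ) : ℚ) := by
    exact_mod_cast (Int.emod_add_mul_ediv y N).symm
  have h6 : (N : ℚ) ≠ 0 := by exact_mod_cast hN.ne'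
  have h7 : ((y / N : ℤ) : ℚ) = (y - ((y % N : ℤ) : ℚ)) / N := by
    rw [eq_div_iff h6]
    linarith
  rw [h4, Int.cast_add, Int.cast_mul, h7]
  simp only [if_true]
  ring

lemma indicator_mul_mem_span_terms (l : E × ℤ →+ ℤ) {f : E × ℤ → ℚ} (hf : f ∈ terms E) :
    (fun p => (if 0 ≤ l p then 1 else 0) * f p) ∈ Submodule.span ℚ (terms E) := by
  set l₀ := l.comp (AddMonoidHom.inl E ℤ)
  set a := l (0, 1) with ha
  have hl : ∀ p : E × ℤ, l p = l₀ p.1 + a * p.2 := fun p => hom_prod_int_apply l p.1 p.2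
  simp only [hl]
  rcases lt_trichotomy a 0 with h | h | h
  · convert sub_mem (Submodule.subset_span (R := ℚ) hf)
      (cut_mul_mem_span_terms ⟨l₀, 0, -a, by omega, Or.inl rfl, rfl⟩ hf) using 1
    ext p
    simp only [Pi.sub_apply, Int.ediv_lt_iff_lt_mul (show 0 < -a by omega)]
    have : l₀ p.1 + 0 < p.2 * -a ↔ ¬ 0 ≤ l₀ p.1 + a * p.2 := by
      rw [mul_neg, mul_comm p.2 a]
      omega
    simp only [this]
    split_ifs <;> simp_all
  · simp only [h, zero_mul, add_zero]
    exact Submodule.subset_span (mul_mem_terms_of_left (indicator_nonneg_mem l₀) hf)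
  · convert cut_mul_mem_span_terms ⟨-l₀, -1, a, h, Or.inr rfl, rfl⟩ hf using 4
    rename_i p
    simp only [Int.ediv_lt_iff_lt_mul h, AddMonoidHom.neg_apply]
    rw [mul_comm p.2 a]
    omega

lemma piecewiseQuasi_le_span_terms {f : E × ℤ → ℚ} (hf : f ∈ piecewiseQuasi (E × ℤ)) :
    f ∈ Submodule.span ℚ (terms E) := by
  suffices h : ∀ s ∈ Submodule.span ℚ (terms E), f * s ∈ Submodule.span ℚ (terms E) by
    rw [← mul_one f]
    refine h _ (Submodule.subset_span ⟨1, one_mem _, 1, 1, 0, one_pos, fun _ => rfl, Or.inl ?_⟩)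
    ext p
    simp
  induction hf using Algebra.adjoin_induction with
  | mem f hf =>
    intro s hs
    induction hs using Submodule.span_induction with
    | mem s hs =>
      rcases hf with ⟨l, k, N, hN, rfl⟩ | ⟨l, rfl⟩
      · exact floor_mul_mem_span_terms l k hN hs
      · exact indicator_mul_mem_span_terms l hs
    | zero => simp
    | add s t _ _ hs ht => rw [mul_add]; exact add_mem hs ht
    | smul a s _ hs => rw [mul_smul_comm]; exact Submodule.smul_mem _ _ hs
  | algebraMap r =>
    intro s hs
    rw [← Algebra.smul_def]
    exact Submodule.smul_mem _ _ hs
  | add f g _ _ hf hg => exact fun s hs => by rw [add_mul]; exact add_mem (hf s hs) (hg s hs)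
  | mul f g _ _ hf hg => exact fun s hs => by rw [mul_assoc]; exact hf _ (hg s hs)

lemma exists_antidifference {f : E × ℤ → ℚ} (hf : f ∈ piecewiseQuasi (E × ℤ)) :
    ∃ F ∈ piecewiseQuasi (E × ℤ), ∀ x y, F (x, y) - F (x, y - 1) = f (x, y) := by
  have h := piecewiseQuasi_le_span_terms hf
  clear hf
  induction h using Submodule.span_induction with
  | mem f hf => exact exists_antidifference_of_term hf
  | zero => exact ⟨0, zero_mem _, by simp⟩
  | add f g _ _ hf hg =>
    obtain ⟨F, hF, hF'⟩ := hf
    obtain ⟨G, hG, hG'⟩ := hg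
    refine ⟨F + G, add_mem hF hG, fun x y => ?_⟩
    simp only [Pi.add_apply, ← hF', ← hG']
    ring
  | smul a f _ hf =>
    obtain ⟨F, hF, hF'⟩ := hf
    exact ⟨a • F, Subalgebra.smul_mem _ hF a, fun x y => by simp [← hF', mul_sub]⟩

lemma sum_Ioc_sub (F : ℤ → ℚ) {a b : ℤ} (h : a ≤ b) :
    ∑ y ∈ Finset.Ioc a b, (F y - F (y - 1)) = F b - F a := by
  induction b, h using Int.leInduction with
  | base => simp
  | succ b hab ih =>
    have : Finset.Ioc a (b + 1) = insert (b + 1) (Finset.Ioc a b) := by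
      ext y
      simp only [Finset.mem_Ioc, Finset.mem_insert]
      omega
    rw [this, Finset.sum_insert (by simp), ih]
    simp

lemma sum_Ioc_mem {f : E × ℤ → ℚ} (hf : f ∈ piecewiseQuasi (E × ℤ)) (M : E →+ ℤ) :
    (fun x => ∑ y ∈ Finset.Ioc (-M x) (M x), f (x, y)) ∈ piecewiseQuasi E := by
  obtain ⟨F, hF, hF'⟩ := exists_antidifference hf
  convert mul_mem (indicator_nonneg_mem M)
    (sub_mem (comp_mem ((AddMonoidHom.id E).prod M) hF)
      (comp_mem ((AddMonoidHom.id E).prod (-M)) hF)) using 1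
  ext x
  simp only [Pi.mul_apply, Pi.sub_apply, ← hF']
  by_cases h : 0 ≤ M x
  · rw [sum_Ioc_sub (fun y => F (x, y)) (by omega)]
    simp [h]
  · rw [Finset.Ioc_eq_empty (by omega)]
    simp [h]

lemma sum_box_mem (n : ℕ) : ∀ {E : Type} [AddCommGroup E] {f : E × (Fin n → ℤ) → ℚ},
    f ∈ piecewiseQuasi (E × (Fin n → ℤ)) → ∀ M : E →+ ℤ,
    (fun x => ∑ z ∈ Fintype.piFinset fun _ => Finset.Ioc (-M x) (M x), f (x, z)) ∈
      piecewiseQuasi E := by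
  induction n with
  | zero =>
    intro E _ f hf M
    convert comp_mem ((AddMonoidHom.id E).prod 0) hf using 2 with x
    simp
    rfl
  | succ n ih =>
    intro E _ f hf M
    let φ : (E × ℤ) × (Fin n → ℤ) →+ E × (Fin (n + 1) → ℤ) :=
      { toFun := fun p => (p.1.1, Fin.cons p.1.2 p.2)
        map_zero' := by
          ext i
          · rfl
          · refine Fin.cases ?_ (fun i => ?_) i <;> simp
        map_add' := fun p q => by
          ext i
          · rfl
          · refine Fin.cases ?_ (fun i => ?_) i <;> simp }
    convert sum_Ioc_mem (ih (comp_mem φ hf) (M.comp (AddMonoidHom.fst E ℤ))) M using 1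
    ext x
    simp only [AddMonoidHom.comp_apply, AddMonoidHom.coe_fst]
    rw [← Finset.sum_product']
    refine Finset.sum_nbij' (fun z => (z 0, Fin.tail z)) (fun p => Fin.cons p.1 p.2) ?_ ?_ ?_ ?_ ?_
    · intro z hz
      simp only [Fintype.mem_piFinset, Finset.mem_product] at hz ⊢
      exact ⟨hz 0, fun i => hz i.succ⟩
    · intro p hp
      simp only [Fintype.mem_piFinset, Finset.mem_product] at hp ⊢
      exact fun i => Fin.cases hp.1 hp.2 i
    · intro z _
      exact Fin.cons_self_tail z
    · intro p _
      simp
    · intro z _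
      simp [φ]

/-- On positive integers, a piecewise quasipolynomial function on `ℤ` is a quasipolynomial. -/
lemma exists_quasipolynomial {f : ℤ → ℚ} (hf : f ∈ piecewiseQuasi ℤ) :
    ∃ p : ℕ, 0 < p ∧ ∃ q : ZMod p → Polynomial ℚ, ∀ t : ℕ, 0 < t →
      f t = (q (t : ZMod p)).eval (t : ℚ) := by
  induction hf using Algebra.adjoin_induction with
  | mem f hf =>
    rcases hf with ⟨l, k, N, hN, rfl⟩ | ⟨l, rfl⟩
    · lift N to ℕ using hN.le
      have hN' : 0 < N := by exact_mod_cast hN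
      refine ⟨N, hN', fun r => Polynomial.C ((((l 1 * (r.val : ℤ) + k) / N : ℤ) : ℚ) -
        l 1 * r.val / N) + Polynomial.C (l 1 / N : ℚ) * Polynomial.X, fun t _ => ?_⟩
      have h1 : l (t : ℤ) = l 1 * t := by
        have := map_nsmul l t 1
        simpa [mul_comm] using this
      have h2 : (t : ℤ) = t % N + N * (t / N) := (Int.emod_add_mul_ediv _ _).symm
      have h3 : (l 1 * t + k) / (N : ℤ) = (l 1 * (t % N : ℤ) + k) / N + l 1 * (t / N) := by
        rw [← Int.add_mul_ediv_left _ _ hN.ne']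
        congr 1
        linear_combination l 1 * h2
      have h4 : (t : ℚ) = ((t % N : ℤ) : ℚ) + N * ((t / N : ℤ) : ℚ) := by exact_mod_cast h2
      have h5 : (N : ℚ) ≠ 0 := by positivity
      simp only [h1, h3, ZMod.val_natCast, Polynomial.eval_add, Polynomial.eval_mul,
        Polynomial.eval_C, Polynomial.eval_X]
      rw [← Int.natCast_mod] at h4 ⊢
      push_cast
      field_simp
      linear_combination -(l 1 : ℚ) * h4
    · refine ⟨1, one_pos, fun _ => Polynomial.C (if 0 ≤ l 1 then 1 else 0), fun t ht => ?_⟩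
      have h1 : l (t : ℤ) = t * l 1 := by
        have := map_nsmul l t 1
        simpa using this
      have h2 : 0 ≤ (t : ℤ) * l 1 ↔ 0 ≤ l 1 := mul_nonneg_iff_of_pos_left (by exact_mod_cast ht)
      simp only [h1, h2, Polynomial.eval_C]
  | algebraMap r => exact ⟨1, one_pos, fun _ => Polynomial.C r, fun t _ => by simp⟩
  | add f g _ _ hf hg =>
    obtain ⟨N, hN, q, hq⟩ := hf
    obtain ⟨M, hM, r, hr⟩ := hg
    refine ⟨N * M, Nat.mul_pos hN hM, fun a => q (ZMod.castHom (dvd_mul_right N M) _ a) +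
      r (ZMod.castHom (dvd_mul_left M N) _ a), fun t ht => ?_⟩
    simp only [map_natCast, Polynomial.eval_add, Pi.add_apply, hq t ht, hr t ht]
  | mul f g _ _ hf hg =>
    obtain ⟨N, hN, q, hq⟩ := hf
    obtain ⟨M, hM, r, hr⟩ := hg
    refine ⟨N * M, Nat.mul_pos hN hM, fun a => q (ZMod.castHom (dvd_mul_right N M) _ a) *
      r (ZMod.castHom (dvd_mul_left M N) _ a), fun t ht => ?_⟩
    simp only [map_natCast, Polynomial.eval_mul, Pi.mul_apply, hq t ht, hr t ht]

open scoped NNReal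

/-- Fourier–Motzkin elimination: a cone generated by finitely many vectors is cut out by finitely
many functionals from any group of functionals which takes integer values on the generators and
contains finitely many functionals cutting out the origin. -/
lemma exists_dual_description {F : Type*} [AddCommGroup F] [Module ℝ F]
    (A : AddSubgroup (F →ₗ[ℝ] ℝ)) (L₀ : Finset (F →ₗ[ℝ] ℝ)) (hL₀A : ∀ l ∈ L₀, l ∈ A)
    (hL₀ : ∀ x, (∀ l ∈ L₀, 0 ≤ l x) → x = 0) (W : Finset F)
    (hW : ∀ w ∈ W, ∀ l ∈ A, ∃ m : ℤ, l w = m) :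
    ∃ L : Finset (F →ₗ[ℝ] ℝ), (∀ l ∈ L, l ∈ A) ∧
      ∀ x, x ∈ Submodule.span ℝ≥0 (W : Set F) ↔ ∀ l ∈ L, 0 ≤ l x := by
  classical
  induction W using Finset.induction_on with
  | empty =>
    refine ⟨L₀, hL₀A, fun x => ?_⟩
    simp only [Finset.coe_empty, Submodule.span_empty, Submodule.mem_bot]
    exact ⟨fun h => by simp [h], hL₀ x⟩
  | insert w W _ ih =>
    obtain ⟨L, hLA, hL⟩ := ih fun v hv => hW v (Finset.mem_insert_of_mem hv)
    have hw := hW w (Finset.mem_insert_self w W)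
    have hstep : ∀ x, x ∈ Submodule.span ℝ≥0 ((insert w W : Finset F) : Set F) ↔
        ∃ a : ℝ, 0 ≤ a ∧ ∀ l ∈ L, a * l w ≤ l x := by
      intro x
      rw [Finset.coe_insert, Submodule.mem_span_insert]
      constructor
      · rintro ⟨a, z, hz, rfl⟩
        refine ⟨a, a.2, fun l hl => ?_⟩
        have := (hL z).mp hz l hl
        rw [map_add, NNReal.smul_def, map_smul, smul_eq_mul]
        linarith
      · rintro ⟨a, ha, h⟩
        refine ⟨a.toNNReal, x - a • w, (hL _).mpr fun l hl => ?_, ?_⟩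
        · rw [map_sub, map_smul, smul_eq_mul]
          linarith [h l hl]
        · rw [NNReal.smul_def, Real.coe_toNNReal a ha]
          simp
    let comb : (F →ₗ[ℝ] ℝ) × (F →ₗ[ℝ] ℝ) → (F →ₗ[ℝ] ℝ) := fun p => p.1 w • p.2 - p.2 w • p.1
    refine ⟨L.filter (fun l => 0 ≤ l w) ∪
      ((L.filter fun l => 0 < l w) ×ˢ (L.filter fun l => l w < 0)).image comb, ?_, fun x => ?_⟩
    · intro l hl
      rw [Finset.mem_union, Finset.mem_filter, Finset.mem_image] at hl
      rcases hl with hl | ⟨⟨l, m⟩, hlm, rfl⟩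
      · exact hLA l hl.1
      · simp only [Finset.mem_product, Finset.mem_filter] at hlm
        obtain ⟨a, ha⟩ := hw l (hLA l hlm.1.1)
        obtain ⟨b, hb⟩ := hw m (hLA m hlm.2.1)
        simp only [comb, ha, hb]
        have hz : ∀ (k : ℤ) (u : F →ₗ[ℝ] ℝ), (k : ℝ) • u = k • u := fun k u => by
          ext
          simp
        rw [hz, hz]
        exact sub_mem (zsmul_mem (hLA m hlm.2.1) a) (zsmul_mem (hLA l hlm.1.1) b)
    · rw [hstep]
      constructor
      · rintro ⟨a, ha, h⟩ l hl
        rw [Finset.mem_union, Finset.mem_filter, Finset.mem_image] at hl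
        rcases hl with hl | ⟨⟨l, m⟩, hlm, rfl⟩
        · exact (mul_nonneg ha hl.2).trans (h l hl.1)
        · simp only [Finset.mem_product, Finset.mem_filter] at hlm
          simp only [comb, LinearMap.sub_apply, LinearMap.smul_apply, smul_eq_mul]
          nlinarith [h l hlm.1.1, h m hlm.2.1]
      · intro h
        have hnn : ∀ l ∈ L, 0 ≤ l w → 0 ≤ l x := fun l hl hlw =>
          h l (Finset.mem_union_left _ (Finset.mem_filter.mpr ⟨hl, hlw⟩))
        have hpair : ∀ l ∈ L, ∀ m ∈ L, 0 < l w → m w < 0 → m x / m w ≤ l x / l w := by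
          intro l hl m hm hlw hmw
          have := h (comb (l, m)) (Finset.mem_union_right _ (Finset.mem_image_of_mem _
            (Finset.mem_product.mpr ⟨Finset.mem_filter.mpr ⟨hl, hlw⟩,
              Finset.mem_filter.mpr ⟨hm, hmw⟩⟩)))
          simp only [comb, LinearMap.sub_apply, LinearMap.smul_apply, smul_eq_mul] at this
          rw [le_div_iff₀ hlw, div_mul_eq_mul_div, div_le_iff_of_neg hmw]
          linarith
        let lower : Finset ℝ := insert 0 ((L.filter fun l => l w < 0).image fun l => l x / l w)
        have hne : lower.Nonempty := Finset.insert_nonempty _ _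
        refine ⟨lower.max' hne, lower.le_max' 0 (Finset.mem_insert_self _ _), fun l hl => ?_⟩
        rcases lt_trichotomy (l w) 0 with hlw | hlw | hlw
        · rw [← div_le_iff_of_neg hlw]
          exact lower.le_max' _ (Finset.mem_insert_of_mem (Finset.mem_image_of_mem _
            (Finset.mem_filter.mpr ⟨hl, hlw⟩)))
        · rw [hlw, mul_zero]
          exact hnn l hl hlw.ge
        · rw [← le_div_iff₀ hlw]
          refine Finset.max'_le _ _ _ fun a ha => ?_
          rw [Finset.mem_insert, Finset.mem_image] at ha
          rcases ha with rfl | ⟨m, hm, rfl⟩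
          · exact div_nonneg (hnn l hl hlw.le) hlw.le
          · rw [Finset.mem_filter] at hm
            exact hpair l hl m hm.1 hlw hm.2

/-- The functionals on `ℝⁿ × ℝ` that take integer values at integer points. -/
def integralFunctionals (n : ℕ) : AddSubgroup ((Fin n → ℝ) × ℝ →ₗ[ℝ] ℝ) where
  carrier := {l | ∀ (z : Fin n → ℤ) (t : ℤ), ∃ m : ℤ, l (fun i => (z i : ℝ), (t : ℝ)) = m}
  zero_mem' := fun _ _ => ⟨0, by simp⟩
  add_mem' := fun {l m} hl hm z t => by
    obtain ⟨a, ha⟩ := hl z t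
    obtain ⟨b, hb⟩ := hm z t
    exact ⟨a + b, by rw [LinearMap.add_apply, ha, hb, Int.cast_add]⟩
  neg_mem' := fun {l} hl z t => by
    obtain ⟨a, ha⟩ := hl z t
    exact ⟨-a, by rw [LinearMap.neg_apply, ha, Int.cast_neg]⟩

lemma exists_int_hom {n : ℕ} {l : (Fin n → ℝ) × ℝ →ₗ[ℝ] ℝ} (hl : l ∈ integralFunctionals n) :
    ∃ φ : ℤ × (Fin n → ℤ) →+ ℤ, ∀ (t : ℤ) (z : Fin n → ℤ),
      (φ (t, z) : ℝ) = l (fun i => (z i : ℝ), (t : ℝ)) := by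
  choose m hm using hl
  refine ⟨AddMonoidHom.mk' (fun p => m p.2 p.1) fun p q => ?_, fun t z => (hm z t).symm⟩
  have h : ((m (p + q).2 (p + q).1 : ℤ) : ℝ) = ((m p.2 p.1 + m q.2 q.1 : ℤ) : ℝ) := by
    rw [Int.cast_add, ← hm, ← hm, ← hm, ← map_add]
    congr 1
    ext <;> simp
  exact_mod_cast h

lemma exists_common_denominator {n : ℕ} {v : Fin n → ℝ} (hv : ∀ i, ∃ r : ℚ, v i = (r : ℝ)) :
    ∃ d : ℕ, 0 < d ∧ ∃ z : Fin n → ℤ, ∀ i, (d : ℝ) * v i = z i := by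
  choose r hr using hv
  refine ⟨∏ i, (r i).den, Finset.prod_pos fun i _ => (r i).den_pos, ?_⟩
  have h : ∀ i, ∃ m : ℤ, ((∏ j, (r j).den : ℕ) : ℝ) * v i = m := by
    intro i
    obtain ⟨k, hk⟩ := Finset.dvd_prod_of_mem (fun j => (r j).den) (Finset.mem_univ i)
    refine ⟨k * (r i).num, ?_⟩
    have h1 : ((r i).den : ℝ) * (r i : ℝ) = (r i).num := by
      exact_mod_cast Rat.den_mul_eq_num (r i)
    rw [hk, hr i]
    push_cast
    linear_combination (k : ℝ) * h1
  choose z hz using h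
  exact ⟨z, hz⟩

/-- The cone over a polytope: `x` lies in the dilate `t • conv V` iff `(x, t)` is a nonnegative
combination of positive multiples of the vectors `(v, 1)`. -/
lemma mem_smul_convexHull_iff {n : ℕ} (V : Finset (Fin n → ℝ)) {d : (Fin n → ℝ) → ℕ}
    (hd : ∀ v ∈ V, 0 < d v) {t : ℝ} (ht : 0 < t) (x : Fin n → ℝ) :
    x ∈ t • convexHull ℝ (V : Set (Fin n → ℝ)) ↔
      (x, t) ∈ Submodule.span ℝ≥0
        ((fun v => ((d v : ℝ) • v, (d v : ℝ))) '' (V : Set (Fin n → ℝ))) := by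
  rw [Set.mem_smul_set_iff_inv_smul_mem₀ ht.ne', Finset.mem_convexHull',
    Submodule.mem_span_image_finset_iff_exists_fun]
  constructor
  · rintro ⟨w, hw, hw1, hwx⟩
    refine ⟨fun v => (t * w v / d v).toNNReal, ?_⟩
    rw [Finset.sum_coe_sort V fun v => (t * w v / d v).toNNReal • ((d v : ℝ) • v, (d v : ℝ))]
    have h : ∀ v ∈ V, (t * w v / d v).toNNReal • ((d v : ℝ) • v, (d v : ℝ)) =
        t • (w v • v, w v) := by
      intro v hv
      have hdv : (0 : ℝ) < d v := by exact_mod_cast hd v hv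
      rw [NNReal.smul_def, Real.coe_toNNReal _ (by have := hw v hv; positivity)]
      ext
      · simp
        field_simp
      · simp
        field_simp
    rw [Finset.sum_congr rfl h, ← Finset.smul_sum]
    ext
    · simp only [Prod.smul_fst, Prod.fst_sum, hwx, smul_inv_smul₀ ht.ne']
    · simp only [Prod.smul_snd, Prod.snd_sum, hw1, smul_eq_mul, mul_one]
  · rintro ⟨c', hc'⟩
    obtain ⟨c, hc⟩ : ∃ c : (Fin n → ℝ) → ℝ≥0,
        ∑ v ∈ V, c v • ((d v : ℝ) • v, (d v : ℝ)) = (x, t) := by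
      classical
      refine ⟨fun v => if h : v ∈ V then c' ⟨v, h⟩ else 0, ?_⟩
      rw [← Finset.sum_coe_sort]
      simpa using hc'
    have h1 : ∑ v ∈ V, (c v : ℝ) • (d v : ℝ) • v = x := by
      simpa [Prod.fst_sum, NNReal.smul_def] using congrArg Prod.fst hc
    have h2 : ∑ v ∈ V, (c v : ℝ) * (d v : ℝ) = t := by
      simpa [Prod.snd_sum, NNReal.smul_def] using congrArg Prod.snd hc
    refine ⟨fun v => t⁻¹ * (c v * d v), fun v _ => by positivity, ?_, ?_⟩
    · rw [← Finset.mul_sum, h2, inv_mul_cancel₀ ht.ne']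
    · simp only [← h1, Finset.smul_sum, smul_smul]

/-- A rational polytope and its dilates are cut out by finitely many integral functionals. -/
lemma exists_halfspace_description {n : ℕ} (V : Finset (Fin n → ℝ))
    (hV : ∀ v ∈ V, ∀ i, ∃ r : ℚ, v i = (r : ℝ)) :
    ∃ L : Finset ((Fin n → ℝ) × ℝ →ₗ[ℝ] ℝ), (∀ l ∈ L, l ∈ integralFunctionals n) ∧
      ∀ t : ℝ, 0 < t → ∀ x, x ∈ t • convexHull ℝ (V : Set (Fin n → ℝ)) ↔
        ∀ l ∈ L, 0 ≤ l (x, t) := by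
  classical
  choose! d hd z hz using fun v (hv : v ∈ V) => exists_common_denominator (hV v hv)
  let coord : Option (Fin n) → ((Fin n → ℝ) × ℝ →ₗ[ℝ] ℝ) := fun o =>
    o.elim (LinearMap.snd ℝ _ _) fun i => (LinearMap.proj i).comp (LinearMap.fst ℝ _ _)
  have hcoord : ∀ o, coord o ∈ integralFunctionals n := by
    rintro (_ | i) z t
    · exact ⟨t, rfl⟩
    · exact ⟨z i, rfl⟩
  obtain ⟨L, hLA, hL⟩ := exists_dual_description (integralFunctionals n)
    (Finset.univ.image coord ∪ Finset.univ.image fun o => -coord o)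
    (by
      intro l hl
      simp only [Finset.mem_union, Finset.mem_image, Finset.mem_univ, true_and] at hl
      rcases hl with ⟨o, rfl⟩ | ⟨o, rfl⟩
      · exact hcoord o
      · exact neg_mem (hcoord o))
    (by
      intro x hx
      have h : ∀ o, coord o x = 0 := fun o => le_antisymm
        (by simpa using hx (-coord o) (Finset.mem_union_right _
          (Finset.mem_image_of_mem (fun o => -coord o) (Finset.mem_univ o))))
        (hx _ (Finset.mem_union_left _ (Finset.mem_image_of_mem _ (Finset.mem_univ o))))
      ext i
      · exact h (some i)
      · exact h none)
    (V.image fun v => ((d v : ℝ) • v, (d v : ℝ)))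
    (by
      intro w hw l hl
      obtain ⟨v, hv, rfl⟩ := Finset.mem_image.mp hw
      obtain ⟨m, hm⟩ := hl (z v) (d v)
      refine ⟨m, ?_⟩
      rw [← hm]
      congr 2
      ext i
      exact hz v hv i)
  refine ⟨L, hLA, fun t ht x => ?_⟩
  rw [mem_smul_convexHull_iff V hd ht, ← hL, Finset.coe_image]

lemma interior_halfspaces {n : ℕ} (L : Finset ((Fin n → ℝ) × ℝ →ₗ[ℝ] ℝ)) (t : ℝ)
    (S : Set (Fin n → ℝ)) (hS : ∀ x, x ∈ S ↔ ∀ l ∈ L, 0 ≤ l (x, t)) (hne : S.Nonempty)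
    (x : Fin n → ℝ) :
    x ∈ interior S ↔ ∀ l ∈ L, (∃ v, l (v, 0) ≠ 0) → 0 < l (x, t) := by
  classical
  have hadd : ∀ (l : (Fin n → ℝ) × ℝ →ₗ[ℝ] ℝ) (u v : Fin n → ℝ),
      l (u + v, t) = l (u, t) + l (v, 0) := fun l u v => by
    rw [← map_add]
    simp
  constructor
  · rintro hx l hl ⟨v, hv⟩
    obtain ⟨v, hv⟩ : ∃ v, l (v, 0) < 0 := by
      rcases lt_or_gt_of_ne hv with h | h
      · exact ⟨v, h⟩
      · refine ⟨-v, ?_⟩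
        have : ((-v, 0) : (Fin n → ℝ) × ℝ) = -(v, 0) := by simp
        rw [this, map_neg]
        linarith
    have hcont : Filter.Tendsto (fun ε : ℝ => x + ε • v) (nhdsWithin 0 (Set.Ioi 0)) (nhds x) := by
      have : Continuous fun ε : ℝ => x + ε • v := by fun_prop
      simpa using (this.tendsto 0).mono_left nhdsWithin_le_nhds
    obtain ⟨ε, hε, hε0⟩ := ((hcont.eventually (mem_interior_iff_mem_nhds.mp hx)).and
      self_mem_nhdsWithin).exists
    have h := (hS _).mp hε l hl
    have hsmul : l (ε • v, 0) = ε * l (v, 0) := by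
      rw [← smul_eq_mul, ← map_smul]
      simp
    rw [hadd, hsmul] at h
    have := mul_neg_of_pos_of_neg (Set.mem_Ioi.mp hε0) hv
    linarith
  · intro hx
    obtain ⟨x₀, hx₀⟩ := hne
    refine mem_interior.mpr
      ⟨⋂ l ∈ L.filter (fun l => ∃ v, l (v, 0) ≠ 0), {y | 0 < l (y, t)}, ?_, ?_, ?_⟩
    · intro y hy
      simp only [Set.mem_iInter, Finset.mem_filter, Set.mem_ofPred_eq] at hy
      refine (hS y).mpr fun l hl => ?_
      by_cases h : ∃ v, l (v, 0) ≠ 0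
      · exact (hy l ⟨hl, h⟩).le
      · push Not at h
        have h1 := hadd l x₀ (y - x₀)
        rw [add_sub_cancel, h, add_zero] at h1
        rw [h1]
        exact (hS x₀).mp hx₀ l hl
    · refine isOpen_biInter_finset fun l _ => ?_
      have := l.continuous_of_finiteDimensional
      exact isOpen_lt continuous_const (by fun_prop)
    · simp only [Set.mem_iInter, Finset.mem_filter, Set.mem_ofPred_eq]
      exact fun l hl => hx l hl.1 hl.2

end LatticePointCount

open LatticePointCount in
/-- **Ehrhart quasipolynomiality of the interior lattice-point count.**
If `P ⊆ ℝⁿ` is an `n`-dimensional rational polytope (the convex hull of finitely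
many rational points, with nonempty interior), then there are a positive integer `p`
and polynomials `q_r ∈ ℚ[x]`, indexed by `r ∈ ℤ/p`, such that for every positive
integer `t` the number of lattice points in the interior of the dilate `t • P`
equals `q_{t mod p}(t)`. -/
theorem ehrhart_interior_quasipolynomial
    (n : ℕ) (V : Finset (Fin n → ℝ))
    (hV : ∀ v ∈ V, ∀ i, ∃ r : ℚ, v i = (r : ℝ))
    (P : Set (Fin n → ℝ)) (hP : P = convexHull ℝ (V : Set (Fin n → ℝ)))
    (hdim : (interior P).Nonempty) :
    ∃ p : ℕ, 0 < p ∧ ∃ q : ZMod p → Polynomial ℚ,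
      ∀ t : ℕ, 0 < t →
        (({x : Fin n → ℝ | x ∈ interior ((t : ℝ) • P) ∧ ∀ i, ∃ m : ℤ, x i = (m : ℝ)}.ncard : ℚ)
          = (q (t : ZMod p)).eval (t : ℚ)) := by
  classical
  obtain ⟨L, hLA, hL⟩ := exists_halfspace_description V hV
  rw [← hP] at hL
  choose! φ hφ using fun l (hl : l ∈ L) => exists_int_hom (hLA l hl)
  obtain ⟨M, hM⟩ : ∃ M : ℤ, ∀ x ∈ P, ∀ i, |x i| < M := by
    have hb : Bornology.IsBounded P := by
      rw [hP, isBounded_convexHull]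
      exact V.finite_toSet.isBounded
    obtain ⟨C, hC⟩ := hb.exists_norm_le
    obtain ⟨M, hM⟩ := exists_int_gt C
    exact ⟨M, fun x hx i => ((norm_le_pi_norm x i).trans (hC x hx)).trans_lt hM⟩
  let L' := L.filter fun l => ∃ v, l (v, 0) ≠ 0
  let f : ℤ × (Fin n → ℤ) → ℚ := ∏ l ∈ L', fun p => if 0 < φ l p then 1 else 0
  have hf : f ∈ piecewiseQuasi (ℤ × (Fin n → ℤ)) :=
    prod_mem fun l _ => indicator_pos_mem (φ l)
  obtain ⟨p, hp, q, hq⟩ := exists_quasipolynomial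
    (sum_box_mem n hf (AddMonoidHom.mulLeft M))
  refine ⟨p, hp, q, fun t ht => ?_⟩
  rw [← hq t ht]
  have ht' : (0 : ℝ) < t := by exact_mod_cast ht
  have hinterior : ∀ z : Fin n → ℤ, (fun i => (z i : ℝ)) ∈ interior ((t : ℝ) • P) ↔
      ∀ l ∈ L', 0 < φ l (t, z) := by
    intro z
    rw [interior_halfspaces L t _ (hL t ht') ((hdim.mono interior_subset).smul_set)]
    simp only [L', Finset.mem_filter, and_imp]
    refine forall₃_congr fun l hl _ => ?_
    rw [← Int.cast_pos (R := ℝ), hφ l hl, Int.cast_natCast]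
  have hset : {x : Fin n → ℝ | x ∈ interior ((t : ℝ) • P) ∧ ∀ i, ∃ m : ℤ, x i = (m : ℝ)} =
      (fun (z : Fin n → ℤ) i => (z i : ℝ)) ''
        ((Fintype.piFinset fun _ => Finset.Ioc (-(M * (t : ℤ))) (M * t)).filter
          fun z => ∀ l ∈ L', 0 < φ l (t, z) : Finset (Fin n → ℤ)) := by
    ext x
    simp only [Set.mem_ofPred_eq, Finset.coe_filter, Set.mem_image]
    constructor
    · rintro ⟨hx, hxz⟩
      choose z hz using hxz
      obtain rfl : x = fun i => (z i : ℝ) := funext hz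
      refine ⟨z, ⟨Fintype.mem_piFinset.mpr fun i => ?_, (hinterior z).mp hx⟩, rfl⟩
      obtain ⟨y, hy, hyz⟩ := interior_subset hx
      have h1 : (t : ℝ) * y i = z i := congrFun hyz i
      have h2 := abs_lt.mp (hM y hy i)
      rw [Finset.mem_Ioc]
      constructor
      · have : ((-(M * (t : ℤ)) : ℤ) : ℝ) < z i := by
          push_cast
          rw [← h1]
          nlinarith [h2.1]
        exact_mod_cast this
      · have : (z i : ℝ) ≤ ((M * (t : ℤ) : ℤ) : ℝ) := by
          push_cast
          rw [← h1]
          nlinarith [h2.2]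
        exact_mod_cast this
    · rintro ⟨z, ⟨-, hz⟩, rfl⟩
      exact ⟨(hinterior z).mpr hz, fun i => ⟨z i, rfl⟩⟩
  rw [hset, Set.ncard_image_of_injective _ fun z w h => funext fun i => by
    exact_mod_cast congrFun h i, Set.ncard_coe_finset, Finset.card_filter]
  push_cast
  refine Finset.sum_congr rfl fun z _ => ?_
  rw [show f (t, z) = _ from Finset.prod_apply _ _ _, Finset.prod_boole]
end

section
/- Let P ⊂ ℝ^n be an n-dimensional rational polytope. Then the closed lattice-point counting function is a quasipolynomial: there exist a positive integer p and polynomials q_0, …, q_{p-1} ∈ ℚ[x] such that for every positive integer t, the number of points of ℤ^n lying in the dilate tP = {t·x : x ∈ P} equals q_{t mod p}(t). -/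
open Pointwise

/-- The Iverson bracket of a proposition, with values in `ℚ`. -/
noncomputable def iverson (p : Prop) : ℚ := by
  classical exact if p then 1 else 0

theorem iverson_of {p : Prop} (h : p) : iverson p = 1 := by simp [iverson, h]

theorem iverson_of_not {p : Prop} (h : ¬p) : iverson p = 0 := by simp [iverson, h]

theorem iverson_not (p : Prop) : iverson (¬p) = 1 - iverson p := by
  by_cases h : p <;> simp [iverson, h]

theorem iverson_and (p q : Prop) : iverson (p ∧ q) = iverson p * iverson q := by
  by_cases hp : p
  · simp only [hp, true_and, iverson_of, one_mul]
  · rw [iverson_of_not hp, iverson_of_not fun h => hp h.1, zero_mul]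

/-- A function on `ℤ` given by a polynomial whose coefficients are periodic. -/
def IsQuasiPoly (f : ℤ → ℚ) : Prop :=
  ∃ N : ℤ, 0 < N ∧ ∃ q : ℤ → Polynomial ℚ, Function.Periodic q N ∧
    ∀ y : ℤ, f y = (q y).eval (y : ℚ)

namespace IsQuasiPoly

theorem of_polynomial (q : Polynomial ℚ) : IsQuasiPoly fun y => q.eval (y : ℚ) :=
  ⟨1, one_pos, fun _ => q, fun _ => rfl, fun _ => rfl⟩

theorem of_periodic {g : ℤ → ℚ} {N : ℤ} (hN : 0 < N) (hg : Function.Periodic g N) :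
    IsQuasiPoly g :=
  ⟨N, hN, fun y => Polynomial.C (g y), fun y => by simp only [hg y], fun y => by simp⟩

theorem exists_common_period {α β : Type*} {f : ℤ → α} {g : ℤ → β} {N K : ℤ}
    (hf : Function.Periodic f N) (hg : Function.Periodic g K) :
    Function.Periodic f (N * K) ∧ Function.Periodic g (N * K) := by
  refine ⟨?_, hg.int_mul N⟩
  rw [mul_comm]
  exact hf.int_mul K

theorem add {f g : ℤ → ℚ} (hf : IsQuasiPoly f) (hg : IsQuasiPoly g) :
    IsQuasiPoly fun y => f y + g y := by
  obtain ⟨N, hN, q, hq, hf⟩ := hf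
  obtain ⟨K, hK, r, hr, hg⟩ := hg
  obtain ⟨hq, hr⟩ := exists_common_period hq hr
  exact ⟨N * K, mul_pos hN hK, fun y => q y + r y, fun y => by simp only [hq y, hr y],
    fun y => by simp [hf, hg]⟩

theorem mul {f g : ℤ → ℚ} (hf : IsQuasiPoly f) (hg : IsQuasiPoly g) :
    IsQuasiPoly fun y => f y * g y := by
  obtain ⟨N, hN, q, hq, hf⟩ := hf
  obtain ⟨K, hK, r, hr, hg⟩ := hg
  obtain ⟨hq, hr⟩ := exists_common_period hq hr
  exact ⟨N * K, mul_pos hN hK, fun y => q y * r y, fun y => by simp only [hq y, hr y],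
    fun y => by simp [hf, hg]⟩

theorem comp_neg {f : ℤ → ℚ} (hf : IsQuasiPoly f) : IsQuasiPoly fun y => f (-y) := by
  obtain ⟨N, hN, q, hq, hf⟩ := hf
  refine ⟨N, hN, fun y => (q (-y)).comp (-Polynomial.X), fun y => ?_, fun y => by simp [hf]⟩
  have : q (-(y + N)) = q (-y) := by rw [← hq (-(y + N))]; congr 1; ring
  simp only [this]

theorem comp_add_const {f : ℤ → ℚ} (hf : IsQuasiPoly f) (a : ℤ) :
    IsQuasiPoly fun y => f (y + a) := by
  obtain ⟨N, hN, q, hq, hf⟩ := hf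
  refine ⟨N, hN, fun y => (q (y + a)).comp (Polynomial.X + Polynomial.C (a : ℚ)),
    fun y => ?_, fun y => by simp [hf]⟩
  have : q (y + N + a) = q (y + a) := by rw [← hq (y + a)]; congr 1; ring
  simp only [this]

theorem comp_ediv {f : ℤ → ℚ} (hf : IsQuasiPoly f) {c : ℤ} (hc : 0 < c) :
    IsQuasiPoly fun y => f (y / c) := by
  obtain ⟨N, hN, q, hq, hf⟩ := hf
  refine ⟨c * N, mul_pos hc hN, fun y => (q (y / c)).comp
    (Polynomial.C ((c : ℚ)⁻¹) * (Polynomial.X - Polynomial.C ((y % c : ℤ) : ℚ))),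
    fun y => ?_, fun y => ?_⟩
  · have h1 : (y + c * N) / c = y / c + N := Int.add_mul_ediv_left _ _ hc.ne'
    have h2 : (y + c * N) % c = y % c := Int.add_mul_emod_self_left _ _ _
    simp only [h1, h2, hq (y / c)]
  · have h : (y : ℚ) = c * ((y / c : ℤ) : ℚ) + ((y % c : ℤ) : ℚ) := by
      exact_mod_cast (Int.mul_ediv_add_emod y c).symm
    have hc' : (c : ℚ) ≠ 0 := by exact_mod_cast hc.ne'
    simp only [hf, Polynomial.eval_comp, Polynomial.eval_mul, Polynomial.eval_C,
      Polynomial.eval_sub, Polynomial.eval_X]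
    congr 1
    rw [eq_inv_mul_iff_mul_eq₀ hc']
    linarith

end IsQuasiPoly

/-- Every polynomial is the difference, with any nonzero step, of another polynomial. -/
theorem Polynomial.exists_eval_add_sub_eval (q : Polynomial ℚ) {N : ℚ} (hN : N ≠ 0) :
    ∃ Q : Polynomial ℚ, ∀ x, Q.eval (x + N) - Q.eval x = q.eval x := by
  induction q using Polynomial.induction_on' with
  | add p q hp hq =>
    obtain ⟨P, hP⟩ := hp
    obtain ⟨Q, hQ⟩ := hq
    refine ⟨P + Q, fun x => ?_⟩
    simp only [Polynomial.eval_add, ← hP, ← hQ]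
    ring
  | monomial k a =>
    refine ⟨C (a * N ^ k / (k + 1)) * (Polynomial.bernoulli (k + 1)).comp (C N⁻¹ * X), fun x => ?_⟩
    have h := Polynomial.bernoulli_eval_one_add (k + 1) (N⁻¹ * x)
    have h' : N⁻¹ * (x + N) = 1 + N⁻¹ * x := by field_simp; ring
    simp only [Polynomial.eval_mul, Polynomial.eval_C, Polynomial.eval_comp, Polynomial.eval_X,
      h', h, Polynomial.eval_monomial]
    have : (k : ℚ) + 1 ≠ 0 := by positivity
    push_cast
    simp only [mul_pow, inv_pow]
    field_simp
    ring

/-- Every quasipolynomial has a quasipolynomial antidifference. -/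
theorem IsQuasiPoly.exists_antidifference {u : ℤ → ℚ} (hu : IsQuasiPoly u) :
    ∃ v, IsQuasiPoly v ∧ ∀ y, v (y + 1) - v y = u y := by
  obtain ⟨N, hN, q, hq, hu⟩ := hu
  lift N to ℕ using hN.le
  have hN0 : ((N : ℤ) : ℚ) ≠ 0 := by exact_mod_cast hN.ne'
  choose S hS using fun q : Polynomial ℚ => q.exists_eval_add_sub_eval hN0
  let w : ℤ → ℚ := fun y => (S (q y)).eval (y : ℚ)
  have hw : ∀ y, w (y + N) - w y = u y := fun y => by
    simp only [w, hq y, hu y, ← hS (q y)]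
    push_cast
    rfl
  have hwq : IsQuasiPoly w := ⟨N, hN, fun y => S (q y), fun y => by simp only [hq y], fun _ => rfl⟩
  have hsum : ∀ k : ℕ, IsQuasiPoly fun y => ∑ i ∈ Finset.range k, w (y + (i : ℤ)) := by
    intro k
    induction k with
    | zero => simpa using IsQuasiPoly.of_polynomial 0
    | succ k ih =>
      simp only [Finset.sum_range_succ]
      exact ih.add (hwq.comp_add_const k)
  refine ⟨_, hsum N, fun y => ?_⟩
  rw [← hw y, ← Finset.sum_sub_distrib]
  have := Finset.sum_range_sub (fun i : ℕ => w (y + i)) N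
  simp only [Nat.cast_zero, add_zero] at this
  rw [← this]
  refine Finset.sum_congr rfl fun i _ => ?_
  congr 2
  push_cast
  ring

theorem sum_Ico_eq_sub_of_antidifference {u v : ℤ → ℚ} (h : ∀ y, v (y + 1) - v y = u y)
    (a b : ℤ) : ∑ y ∈ Finset.Ico a b, u y = v (max a b) - v a := by
  rcases le_total b a with hab | hab
  · simp [hab]
  · rw [max_eq_right hab]
    induction b, hab using Int.leInduction with
    | base => simp
    | succ b hab ih =>
      rw [← Finset.insert_Ico_right_eq_Ico_add_one hab, Finset.sum_insert (by simp), ih, ← h b]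
      ring

section PiecewiseQuasiPoly

variable {M : Type*} [AddCommGroup M]

/-- Generators of the algebra of conically piecewise quasipolynomial functions. -/
inductive IsPiecewiseGen : (M → ℚ) → Prop
  | lin (φ : M →+ ℤ) : IsPiecewiseGen fun x => (φ x : ℚ)
  | periodic (φ : M →+ ℤ) (g : ℤ → ℚ) (N : ℤ) (hN : 0 < N) (hg : Function.Periodic g N) :
      IsPiecewiseGen fun x => g (φ x)
  | nonneg (φ : M →+ ℤ) : IsPiecewiseGen fun x => iverson (0 ≤ φ x)

variable (M) in
/-- The algebra of functions that are quasipolynomial on each cone of some decomposition of `M`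
by finitely many homogeneous linear inequalities. -/
def piecewiseQuasiPoly : Subalgebra ℚ (M → ℚ) := Algebra.adjoin ℚ {f | IsPiecewiseGen f}

theorem IsPiecewiseGen.mem {f : M → ℚ} (hf : IsPiecewiseGen f) : f ∈ piecewiseQuasiPoly M :=
  Algebra.subset_adjoin hf

theorem piecewiseQuasiPoly_comp {M' : Type*} [AddCommGroup M'] {f : M → ℚ}
    (hf : f ∈ piecewiseQuasiPoly M) (h : M' →+ M) :
    (fun x => f (h x)) ∈ piecewiseQuasiPoly M' := by
  induction hf using Algebra.adjoin_induction with
  | mem f hf =>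
    cases hf with
    | lin φ => exact (IsPiecewiseGen.lin (φ.comp h)).mem
    | periodic φ g N hN hg => exact (IsPiecewiseGen.periodic (φ.comp h) g N hN hg).mem
    | nonneg φ => exact (IsPiecewiseGen.nonneg (φ.comp h)).mem
  | algebraMap r => exact (piecewiseQuasiPoly M').algebraMap_mem r
  | add f g _ _ hf hg => exact add_mem hf hg
  | mul f g _ _ hf hg => exact mul_mem hf hg

theorem IsQuasiPoly.comp_mem {u : ℤ → ℚ} (hu : IsQuasiPoly u) (φ : M →+ ℤ) :
    (fun x => u (φ x)) ∈ piecewiseQuasiPoly M := by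
  obtain ⟨N, hN, q, hq, hu⟩ := hu
  have key : (fun x => u (φ x)) = ∑ s ∈ Finset.Ico 0 N, (fun x => iverson (φ x % N = s)) *
      Polynomial.aeval (fun x => (φ x : ℚ)) (q s) := by
    ext x
    rw [Finset.sum_apply, Finset.sum_eq_single (φ x % N)]
    · have hmod : q (φ x % N) = q (φ x) := by
        conv_rhs => rw [← Int.emod_add_mul_ediv (φ x) N, mul_comm]
        exact ((hq.int_mul (φ x / N)) _).symm
      rw [Pi.mul_apply, Polynomial.aeval_fn_apply, iverson_of rfl, one_mul, hmod, hu]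
      simp
    · intro s _ hs
      rw [Pi.mul_apply, iverson_of_not (Ne.symm hs), zero_mul]
    · intro h
      exact absurd (Finset.mem_Ico.2 ⟨Int.emod_nonneg _ hN.ne', Int.emod_lt_of_pos _ hN⟩) h
  rw [key]
  refine sum_mem fun s _ => mul_mem ?_ ?_
  · exact (IsPiecewiseGen.periodic φ (fun y => iverson (y % N = s)) N hN fun y => by simp).mem
  · exact Algebra.adjoin_mono (Set.singleton_subset_iff.2 (IsPiecewiseGen.lin φ))
      (Polynomial.aeval_mem_adjoin_singleton ℚ _)

/-- Functions `θ` such that `θ x ≤ y` is a homogeneous linear inequality in `(x, y)`, possibly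
strict. -/
def IsThreshold (θ : M → ℤ) : Prop :=
  ∃ (ψ : M →+ ℤ) (c : ℤ), 0 < c ∧
    ((∀ x y, θ x ≤ y ↔ 0 ≤ ψ x + c * y) ∨ (∀ x y, θ x ≤ y ↔ 0 < ψ x + c * y))

theorem IsThreshold.of_hom (φ : M →+ ℤ) : IsThreshold fun x => φ x :=
  ⟨-φ, 1, one_pos, Or.inl fun x y => by simp⟩

theorem exists_isThreshold_nonneg (ψ : M →+ ℤ) {c : ℤ} (hc : 0 < c) :
    ∃ θ : M → ℤ, IsThreshold θ ∧ ∀ x y, θ x ≤ y ↔ 0 ≤ ψ x + c * y := by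
  have h : ∀ x y, -(ψ x / c) ≤ y ↔ 0 ≤ ψ x + c * y := fun x y => by
    rw [neg_le, Int.le_ediv_iff_mul_le hc]
    constructor <;> intro h <;> linarith
  exact ⟨_, ⟨ψ, c, hc, Or.inl h⟩, h⟩

theorem exists_isThreshold_pos (ψ : M →+ ℤ) {c : ℤ} (hc : 0 < c) :
    ∃ θ : M → ℤ, IsThreshold θ ∧ ∀ x y, θ x ≤ y ↔ 0 < ψ x + c * y := by
  have h : ∀ x y, (-ψ x) / c + 1 ≤ y ↔ 0 < ψ x + c * y := fun x y => by
    rw [Int.add_one_le_iff, Int.ediv_lt_iff_lt_mul hc]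
    constructor <;> intro h <;> linarith
  exact ⟨_, ⟨ψ, c, hc, Or.inr h⟩, h⟩

theorem IsQuasiPoly.comp_threshold_mem {u : ℤ → ℚ} (hu : IsQuasiPoly u) {θ : M → ℤ}
    (hθ : IsThreshold θ) : (fun x => u (θ x)) ∈ piecewiseQuasiPoly M := by
  obtain ⟨ψ, c, hc, h | h⟩ := hθ
  · have : θ = fun x => -(ψ x / c) := by
      ext x
      refine eq_of_forall_ge_iff fun y => ?_
      rw [h, neg_le, Int.le_ediv_iff_mul_le hc]
      constructor <;> intro h <;> linarith
    subst this
    exact (hu.comp_neg.comp_ediv hc).comp_mem ψ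
  · have : θ = fun x => (-ψ) x / c + 1 := by
      ext x
      refine eq_of_forall_ge_iff fun y => ?_
      rw [h, Int.add_one_le_iff, Int.ediv_lt_iff_lt_mul hc, AddMonoidHom.neg_apply]
      constructor <;> intro h <;> linarith
    subst this
    exact ((hu.comp_add_const 1).comp_ediv hc).comp_mem (-ψ)

/-- Two thresholds are compared by a homogeneous linear inequality. -/
theorem IsThreshold.exists_compare {θ₁ θ₂ : M → ℤ} (h₁ : IsThreshold θ₁) (h₂ : IsThreshold θ₂) :
    ∃ D : M → Prop, (fun x => iverson (D x)) ∈ piecewiseQuasiPoly M ∧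
      ∀ x, (D x → θ₁ x ≤ θ₂ x) ∧ (¬D x → θ₂ x ≤ θ₁ x) := by
  obtain ⟨ψ₁, c₁, hc₁, h₁⟩ := h₁
  obtain ⟨ψ₂, c₂, hc₂, h₂⟩ := h₂
  have weak : (fun x => iverson (0 ≤ (c₂ • ψ₁ - c₁ • ψ₂) x)) ∈ piecewiseQuasiPoly M :=
    (IsPiecewiseGen.nonneg _).mem
  have strict : (fun x => iverson (¬0 ≤ (c₁ • ψ₂ - c₂ • ψ₁) x)) ∈ piecewiseQuasiPoly M := by
    simp only [iverson_not]
    exact sub_mem (one_mem _) (IsPiecewiseGen.nonneg _).mem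
  rcases h₁ with h₁ | h₁ <;> rcases h₂ with h₂ | h₂
  on_goal 3 => refine ⟨_, strict, fun x => ?_⟩
  on_goal 1 => refine ⟨_, weak, fun x => ?_⟩
  on_goal 2 => refine ⟨_, weak, fun x => ?_⟩
  on_goal 4 => refine ⟨_, weak, fun x => ?_⟩
  all_goals
    have e₁ := (h₁ x (θ₁ x)).1 le_rfl
    have e₂ := (h₂ x (θ₂ x)).1 le_rfl
    simp only [AddMonoidHom.sub_apply, AddMonoidHom.smul_apply, smul_eq_mul, h₁, h₂, not_le,
      not_lt, sub_nonneg]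
    constructor <;> intro h <;> by_contra! hn <;> nlinarith

theorem sum_Ico_threshold_mem {u : ℤ → ℚ} (hu : IsQuasiPoly u) {θ ζ : M → ℤ}
    (hθ : IsThreshold θ) (hζ : IsThreshold ζ) :
    (fun x => ∑ y ∈ Finset.Ico (θ x) (ζ x), u y) ∈ piecewiseQuasiPoly M := by
  obtain ⟨v, hv, hvu⟩ := hu.exists_antidifference
  obtain ⟨D, hD, h⟩ := hθ.exists_compare hζ
  have key : (fun x => ∑ y ∈ Finset.Ico (θ x) (ζ x), u y) =
      (fun x => iverson (D x)) * ((fun x => v (ζ x)) - fun x => v (θ x)) := by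
    ext x
    rw [sum_Ico_eq_sub_of_antidifference hvu]
    by_cases hx : D x
    · simp [iverson_of hx, (h x).1 hx]
    · simp [iverson_of_not hx, (h x).2 hx]
  rw [key]
  exact mul_mem hD (sub_mem (hv.comp_threshold_mem hζ) (hv.comp_threshold_mem hθ))

variable (M) in
/-- The span of products of a piecewise quasipolynomial in `x`, a quasipolynomial in `y` and the
bracket of a single lower bound on `y`. -/
def lowerBoundSpan : Submodule ℚ (M × ℤ → ℚ) :=
  Submodule.span ℚ {f | ∃ α ∈ piecewiseQuasiPoly M, ∃ u, IsQuasiPoly u ∧ ∃ θ, IsThreshold θ ∧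
    f = fun p => α p.1 * u p.2 * iverson (θ p.1 ≤ p.2)}

theorem mem_lowerBoundSpan {α : M → ℚ} (hα : α ∈ piecewiseQuasiPoly M) {u : ℤ → ℚ}
    (hu : IsQuasiPoly u) {θ : M → ℤ} (hθ : IsThreshold θ) :
    (fun p : M × ℤ => α p.1 * u p.2 * iverson (θ p.1 ≤ p.2)) ∈ lowerBoundSpan M :=
  Submodule.subset_span ⟨α, hα, u, hu, θ, hθ, rfl⟩

theorem mul_bracket_mem_lowerBoundSpan {α : M → ℚ} (hα : α ∈ piecewiseQuasiPoly M) {u : ℤ → ℚ}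
    (hu : IsQuasiPoly u) {θ η : M → ℤ} (hθ : IsThreshold θ) (hη : IsThreshold η) :
    (fun p : M × ℤ => iverson (η p.1 ≤ p.2) * (α p.1 * u p.2 * iverson (θ p.1 ≤ p.2))) ∈
      lowerBoundSpan M := by
  obtain ⟨D, hD, h⟩ := hθ.exists_compare hη
  convert add_mem (mem_lowerBoundSpan (mul_mem hD hα) hu hη)
    (mem_lowerBoundSpan (mul_mem (sub_mem (one_mem _) hD) hα) hu hθ) using 1
  ext ⟨x, y⟩
  simp only [Pi.add_apply, Pi.mul_apply, Pi.sub_apply, Pi.one_apply]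
  by_cases hx : D x
  · rw [iverson_of hx]
    by_cases hy : η x ≤ y
    · rw [iverson_of hy, iverson_of (((h x).1 hx).trans hy)]
      ring
    · rw [iverson_of_not hy]
      ring
  · rw [iverson_of_not hx]
    by_cases hy : θ x ≤ y
    · rw [iverson_of hy, iverson_of (((h x).2 hx).trans hy)]
      ring
    · rw [iverson_of_not hy]
      ring

theorem AddMonoidHom.apply_prod_int (φ : M × ℤ →+ ℤ) (p : M × ℤ) :
    φ p = φ.comp (AddMonoidHom.inl M ℤ) p.1 + φ (0, 1) * p.2 := by
  have : p = (p.1, 0) + p.2 • ((0 : M), (1 : ℤ)) := by ext <;> simp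
  conv_lhs => rw [this, map_add, map_zsmul, smul_eq_mul, mul_comm]
  rfl

theorem IsPiecewiseGen.mul_mem_lowerBoundSpan {e f : M × ℤ → ℚ} (he : IsPiecewiseGen e)
    (hf : f ∈ lowerBoundSpan M) : e * f ∈ lowerBoundSpan M := by
  suffices lowerBoundSpan M ≤ (lowerBoundSpan M).comap (LinearMap.mulLeft ℚ e) from this hf
  refine Submodule.span_le.2 ?_
  rintro _ ⟨α, hα, u, hu, θ, hθ, rfl⟩
  change e * _ ∈ lowerBoundSpan M
  cases he with
  | lin φ =>
    convert add_mem (mem_lowerBoundSpan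
        (mul_mem (IsPiecewiseGen.lin (φ.comp (AddMonoidHom.inl M ℤ))).mem hα) hu hθ)
      (mem_lowerBoundSpan hα
        ((IsQuasiPoly.of_polynomial (Polynomial.C (φ (0, 1) : ℚ) * Polynomial.X)).mul hu) hθ)
      using 1
    ext p
    simp only [Pi.add_apply, Pi.mul_apply, φ.apply_prod_int p, Polynomial.eval_mul,
      Polynomial.eval_C, Polynomial.eval_X]
    push_cast
    ring
  | periodic φ g N hN hg =>
    have key : ∀ p : M × ℤ, g (φ p) = ∑ s ∈ Finset.Ico 0 N,
        iverson (φ.comp (AddMonoidHom.inl M ℤ) p.1 % N = s) * g (s + φ (0, 1) * p.2) := by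
      intro p
      rw [φ.apply_prod_int p]
      set a := φ.comp (AddMonoidHom.inl M ℤ) p.1
      rw [Finset.sum_eq_single (a % N)]
      · rw [iverson_of rfl, one_mul, ← hg.int_mul (a / N) (a % N + φ (0, 1) * p.2)]
        congr 1
        push_cast
        linarith [Int.emod_add_mul_ediv a N, mul_comm N (a / N)]
      · intro s _ hs
        rw [iverson_of_not (Ne.symm hs), zero_mul]
      · intro h
        exact absurd (Finset.mem_Ico.2 ⟨Int.emod_nonneg _ hN.ne', Int.emod_lt_of_pos _ hN⟩) h
    have hmem : ∀ s : ℤ, _ ∈ lowerBoundSpan M := fun s => mem_lowerBoundSpan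
      (mul_mem (IsPiecewiseGen.periodic (φ.comp (AddMonoidHom.inl M ℤ))
        (fun y => iverson (y % N = s)) N hN fun y => by simp).mem hα)
      ((IsQuasiPoly.of_periodic (g := fun y => g (s + φ (0, 1) * y)) hN fun y => by
        change g _ = g _
        rw [← hg.int_mul (φ (0, 1)) (s + φ (0, 1) * y)]
        congr 1
        push_cast
        ring).mul hu) hθ
    convert sum_mem fun s (_ : s ∈ Finset.Ico 0 N) => hmem s using 1
    ext p
    simp only [Pi.mul_apply, Finset.sum_apply, key p, Finset.sum_mul]
    refine Finset.sum_congr rfl fun s _ => ?_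
    ring
  | nonneg φ =>
    set ψ := φ.comp (AddMonoidHom.inl M ℤ) with hψ
    have hφ : ∀ p : M × ℤ, φ p = ψ p.1 + φ (0, 1) * p.2 := φ.apply_prod_int
    rcases lt_trichotomy (φ (0, 1)) 0 with hc | hc | hc
    · obtain ⟨η, hη, h⟩ := exists_isThreshold_pos (-ψ) (neg_pos.2 hc)
      convert sub_mem (mem_lowerBoundSpan hα hu hθ) (mul_bracket_mem_lowerBoundSpan hα hu hθ hη)
        using 1
      ext p
      have : iverson (0 ≤ φ p) = 1 - iverson (η p.1 ≤ p.2) := by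
        rw [← iverson_not, h, hφ, AddMonoidHom.neg_apply]
        congr 1
        rw [eq_iff_iff]
        constructor <;> intro h <;> linarith
      simp only [Pi.mul_apply, Pi.sub_apply, this]
      ring
    · convert mem_lowerBoundSpan (mul_mem (IsPiecewiseGen.nonneg ψ).mem hα) hu hθ using 1
      ext p
      simp only [Pi.mul_apply, hφ p, hc, zero_mul, add_zero]
      ring
    · obtain ⟨η, hη, h⟩ := exists_isThreshold_nonneg ψ hc
      convert mul_bracket_mem_lowerBoundSpan hα hu hθ hη using 1
      ext p
      simp only [Pi.mul_apply, hφ p, h]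

theorem mul_bracket_nonneg_mem_lowerBoundSpan {f : M × ℤ → ℚ}
    (hf : f ∈ piecewiseQuasiPoly (M × ℤ)) :
    f * (fun p => iverson (0 ≤ p.2)) ∈ lowerBoundSpan M := by
  have h0 : (fun p : M × ℤ => iverson (0 ≤ p.2)) ∈ lowerBoundSpan M := by
    simpa using mem_lowerBoundSpan (one_mem (piecewiseQuasiPoly M))
      (IsQuasiPoly.of_polynomial 1) (IsThreshold.of_hom 0)
  rw [piecewiseQuasiPoly, ← Subalgebra.mem_toSubmodule, Algebra.adjoin_eq_span] at hf
  induction hf using Submodule.span_induction with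
  | mem f hf =>
    induction hf using Submonoid.closure_induction_left with
    | one => simpa using h0
    | mul_left e he f _ ih =>
      rw [mul_assoc]
      exact IsPiecewiseGen.mul_mem_lowerBoundSpan he ih
  | zero => simp
  | add f g _ _ hf hg => rw [add_mul]; exact add_mem hf hg
  | smul r f _ hf => rw [smul_mul_assoc]; exact Submodule.smul_mem _ _ hf

/-- Summation over an interval with linear endpoints preserves piecewise quasipolynomials. -/
theorem sum_Ico_mem_piecewiseQuasiPoly {f : M × ℤ → ℚ} (hf : f ∈ piecewiseQuasiPoly (M × ℤ))
    (ζ : M →+ ℤ) : (fun x => ∑ y ∈ Finset.Ico 0 (ζ x), f (x, y)) ∈ piecewiseQuasiPoly M := by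
  have key : ∀ g ∈ lowerBoundSpan M,
      (fun x => ∑ y ∈ Finset.Ico 0 (ζ x), g (x, y)) ∈ piecewiseQuasiPoly M := by
    intro g hg
    induction hg using Submodule.span_induction with
    | mem g hg =>
      obtain ⟨α, hα, u, hu, θ, hθ, rfl⟩ := hg
      obtain ⟨D, hD, h⟩ := (IsThreshold.of_hom (0 : M →+ ℤ)).exists_compare hθ
      have hζ := IsThreshold.of_hom ζ
      convert mul_mem hα (add_mem (mul_mem hD (sum_Ico_threshold_mem hu hθ hζ))
        (mul_mem (sub_mem (one_mem _) hD)
          (sum_Ico_threshold_mem hu (IsThreshold.of_hom 0) hζ))) using 1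
      ext x
      simp only [Pi.add_apply, Pi.mul_apply, Pi.sub_apply, Pi.one_apply, mul_assoc,
        ← Finset.mul_sum, AddMonoidHom.zero_apply] at h ⊢
      congr 1
      by_cases hx : D x
      · rw [iverson_of hx, sub_self, zero_mul, add_zero, one_mul]
        have hsub : Finset.Ico (θ x) (ζ x) ⊆ Finset.Ico 0 (ζ x) :=
          Finset.Ico_subset_Ico_left ((h x).1 hx)
        rw [← Finset.sum_subset hsub]
        · refine Finset.sum_congr rfl fun y hy => ?_
          rw [iverson_of (Finset.mem_Ico.1 hy).1, mul_one]
        · intro y hy hy'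
          rw [iverson_of_not fun hle => hy' (Finset.mem_Ico.2 ⟨hle, (Finset.mem_Ico.1 hy).2⟩),
            mul_zero]
      · rw [iverson_of_not hx, sub_zero, zero_mul, zero_add, one_mul]
        refine Finset.sum_congr rfl fun y hy => ?_
        rw [iverson_of (((h x).2 hx).trans (Finset.mem_Ico.1 hy).1), mul_one]
    | zero =>
      simp only [Pi.zero_apply, Finset.sum_const_zero]
      exact zero_mem (piecewiseQuasiPoly M)
    | add f g _ _ hf hg =>
      simp only [Pi.add_apply, Finset.sum_add_distrib]
      exact add_mem hf hg
    | smul r f _ hf =>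
      simp only [Pi.smul_apply, ← Finset.smul_sum]
      exact Subalgebra.smul_mem _ hf r
  convert key _ (mul_bracket_nonneg_mem_lowerBoundSpan hf) using 2 with x
  refine Finset.sum_congr rfl fun y hy => ?_
  rw [Pi.mul_apply, iverson_of (Finset.mem_Ico.1 hy).1, mul_one]

end PiecewiseQuasiPoly

/-- Summation over a cube with linear side length preserves piecewise quasipolynomials. -/
theorem sum_piFinset_mem_piecewiseQuasiPoly {n : ℕ} {M : Type*} [AddCommGroup M]
    {f : M × (Fin n → ℤ) → ℚ} (hf : f ∈ piecewiseQuasiPoly (M × (Fin n → ℤ))) (ζ : M →+ ℤ) :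
    (fun x => ∑ y ∈ Fintype.piFinset fun _ : Fin n => Finset.Ico 0 (ζ x), f (x, y)) ∈
      piecewiseQuasiPoly M := by
  induction n generalizing M with
  | zero =>
    convert piecewiseQuasiPoly_comp hf (AddMonoidHom.inl M (Fin 0 → ℤ)) using 2 with x
    simp only [Fintype.piFinset_of_isEmpty, Finset.univ_unique, Finset.sum_singleton]
    exact congrArg (fun y => f (x, y)) (Subsingleton.elim _ _)
  | succ n ih =>
    let h : (M × ℤ) × (Fin n → ℤ) →+ M × (Fin (n + 1) → ℤ) :=
      AddMonoidHom.mk' (fun p => (p.1.1, Fin.cons p.1.2 p.2)) fun p q => by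
        refine Prod.ext rfl (funext fun i => ?_)
        refine Fin.cases ?_ (fun j => ?_) i <;> simp
    have := sum_Ico_mem_piecewiseQuasiPoly
      (ih (piecewiseQuasiPoly_comp hf h) (ζ.comp (AddMonoidHom.fst M ℤ))) ζ
    convert this using 2 with x
    simp only [AddMonoidHom.comp_apply, AddMonoidHom.coe_fst]
    rw [← Finset.sum_product']
    refine Finset.sum_nbij' (fun y => (y 0, Fin.tail y)) (fun p => Fin.cons p.1 p.2) ?_ ?_ ?_ ?_ ?_
    · intro y hy
      simp only [Fintype.mem_piFinset] at hy
      simpa [Fin.tail] using ⟨by simpa using hy 0, fun i => by simpa using hy i.succ⟩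
    · intro p hp
      simp only [Finset.mem_product, Fintype.mem_piFinset] at hp ⊢
      refine Fin.cases ?_ fun j => ?_
      · simpa using hp.1
      · simpa using hp.2 j
    · simp
    · simp
    · intro y _
      simp [h]

/-- A piecewise quasipolynomial function of one variable is a quasipolynomial on the positive
integers. -/
theorem exists_isQuasiPoly_of_mem_piecewiseQuasiPoly {f : ℤ → ℚ}
    (hf : f ∈ piecewiseQuasiPoly ℤ) : ∃ u, IsQuasiPoly u ∧ ∀ t, 0 < t → f t = u t := by
  have hlin : ∀ (φ : ℤ →+ ℤ) (t : ℤ), φ t = φ 1 * t := fun φ t => by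
    conv_lhs => rw [← mul_one t, ← smul_eq_mul, map_zsmul, smul_eq_mul, mul_comm]
  induction hf using Algebra.adjoin_induction with
  | mem f hf =>
    cases hf with
    | lin φ =>
      refine ⟨_, IsQuasiPoly.of_polynomial (Polynomial.C (φ 1 : ℚ) * Polynomial.X), fun t _ => ?_⟩
      simp [hlin φ t]
    | periodic φ g N hN hg =>
      refine ⟨fun t => g (φ t), IsQuasiPoly.of_periodic hN fun t => ?_, fun t _ => rfl⟩
      rw [hlin φ (t + N), hlin φ t, mul_add]
      exact hg.int_mul (φ 1) _
    | nonneg φ =>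
      refine ⟨_, IsQuasiPoly.of_polynomial (Polynomial.C (iverson (0 ≤ φ 1))), fun t ht => ?_⟩
      simp only [hlin φ t, Polynomial.eval_C, mul_nonneg_iff_of_pos_right ht]
  | algebraMap r => exact ⟨_, IsQuasiPoly.of_polynomial (Polynomial.C r), fun t _ => by simp⟩
  | add f g _ _ hf hg =>
    obtain ⟨u, hu, hfu⟩ := hf
    obtain ⟨v, hv, hgv⟩ := hg
    exact ⟨_, hu.add hv, fun t ht => by simp [hfu t ht, hgv t ht]⟩
  | mul f g _ _ hf hg =>
    obtain ⟨u, hu, hfu⟩ := hf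
    obtain ⟨v, hv, hgv⟩ := hg
    exact ⟨_, hu.mul hv, fun t ht => by simp [hfu t ht, hgv t ht]⟩

section FourierMotzkin

variable {E : Type*} [AddCommGroup E] [Module ℝ E] (F : Submodule ℚ (E →ₗ[ℝ] ℝ))

/-- Fourier–Motzkin elimination of one nonnegative parameter. -/
theorem exists_forms_sub_smul {w : E} (hw : ∀ φ ∈ F, ∃ r : ℚ, φ w = r)
    {Φ : Set (E →ₗ[ℝ] ℝ)} (hΦ : Φ.Finite) (hΦF : Φ ⊆ F) :
    ∃ Φ' : Set (E →ₗ[ℝ] ℝ), Φ'.Finite ∧ Φ' ⊆ F ∧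
      ∀ x, (∃ l : ℝ, 0 ≤ l ∧ ∀ φ ∈ Φ, 0 ≤ φ (x - l • w)) ↔ ∀ φ ∈ Φ', 0 ≤ φ x := by
  refine ⟨{φ ∈ Φ | 0 ≤ φ w} ∪
    Set.image2 (fun φ ψ => φ w • ψ - ψ w • φ) {φ ∈ Φ | 0 < φ w} {ψ ∈ Φ | ψ w < 0},
    (hΦ.sep _).union ((hΦ.sep _).image2 _ (hΦ.sep _)), ?_, fun x => ⟨?_, fun h => ?_⟩⟩
  · rintro _ (⟨hφ, -⟩ | ⟨φ, ⟨hφ, -⟩, ψ, ⟨hψ, -⟩, rfl⟩)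
    · exact hΦF hφ
    · obtain ⟨r, hr⟩ := hw φ (hΦF hφ)
      obtain ⟨s, hs⟩ := hw ψ (hΦF hψ)
      simp only [hr, hs, Rat.cast_smul_eq_qsmul]
      exact F.sub_mem (F.smul_mem _ (hΦF hψ)) (F.smul_mem _ (hΦF hφ))
  · rintro ⟨l, hl, h⟩
    simp only [map_sub, map_smul, smul_eq_mul, sub_nonneg] at h
    rintro _ (⟨hφ, h0⟩ | ⟨φ, ⟨hφ, h1⟩, ψ, ⟨hψ, h2⟩, rfl⟩)
    · exact (mul_nonneg hl h0).trans (h _ hφ)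
    · have := h φ hφ
      have := h ψ hψ
      simp only [LinearMap.sub_apply, LinearMap.smul_apply, smul_eq_mul]
      nlinarith
  · obtain ⟨l, hlmem, hl⟩ := Set.exists_max_image
      (insert 0 ((fun ψ : E →ₗ[ℝ] ℝ => ψ x / ψ w) '' {ψ ∈ Φ | ψ w < 0})) id
      (((hΦ.sep _).image _).insert 0) ⟨0, Set.mem_insert _ _⟩
    refine ⟨l, hl 0 (Set.mem_insert _ _), fun φ hφ => ?_⟩
    simp only [map_sub, map_smul, smul_eq_mul, sub_nonneg]
    rcases lt_or_ge (φ w) 0 with hneg | hnonneg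
    · have : φ x / φ w ≤ l := hl _ (Or.inr ⟨φ, ⟨hφ, hneg⟩, rfl⟩)
      rwa [div_le_iff_of_neg hneg] at this
    · have hx : 0 ≤ φ x := h φ (Or.inl ⟨hφ, hnonneg⟩)
      rcases hlmem with rfl | ⟨ψ, ⟨hψ, hψw⟩, rfl⟩
      · simpa using hx
      · rcases hnonneg.eq_or_lt with h0 | hpos
        · simpa [← h0] using hx
        · have := h _ (Or.inr ⟨φ, ⟨hφ, hpos⟩, ψ, ⟨hψ, hψw⟩, rfl⟩)
          simp only [LinearMap.sub_apply, LinearMap.smul_apply, smul_eq_mul] at this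
          change ψ x / ψ w * φ w ≤ φ x
          rw [div_mul_eq_mul_div, div_le_iff_of_neg hψw]
          linarith

/-- The sum of a polyhedral cone and a finitely generated cone is cut out by finitely many linear
inequalities. -/
theorem exists_forms_sub_sum {ι : Type*} (V : Finset ι) (w : ι → E)
    (hw : ∀ v ∈ V, ∀ φ ∈ F, ∃ r : ℚ, φ (w v) = r)
    {Φ₀ : Set (E →ₗ[ℝ] ℝ)} (hΦ₀ : Φ₀.Finite) (hΦ₀F : Φ₀ ⊆ F) :
    ∃ Φ : Set (E →ₗ[ℝ] ℝ), Φ.Finite ∧ Φ ⊆ F ∧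
      ∀ x, (∃ l : ι → ℝ, (∀ v ∈ V, 0 ≤ l v) ∧ ∀ φ ∈ Φ₀, 0 ≤ φ (x - ∑ v ∈ V, l v • w v)) ↔
        ∀ φ ∈ Φ, 0 ≤ φ x := by
  classical
  induction V using Finset.induction_on with
  | empty => exact ⟨Φ₀, hΦ₀, hΦ₀F, fun x => by simp⟩
  | insert a V ha ih =>
    obtain ⟨Φ, hΦ, hΦF, h⟩ := ih fun v hv => hw v (Finset.mem_insert_of_mem hv)
    obtain ⟨Φ', hΦ', hΦF', h'⟩ :=
      exists_forms_sub_smul F (hw a (Finset.mem_insert_self _ _)) hΦ hΦF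
    refine ⟨Φ', hΦ', hΦF', fun x => ?_⟩
    rw [← h']
    simp only [← h, Finset.sum_insert ha, Finset.forall_mem_insert, sub_sub]
    constructor
    · rintro ⟨l, ⟨hla, hl⟩, hx⟩
      exact ⟨l a, hla, l, hl, hx⟩
    · rintro ⟨b, hb, l, hl, hx⟩
      have hne : ∀ v ∈ V, Function.update l a b v = l v := fun v hv =>
        Function.update_of_ne (ne_of_mem_of_not_mem hv ha) _ _
      refine ⟨Function.update l a b, ⟨by simpa using hb, fun v hv => ?_⟩, ?_⟩
      · rw [hne v hv]
        exact hl v hv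
      · rw [Finset.sum_congr rfl fun v hv => by rw [hne v hv], Function.update_self]
        exact hx

end FourierMotzkin

/-- The linear forms on `ℝ × ℝⁿ` with rational coefficients. -/
def rationalForms (n : ℕ) : Submodule ℚ (ℝ × (Fin n → ℝ) →ₗ[ℝ] ℝ) where
  carrier := {φ | ∀ (s : ℚ) (a : Fin n → ℚ), ∃ r : ℚ, φ (s, fun i => (a i : ℝ)) = r}
  zero_mem' := fun _ _ => ⟨0, by simp⟩
  add_mem' := fun {φ ψ} hφ hψ s a => by
    obtain ⟨r, hr⟩ := hφ s a
    obtain ⟨r', hr'⟩ := hψ s a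
    exact ⟨r + r', by simp [hr, hr']⟩
  smul_mem' := fun c φ hφ s a => by
    obtain ⟨r, hr⟩ := hφ s a
    exact ⟨c * r, by simp [hr, Rat.smul_def]⟩

theorem bracket_rationalForms_mem {n : ℕ} {φ : ℝ × (Fin n → ℝ) →ₗ[ℝ] ℝ}
    (hφ : φ ∈ rationalForms n) :
    (fun m : ℤ × (Fin n → ℤ) => iverson (0 ≤ φ (m.1, fun i => (m.2 i : ℝ)))) ∈
      piecewiseQuasiPoly (ℤ × (Fin n → ℤ)) := by
  obtain ⟨r₀, hr₀⟩ := hφ 1 0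
  choose r hr using fun i => hφ 0 (Pi.single i 1)
  obtain ⟨d, hd⟩ := IsLocalization.exist_integer_multiples_of_finite (nonZeroDivisors ℤ)
    (fun o : Option (Fin n) => o.elim r₀ r)
  have hd0 : ((d : ℤ) : ℝ) ≠ 0 := by exact_mod_cast nonZeroDivisors.ne_zero d.2
  choose k hk using hd
  have hk₀ : (k none : ℝ) = (d : ℤ) * (r₀ : ℝ) := by
    have := hk none
    simp only [Option.elim_none, zsmul_eq_mul, eq_intCast] at this
    exact_mod_cast this
  have hk' : ∀ i, (k (some i) : ℝ) = (d : ℤ) * (r i : ℝ) := fun i => by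
    have := hk (some i)
    simp only [Option.elim_some, zsmul_eq_mul, eq_intCast] at this
    exact_mod_cast this
  let ψ : ℤ × (Fin n → ℤ) →+ ℤ := AddMonoidHom.mk'
    (fun m => d * (k none * m.1 + ∑ i, k (some i) * m.2 i)) fun m m' => by
      simp only [Prod.fst_add, Prod.snd_add, Pi.add_apply, mul_add, Finset.sum_add_distrib]
      ring
  have hφm : ∀ m : ℤ × (Fin n → ℤ), φ (m.1, fun i => (m.2 i : ℝ)) =
      r₀ * m.1 + ∑ i, (r i : ℝ) * m.2 i := fun m => by
    have : ((m.1 : ℝ), fun i => (m.2 i : ℝ)) = (m.1 : ℝ) • (((1 : ℚ) : ℝ), fun i : Fin n =>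
        (((0 : Fin n → ℚ) i : ℚ) : ℝ)) + ∑ j, (m.2 j : ℝ) • (((0 : ℚ) : ℝ), fun i : Fin n =>
        (((Pi.single j 1 : Fin n → ℚ) i : ℚ) : ℝ)) := by
      refine Prod.ext ?_ (funext fun i => ?_)
      · simp [Prod.fst_sum]
      · simp [Prod.snd_sum, Pi.single_apply, apply_ite (Rat.cast : ℚ → ℝ)]
    rw [this]
    simp only [map_add, map_sum, map_smul, hr₀, hr, smul_eq_mul]
    congr 1
    · ring
    · exact Finset.sum_congr rfl fun i _ => mul_comm _ _
  have hψ : ∀ m : ℤ × (Fin n → ℤ), ((ψ m : ℤ) : ℝ) =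
      ((d : ℤ) : ℝ) ^ 2 * φ (m.1, fun i => (m.2 i : ℝ)) := fun m => by
    simp only [ψ, AddMonoidHom.mk'_apply, hφm]
    push_cast
    simp only [hk₀, hk', mul_assoc, ← Finset.mul_sum]
    ring
  convert (IsPiecewiseGen.nonneg ψ).mem using 2 with m
  rw [← Int.cast_nonneg_iff (R := ℝ), hψ, mul_nonneg_iff_of_pos_left (by positivity)]

theorem bracket_forall_mem {ι M : Type*} [AddCommGroup M] {S : Set ι} (hS : S.Finite)
    {p : ι → M → Prop} (h : ∀ i ∈ S, (fun x => iverson (p i x)) ∈ piecewiseQuasiPoly M) :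
    (fun x => iverson (∀ i ∈ S, p i x)) ∈ piecewiseQuasiPoly M := by
  induction S, hS using Set.Finite.induction_on with
  | empty =>
    simp only [Set.mem_empty_iff_false, false_implies, implies_true, iverson_of]
    exact one_mem _
  | @insert a S _ _ ih =>
    convert mul_mem (h a (Set.mem_insert _ _)) (ih fun i hi => h i (Set.mem_insert_of_mem _ hi))
      using 1
    ext x
    rw [Pi.mul_apply, Set.forall_mem_insert, iverson_and]

theorem mem_smul_convexHull_iff {E : Type*} [AddCommGroup E] [Module ℝ E] {V : Finset E} {t : ℝ}
    (ht : 0 < t) {x : E} : x ∈ t • convexHull ℝ (V : Set E) ↔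
      ∃ l : E → ℝ, (∀ v ∈ V, 0 ≤ l v) ∧ ∑ v ∈ V, l v = t ∧ ∑ v ∈ V, l v • v = x := by
  rw [Set.mem_smul_set_iff_inv_smul_mem₀ ht.ne', Finset.mem_convexHull']
  constructor
  · rintro ⟨l, hl, h1, hx⟩
    refine ⟨fun v => t * l v, fun v hv => mul_nonneg ht.le (hl v hv), ?_, ?_⟩
    · rw [← Finset.mul_sum, h1, mul_one]
    · simp only [mul_smul, ← Finset.smul_sum, hx]
      exact smul_inv_smul₀ ht.ne' x
  · rintro ⟨l, hl, h1, hx⟩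
    refine ⟨fun v => t⁻¹ * l v, fun v hv => mul_nonneg (inv_nonneg.2 ht.le) (hl v hv), ?_, ?_⟩
    · rw [← Finset.mul_sum, h1, inv_mul_cancel₀ ht.ne']
    · simp only [mul_smul, ← Finset.smul_sum, hx]

/-- The dilates of a rational polytope are cut out by finitely many homogeneous linear
inequalities with rational coefficients. -/
theorem exists_forms_mem_smul_convexHull {n : ℕ} (V : Finset (Fin n → ℝ))
    (hV : ∀ v ∈ V, ∀ i, ∃ r : ℚ, v i = (r : ℝ)) :
    ∃ Φ : Set (ℝ × (Fin n → ℝ) →ₗ[ℝ] ℝ), Φ.Finite ∧ Φ ⊆ rationalForms n ∧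
      ∀ t : ℝ, 0 < t → ∀ x, x ∈ t • convexHull ℝ (V : Set (Fin n → ℝ)) ↔
        ∀ φ ∈ Φ, 0 ≤ φ (t, x) := by
  let e : Option (Fin n) → (ℝ × (Fin n → ℝ) →ₗ[ℝ] ℝ) := fun o => o.elim
    (LinearMap.fst ℝ ℝ (Fin n → ℝ)) fun i => LinearMap.proj i ∘ₗ LinearMap.snd ℝ ℝ (Fin n → ℝ)
  have he : ∀ o, e o ∈ rationalForms n := by
    rintro (_ | i) s a
    · exact ⟨s, rfl⟩
    · exact ⟨a i, rfl⟩
  obtain ⟨Φ, hΦ, hΦF, h⟩ := exists_forms_sub_sum (rationalForms n) V (fun v => ((1 : ℝ), v))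
    (fun v hv φ hφ => by
      choose r hr using hV v hv
      obtain ⟨s, hs⟩ := hφ 1 r
      refine ⟨s, ?_⟩
      rw [← hs, Rat.cast_one, ← funext hr])
    (Φ₀ := Set.range e ∪ Set.range fun o => -e o)
    ((Set.finite_range _).union (Set.finite_range _))
    (by
      rintro _ (⟨o, rfl⟩ | ⟨o, rfl⟩)
      · exact he o
      · exact neg_mem (he o))
  refine ⟨Φ, hΦ, hΦF, fun t ht x => ?_⟩
  rw [mem_smul_convexHull_iff ht, ← h]
  refine exists_congr fun l => and_congr_right fun _ => ?_
  have hsum : ∑ v ∈ V, l v • ((1 : ℝ), v) = (∑ v ∈ V, l v, ∑ v ∈ V, l v • v) := by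
    ext <;> simp [Prod.fst_sum, Prod.snd_sum]
  rw [hsum]
  constructor
  · rintro ⟨rfl, rfl⟩ φ -
    simp
  · intro h0
    have hz : ∀ o, e o ((t, x) - (∑ v ∈ V, l v, ∑ v ∈ V, l v • v)) = 0 := fun o =>
      le_antisymm (neg_nonneg.1 (h0 (-e o) (Or.inr ⟨o, rfl⟩))) (h0 (e o) (Or.inl ⟨o, rfl⟩))
    exact ⟨(sub_eq_zero.1 (hz none)).symm, funext fun i => (sub_eq_zero.1 (hz (some i))).symm⟩

/-- **Ehrhart quasipolynomiality of the closed lattice-point count.**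
If `P ⊆ ℝⁿ` is an `n`-dimensional rational polytope (the convex hull of finitely
many rational points, with nonempty interior), then there are a positive integer `p`
and polynomials `q_r ∈ ℚ[x]`, indexed by `r ∈ ℤ/p`, such that for every positive
integer `t` the number of lattice points in the dilate `t • P`
equals `q_{t mod p}(t)`. -/
theorem ehrhart_closure_quasipolynomial
    (n : ℕ) (V : Finset (Fin n → ℝ))
    (hV : ∀ v ∈ V, ∀ i, ∃ r : ℚ, v i = (r : ℝ))
    (P : Set (Fin n → ℝ)) (hP : P = convexHull ℝ (V : Set (Fin n → ℝ)))
    (hdim : (interior P).Nonempty) :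
    ∃ p : ℕ, 0 < p ∧ ∃ q : ZMod p → Polynomial ℚ,
      ∀ t : ℕ, 0 < t →
        (({x : Fin n → ℝ | x ∈ (t : ℝ) • P ∧ ∀ i, ∃ m : ℤ, x i = (m : ℝ)}.ncard : ℚ)
          = (q (t : ZMod p)).eval (t : ℚ)) := by
  classical
  obtain ⟨Φ, hΦ, hΦF, hmem⟩ := exists_forms_mem_smul_convexHull V hV
  obtain ⟨C, hC⟩ : ∃ C : ℤ, ∀ x ∈ P, ∀ i, |x i| < C := by
    obtain ⟨R, hR⟩ := (V.finite_toSet.isBounded.subset_ball 0)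
    obtain ⟨C, hRC⟩ := exists_nat_gt R
    refine ⟨C, fun x hx i => ?_⟩
    have hx' : x ∈ Metric.ball (0 : Fin n → ℝ) R :=
      convexHull_min hR (convex_ball _ _) (hP ▸ hx)
    rw [mem_ball_zero_iff] at hx'
    exact_mod_cast ((norm_le_pi_norm x i).trans_lt hx').trans hRC
  let shift : ℤ × (Fin n → ℤ) →+ ℤ × (Fin n → ℤ) :=
    AddMonoidHom.mk' (fun m => (m.1, fun i => m.2 i - C * m.1)) fun m m' => by
      refine Prod.ext rfl (funext fun i => ?_)
      simp only [Prod.fst_add, Prod.snd_add, Pi.add_apply]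
      ring
  have hχ := bracket_forall_mem hΦ fun φ hφ => bracket_rationalForms_mem (hΦF hφ)
  obtain ⟨u, ⟨N, hN, q, hq, hu⟩, hfu⟩ := exists_isQuasiPoly_of_mem_piecewiseQuasiPoly
    (sum_piFinset_mem_piecewiseQuasiPoly (piecewiseQuasiPoly_comp hχ shift)
      (AddMonoidHom.mulLeft (2 * C)))
  lift N to ℕ using hN.le
  refine ⟨N, by exact_mod_cast hN, fun z => q z.val, fun t ht => ?_⟩
  have hqt : q ((t : ZMod N).val : ℤ) = q t := by
    rw [ZMod.val_natCast, Int.natCast_mod]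
    conv_rhs => rw [← Int.emod_add_mul_ediv (t : ℤ) N, mul_comm]
    exact ((hq.int_mul ((t : ℤ) / N)) _).symm
  have ht' : (0 : ℝ) < t := by exact_mod_cast ht
  simp only [hqt]
  rw [← Int.cast_natCast (R := ℚ) t, ← hu, ← hfu t (by exact_mod_cast ht)]
  have hset : {x : Fin n → ℝ | x ∈ (t : ℝ) • P ∧ ∀ i, ∃ m : ℤ, x i = (m : ℝ)} =
      (fun (y : Fin n → ℤ) (i : Fin n) => ((y i - C * t : ℤ) : ℝ)) ''
        ({y ∈ Fintype.piFinset fun _ : Fin n => Finset.Ico 0 (2 * C * (t : ℤ)) |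
          ∀ φ ∈ Φ, 0 ≤ φ ((t : ℝ), fun i => ((y i - C * t : ℤ) : ℝ))} : Finset _) := by
    ext x
    constructor
    · rintro ⟨hx, hint⟩
      choose m hm using hint
      have hxm : (fun i => ((m i + C * t - C * t : ℤ) : ℝ)) = x := by
        ext i
        rw [add_sub_cancel_right, hm]
      refine ⟨fun i => m i + C * t, ?_, hxm⟩
      simp only [Finset.coe_filter, Set.mem_ofPred_eq, Fintype.mem_piFinset, Finset.mem_Ico]
      refine ⟨fun i => ?_, ?_⟩
      · obtain ⟨z, hz, rfl⟩ := hx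
        have hzi := abs_lt.1 (hC z hz i)
        have hmi : (t : ℝ) * z i = m i := hm i
        have h1 : (0 : ℝ) < m i + C * t := by nlinarith [hzi.1]
        have h2 : (m i + C * t : ℝ) < 2 * C * t := by nlinarith [hzi.2]
        exact ⟨by exact_mod_cast h1.le, by exact_mod_cast h2⟩
      · rw [hxm]
        exact (hmem t ht' x).1 (hP ▸ hx)
    · rintro ⟨y, hy, rfl⟩
      simp only [Finset.coe_filter, Set.mem_ofPred_eq] at hy
      exact ⟨hP ▸ (hmem t ht' _).2 hy.2, fun i => ⟨_, rfl⟩⟩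
  rw [hset, Set.ncard_image_of_injective, Set.ncard_coe_finset, Finset.card_filter]
  · push_cast
    refine Finset.sum_congr rfl fun y _ => ?_
    simp [iverson, shift]
  · intro y y' h
    ext i
    have := congrFun h i
    simpa using this
end

section
/- Ehrhart–Macdonald reciprocity: Let P ⊂ ℝ^n be an n-dimensional rational polytope. Then there exist a positive integer p and polynomials q_0, …, q_{p-1} ∈ ℚ[x] such that for every positive integer t, the number of points of ℤ^n in the interior of tP equals q_{t mod p}(t), and the number of points of ℤ^n in tP equals (-1)^n · q_{(-t) mod p}(-t). -/
open Pointwise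

section Subdivision

lemma sum_map_flatMap {α β : Type*} (T : List α) (S : α → List β) (f : β → ℕ) :
    ((T.flatMap S).map f).sum = (T.map fun a => ((S a).map f).sum).sum := by
  induction T with
  | nil => simp
  | cons a T ih => simp [ih]

variable {E : Type*} [AddCommGroup E] [Module ℝ E] [Module ℚ E]

/-- A full-dimensional simplex in the hyperplane `h = 1`, given by its vertices `v`, which lie in
the set `R` of rational points, together with the barycentric coordinates `c` of the cone over it. -/
structure RatSimplex (ι : Type*) [Fintype ι] [DecidableEq ι] (R : Submodule ℚ E)
    (h : E →ₗ[ℝ] ℝ) where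
  v : ι → E
  c : ι → E →ₗ[ℝ] ℝ
  sum_c : ∀ x, ∑ i, c i x • v i = x
  c_v : ∀ i j, c i (v j) = if i = j then 1 else 0
  v_mem : ∀ i, v i ∈ R
  c_rat : ∀ i, ∀ x ∈ R, ∃ q : ℚ, c i x = q
  h_v : ∀ i, h (v i) = 1

namespace RatSimplex

variable {ι : Type*} [Fintype ι] [DecidableEq ι] {R : Submodule ℚ E} {h : E →ₗ[ℝ] ℝ}

/-- The point `y` lies in the open cone over the simplex. -/
def Pos (σ : RatSimplex ι R h) (y : E) : Prop := ∀ i, 0 < σ.c i y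

open Classical in
/-- The indicator function of the open cone over a simplex. -/
noncomputable def ind (y : E) (σ : RatSimplex ι R h) : ℕ := if σ.Pos y then 1 else 0

lemma apply_eq_sum (σ : RatSimplex ι R h) (g : E →ₗ[ℝ] ℝ) (y : E) :
    g y = ∑ i, σ.c i y * g (σ.v i) := by
  conv_lhs => rw [← σ.sum_c y]
  simp

lemma c_ne_zero (σ : RatSimplex ι R h) (i : ι) : σ.c i ≠ 0 := fun h0 => by
  simpa [h0] using σ.c_v i i

/-- Replace the vertex `v i` by a rational point `a • v i + b • v j` of the edge from `v i` to
`v j`. -/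
noncomputable def replace [IsScalarTower ℚ ℝ E] (σ : RatSimplex ι R h) (i j : ι) (hij : i ≠ j)
    (a b : ℚ) (ha : 0 < a) (hab : a + b = 1) : RatSimplex ι R h where
  v := Function.update σ.v i ((a : ℝ) • σ.v i + (b : ℝ) • σ.v j)
  c := Function.update (Function.update σ.c i ((a : ℝ)⁻¹ • σ.c i)) j
    (σ.c j - ((b : ℝ) / a) • σ.c i)
  sum_c x := by
    have ha' : (a : ℝ) ≠ 0 := by exact_mod_cast ha.ne'
    have hx := σ.sum_c x
    rw [← Finset.add_sum_erase _ _ (Finset.mem_univ i),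
      ← Finset.add_sum_erase _ _ (show j ∈ Finset.univ.erase i by simp [hij.symm])] at hx ⊢
    have hs : ∑ k ∈ (Finset.univ.erase i).erase j,
        Function.update (Function.update σ.c i ((a : ℝ)⁻¹ • σ.c i)) j
          (σ.c j - ((b : ℝ) / a) • σ.c i) k x •
          Function.update σ.v i ((a : ℝ) • σ.v i + (b : ℝ) • σ.v j) k =
        ∑ k ∈ (Finset.univ.erase i).erase j, σ.c k x • σ.v k := by
      refine Finset.sum_congr rfl fun k hk => ?_
      simp only [Finset.mem_erase] at hk
      simp [hk.1, hk.2.1]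
    rw [hs]
    refine Eq.trans ?_ hx
    rw [← add_assoc, ← add_assoc]
    congr 1
    simp only [Function.update_self, Function.update_of_ne hij, Function.update_of_ne hij.symm,
      LinearMap.smul_apply, LinearMap.sub_apply, smul_eq_mul]
    match_scalars
    · field_simp
    · field_simp
      ring
  c_v k l := by
    have ha' : (a : ℝ) ≠ 0 := by exact_mod_cast ha.ne'
    by_cases hl : l = i
    · subst hl
      by_cases hk : k = j
      · subst hk
        simp [σ.c_v, hij, hij.symm]
        field_simp
        simp
      · by_cases hk' : k = l
        · subst hk'
          simp [σ.c_v, hij, ha']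
        · simp [σ.c_v, hk, hk']
    · by_cases hk : k = j
      · subst hk
        simp [σ.c_v, hl, Ne.symm hl]
      · by_cases hk' : k = i
        · subst hk'
          simp [σ.c_v, hl, hk, Ne.symm hl]
        · simp [σ.c_v, hk, hk', hl]
  v_mem k := by
    by_cases hk : k = i
    · subst hk
      have e : ∀ (q : ℚ) (x : E), (q : ℝ) • x = q • x := fun q x => by
        rw [← algebraMap_smul ℝ q x]; simp
      simpa [e] using R.add_mem (R.smul_mem a (σ.v_mem k)) (R.smul_mem b (σ.v_mem j))
    · simpa [hk] using σ.v_mem k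
  c_rat k x hx := by
    obtain ⟨qi, hi⟩ := σ.c_rat i x hx
    obtain ⟨qj, hj⟩ := σ.c_rat j x hx
    obtain ⟨qk, hk⟩ := σ.c_rat k x hx
    by_cases h1 : k = j
    · subst h1
      exact ⟨qj - b / a * qi, by simp [hi, hj]⟩
    · by_cases h2 : k = i
      · subst h2
        exact ⟨a⁻¹ * qi, by simp [hi, h1]⟩
      · exact ⟨qk, by simp [hk, h1, h2]⟩
  h_v k := by
    by_cases hk : k = i
    · subst hk
      simp only [Function.update_self, map_add, map_smul, σ.h_v]
      simpa using (by exact_mod_cast hab : (a : ℝ) + b = 1)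
    · simpa [hk] using σ.h_v k

/-- Away from the hyperplane through the new wall, an open cone is the disjoint union of the two
cones obtained by subdividing an edge. -/
lemma ind_replace [IsScalarTower ℚ ℝ E] (σ : RatSimplex ι R h) (i j : ι) (hij : i ≠ j) (a b : ℚ)
    (ha : 0 < a) (hb : 0 < b) (hab : a + b = 1) (y : E)
    (hy : ((b : ℝ) • σ.c i - (a : ℝ) • σ.c j) y ≠ 0) :
    ind y (σ.replace i j hij a b ha hab) +
      ind y (σ.replace j i hij.symm b a hb (by rw [add_comm, hab])) = ind y σ := by
  have ha' : (0 : ℝ) < a := by exact_mod_cast ha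
  have hb' : (0 : ℝ) < b := by exact_mod_cast hb
  have key : ∀ (i j : ι) (hij : i ≠ j) (a b : ℚ) (ha : 0 < a) (hab : a + b = 1), 0 < (a : ℝ) →
      0 < (b : ℝ) →
      ((σ.replace i j hij a b ha hab).Pos y ↔
        (σ.Pos y ∧ 0 < (a : ℝ) * σ.c j y - b * σ.c i y)) := by
    intro i j hij a b ha hab ha' hb'
    have e : σ.c j y - (b / a) * σ.c i y = (a * σ.c j y - b * σ.c i y) / a := by
      field_simp
    have hj : (σ.replace i j hij a b ha hab).c j y = (a * σ.c j y - b * σ.c i y) / a := by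
      simp [replace, ← e]
    have hi : (σ.replace i j hij a b ha hab).c i y = (a : ℝ)⁻¹ * σ.c i y := by
      simp [replace, hij]
    have hk : ∀ k, k ≠ i → k ≠ j → (σ.replace i j hij a b ha hab).c k y = σ.c k y := by
      intro k h1 h2
      simp [replace, h1, h2]
    constructor
    · intro H
      have Hi := H i
      have Hj := H j
      rw [hi] at Hi
      rw [hj] at Hj
      have Hi' : 0 < σ.c i y := (pos_iff_pos_of_mul_pos Hi).1 (by positivity)
      have Hj' : 0 < (a : ℝ) * σ.c j y - b * σ.c i y := (div_pos_iff_of_pos_right ha').1 Hj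
      refine ⟨fun k => ?_, Hj'⟩
      by_cases h1 : k = i
      · rwa [h1]
      by_cases h2 : k = j
      · rw [h2]
        have := mul_pos hb' Hi'
        exact (pos_iff_pos_of_mul_pos (show 0 < (a : ℝ) * σ.c j y by linarith)).1 ha'
      · rw [← hk k h1 h2]; exact H k
    · rintro ⟨H, Hj⟩ k
      by_cases h1 : k = i
      · rw [h1, hi]
        have := H i
        positivity
      by_cases h2 : k = j
      · rw [h2, hj]
        positivity
      · rw [hk k h1 h2]; exact H k
  unfold ind
  rw [key i j hij a b ha hab ha' hb', key j i hij.symm b a hb (by rw [add_comm, hab]) hb' ha']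
  simp only [LinearMap.sub_apply, LinearMap.smul_apply, smul_eq_mul] at hy
  by_cases hp : σ.Pos y
  · rcases lt_or_gt_of_ne hy with hlt | hgt
    · have h1 : 0 < (a : ℝ) * σ.c j y - b * σ.c i y := by linarith
      have h2 : ¬ 0 < (b : ℝ) * σ.c i y - a * σ.c j y := by linarith
      simp [hp, h1, h2]
    · have h1 : ¬ 0 < (a : ℝ) * σ.c j y - b * σ.c i y := by linarith
      have h2 : 0 < (b : ℝ) * σ.c i y - a * σ.c j y := by linarith
      simp [hp, h1, h2]
  · simp [hp]

/-- The list `T` of simplices subdivides `σ`, up to the kernels of the functionals in `N`. -/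
structure Refines (T : List (RatSimplex ι R h)) (N : List (E →ₗ[ℝ] ℝ)) (σ : RatSimplex ι R h) :
    Prop where
  ne_zero : ∀ l ∈ N, l ≠ 0
  sum_ind : ∀ y, (∀ l ∈ N, l y ≠ 0) → (T.map (ind y)).sum = ind y σ
  nonneg : ∀ τ ∈ T, ∀ g : E →ₗ[ℝ] ℝ, (∀ i, 0 ≤ g (σ.v i)) → ∀ i, 0 ≤ g (τ.v i)

lemma Refines.refl (σ : RatSimplex ι R h) : Refines [σ] [] σ :=
  ⟨by simp, by simp, by simp⟩

lemma Refines.append_of_ind {σ σ₁ σ₂ : RatSimplex ι R h} {T₁ T₂ : List (RatSimplex ι R h)}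
    {N₁ N₂ : List (E →ₗ[ℝ] ℝ)} (h₁ : Refines T₁ N₁ σ₁) (h₂ : Refines T₂ N₂ σ₂)
    {l : E →ₗ[ℝ] ℝ} (hl : l ≠ 0) (hs : ∀ y, l y ≠ 0 → ind y σ₁ + ind y σ₂ = ind y σ)
    (hn₁ : ∀ g : E →ₗ[ℝ] ℝ, (∀ i, 0 ≤ g (σ.v i)) → ∀ i, 0 ≤ g (σ₁.v i))
    (hn₂ : ∀ g : E →ₗ[ℝ] ℝ, (∀ i, 0 ≤ g (σ.v i)) → ∀ i, 0 ≤ g (σ₂.v i)) :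
    Refines (T₁ ++ T₂) (l :: (N₁ ++ N₂)) σ where
  ne_zero m hm := by
    simp only [List.mem_cons, List.mem_append] at hm
    rcases hm with rfl | hm | hm
    exacts [hl, h₁.ne_zero m hm, h₂.ne_zero m hm]
  sum_ind y hy := by
    simp only [List.mem_cons, List.mem_append, forall_eq_or_imp] at hy
    rw [List.map_append, List.sum_append, h₁.sum_ind y fun m hm => hy.2 m (.inl hm),
      h₂.sum_ind y fun m hm => hy.2 m (.inr hm), hs y hy.1]
  nonneg τ hτ g hg := by
    rcases List.mem_append.1 hτ with hτ | hτ
    exacts [h₁.nonneg τ hτ g (hn₁ g hg), h₂.nonneg τ hτ g (hn₂ g hg)]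

/-- The functional `g` does not change sign on the cone over `σ`. -/
def SignConst (g : E →ₗ[ℝ] ℝ) (σ : RatSimplex ι R h) : Prop :=
  (∀ i, 0 ≤ g (σ.v i)) ∨ ∀ i, g (σ.v i) ≤ 0

lemma Refines.signConst {σ τ : RatSimplex ι R h} {T : List (RatSimplex ι R h)}
    {N : List (E →ₗ[ℝ] ℝ)} (hT : Refines T N σ) (hτ : τ ∈ T) {g : E →ₗ[ℝ] ℝ}
    (hg : SignConst g σ) : SignConst g τ := by
  rcases hg with hg | hg
  · exact .inl (hT.nonneg τ hτ g hg)
  · refine .inr fun i => ?_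
    simpa using hT.nonneg τ hτ (-g) (by simpa using hg) i

lemma exists_refines_signConst [IsScalarTower ℚ ℝ E] (g : E →ₗ[ℝ] ℝ)
    (hg : ∀ x ∈ R, ∃ q : ℚ, g x = q) (σ : RatSimplex ι R h) :
    ∃ T N, Refines T N σ ∧ ∀ τ ∈ T, SignConst g τ := by
  classical
  induction hm : (Finset.univ.filter fun i => g (σ.v i) ≠ 0).card using Nat.strong_induction_on
    generalizing σ with
  | _ m ih =>
  by_cases hc : SignConst g σ
  · exact ⟨[σ], [], .refl σ, by simpa using hc⟩
  simp only [SignConst, not_or, not_forall, not_le] at hc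
  obtain ⟨⟨j, hj⟩, ⟨i, hi⟩⟩ := hc
  have hij : i ≠ j := by rintro rfl; linarith
  obtain ⟨qi, hqi⟩ := hg _ (σ.v_mem i)
  obtain ⟨qj, hqj⟩ := hg _ (σ.v_mem j)
  have hi' : 0 < qi := by rw [hqi] at hi; exact_mod_cast hi
  have hj' : qj < 0 := by rw [hqj] at hj; exact_mod_cast hj
  have hd : 0 < qi - qj := by linarith
  have hdr : (qi : ℝ) - qj ≠ 0 := by exact_mod_cast hd.ne'
  set a : ℚ := -qj / (qi - qj) with ha_def
  set b : ℚ := qi / (qi - qj) with hb_def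
  have ha : 0 < a := div_pos (by linarith) hd
  have hb : 0 < b := div_pos hi' hd
  have hab : a + b = 1 := by rw [ha_def, hb_def]; field_simp; ring
  have hzero : (a : ℝ) * g (σ.v i) + b * g (σ.v j) = 0 := by
    rw [hqi, hqj]; norm_cast; rw [ha_def, hb_def]; field_simp; ring
  have descend : ∀ (i j : ι) (hij : i ≠ j) (a b : ℚ) (ha : 0 < a) (hab : a + b = 1),
      (a : ℝ) * g (σ.v i) + b * g (σ.v j) = 0 → g (σ.v i) ≠ 0 →
      ∃ T N, Refines T N (σ.replace i j hij a b ha hab) ∧ ∀ τ ∈ T, SignConst g τ := by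
    intro i j hij a b ha hab hz hi
    refine ih _ ?_ _ rfl
    rw [← hm]
    apply Finset.card_lt_card
    rw [Finset.ssubset_iff_of_subset]
    · refine ⟨i, by simpa using hi, fun hk => (Finset.mem_filter.1 hk).2 ?_⟩
      simpa [replace] using hz
    · intro k hk
      simp only [Finset.mem_filter, Finset.mem_univ, true_and] at hk ⊢
      by_cases hki : k = i
      · rwa [hki]
      · simpa [replace, hki] using hk
  have mono : ∀ (i j : ι) (hij : i ≠ j) (a b : ℚ) (ha : 0 < a) (hab : a + b = 1), 0 < b →
      ∀ g : E →ₗ[ℝ] ℝ, (∀ k, 0 ≤ g (σ.v k)) → ∀ k, 0 ≤ g ((σ.replace i j hij a b ha hab).v k) := by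
    intro i j hij a b ha hab hb g hg k
    have ha' : (0 : ℝ) < a := by exact_mod_cast ha
    have hb' : (0 : ℝ) < b := by exact_mod_cast hb
    by_cases hk : k = i
    · subst hk
      have := hg k
      have := hg j
      simp only [replace, Function.update_self, map_add, map_smul, smul_eq_mul]
      positivity
    · simpa [replace, hk] using hg k
  obtain ⟨T₁, N₁, h₁, s₁⟩ := descend i j hij a b ha hab hzero hi.ne'
  obtain ⟨T₂, N₂, h₂, s₂⟩ := descend j i hij.symm b a hb (by rw [add_comm, hab])
    (by rw [add_comm, hzero]) hj.ne
  refine ⟨T₁ ++ T₂, _ :: (N₁ ++ N₂), h₁.append_of_ind h₂ (l := (b : ℝ) • σ.c i - (a : ℝ) • σ.c j)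
    ?_ (fun y hy => σ.ind_replace i j hij a b ha hb hab y hy) (mono _ _ _ _ _ _ _ hb)
    (mono _ _ _ _ _ _ _ ha), ?_⟩
  · intro h0
    have := congrArg (fun l : E →ₗ[ℝ] ℝ => l (σ.v i)) h0
    simp [σ.c_v, hij.symm, hb.ne'] at this
  · intro τ hτ
    rcases List.mem_append.1 hτ with hτ | hτ
    exacts [s₁ τ hτ, s₂ τ hτ]

lemma Refines.exists_flatMap {σ : RatSimplex ι R h} {T : List (RatSimplex ι R h)}
    {N : List (E →ₗ[ℝ] ℝ)} (hT : Refines T N σ) {p : RatSimplex ι R h → Prop}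
    (H : ∀ τ, ∃ T N, Refines T N τ ∧ ∀ ρ ∈ T, p ρ) :
    ∃ T' N', Refines T' N' σ ∧ (∀ ρ ∈ T', p ρ) ∧
      ∀ g : E →ₗ[ℝ] ℝ, (∀ τ ∈ T, SignConst g τ) → ∀ ρ ∈ T', SignConst g ρ := by
  choose S M hS hp using H
  refine ⟨T.flatMap S, N ++ T.flatMap M, ⟨?_, ?_, ?_⟩, ?_, ?_⟩
  · intro l hl
    rcases List.mem_append.1 hl with hl | hl
    · exact hT.ne_zero l hl
    · obtain ⟨τ, -, hl⟩ := List.mem_flatMap.1 hl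
      exact (hS τ).ne_zero l hl
  · intro y hy
    rw [← hT.sum_ind y fun l hl => hy l (List.mem_append_left _ hl)]
    have hy' : ∀ τ ∈ T, ∀ l ∈ M τ, l y ≠ 0 := fun τ hτ l hl =>
      hy l (List.mem_append_right _ (List.mem_flatMap.2 ⟨τ, hτ, hl⟩))
    rw [← List.map_congr_left fun τ hτ => (hS τ).sum_ind y (hy' τ hτ)]
    exact sum_map_flatMap T S (ind y)
  · intro ρ hρ g hg
    obtain ⟨τ, hτ, hρ⟩ := List.mem_flatMap.1 hρ
    exact (hS τ).nonneg ρ hρ g (hT.nonneg τ hτ g hg)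
  · intro ρ hρ
    obtain ⟨τ, hτ, hρ⟩ := List.mem_flatMap.1 hρ
    exact hp τ ρ hρ
  · intro g hg ρ hρ
    obtain ⟨τ, hτ, hρ⟩ := List.mem_flatMap.1 hρ
    exact (hS τ).signConst hρ (hg τ hτ)

lemma exists_refines_forall_signConst [IsScalarTower ℚ ℝ E] (G : List (E →ₗ[ℝ] ℝ))
    (hG : ∀ g ∈ G, ∀ x ∈ R, ∃ q : ℚ, g x = q) (σ : RatSimplex ι R h) :
    ∃ T N, Refines T N σ ∧ ∀ g ∈ G, ∀ τ ∈ T, SignConst g τ := by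
  induction G with
  | nil => exact ⟨[σ], [], .refl σ, by simp⟩
  | cons g G ih =>
    simp only [List.mem_cons, forall_eq_or_imp] at hG ⊢
    obtain ⟨T, N, hT, hs⟩ := ih hG.2
    obtain ⟨T', N', hT', hp, hs'⟩ := hT.exists_flatMap (exists_refines_signConst g hG.1)
    exact ⟨T', N', hT', hp, fun g' hg' => hs' g' (hs g' hg')⟩

/-- If no coordinate of `ρ` changes sign on `τ`, the open cones over `ρ` and `τ` are generically
nested or disjoint. -/
lemma pos_iff_of_signConst {ρ τ : RatSimplex ι R h} (hs : ∀ i, SignConst (ρ.c i) τ) {y : E}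
    (hy : τ.Pos y) (hne : ∀ i, ρ.c i y ≠ 0) :
    ρ.Pos y ↔ ∀ i j, 0 ≤ ρ.c i (τ.v j) := by
  constructor
  · intro H i
    rcases hs i with h0 | h0
    · exact h0
    · have := ρ.c i |> τ.apply_eq_sum (y := y)
      have h1 : ∑ j, τ.c j y * ρ.c i (τ.v j) ≤ 0 :=
        Finset.sum_nonpos fun j _ => mul_nonpos_of_nonneg_of_nonpos (hy j).le (h0 j)
      have := H i
      linarith
  · intro H i
    refine lt_of_le_of_ne ?_ (hne i).symm
    rw [τ.apply_eq_sum (ρ.c i)]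
    exact Finset.sum_nonneg fun j _ => mul_nonneg (hy j).le (H i j)

open Classical in
/-- A finite union of cones over simplices is generically a disjoint union of such cones. -/
lemma exists_disjoint_union [IsScalarTower ℚ ℝ E] (B : List (RatSimplex ι R h)) :
    ∃ (T : List (RatSimplex ι R h)) (N : List (E →ₗ[ℝ] ℝ)), (∀ l ∈ N, l ≠ 0) ∧
      (∀ σ ∈ B, ∀ i, σ.c i ∈ N) ∧
      ∀ y, (∀ l ∈ N, l y ≠ 0) → (T.map (ind y)).sum = if ∃ σ ∈ B, σ.Pos y then 1 else 0 := by
  induction B with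
  | nil => exact ⟨[], [], by simp, by simp, by simp⟩
  | cons σ B ih =>
    obtain ⟨T, N, hN, hBN, hT⟩ := ih
    set G : List (E →ₗ[ℝ] ℝ) := B.flatMap fun ρ => Finset.univ.toList.map ρ.c with hG
    have memG : ∀ ρ ∈ B, ∀ i, ρ.c i ∈ G := fun ρ hρ i =>
      List.mem_flatMap.2 ⟨ρ, hρ, List.mem_map.2 ⟨i, by simp, rfl⟩⟩
    obtain ⟨S, M, hS, hs⟩ := exists_refines_forall_signConst G (by
      intro g hg
      obtain ⟨ρ, -, hg⟩ := List.mem_flatMap.1 hg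
      obtain ⟨i, -, rfl⟩ := List.mem_map.1 hg
      exact ρ.c_rat i) σ
    refine ⟨T ++ S.filter (fun τ => ¬ ∃ ρ ∈ B, ∀ i j, 0 ≤ ρ.c i (τ.v j)),
      Finset.univ.toList.map σ.c ++ (N ++ M), ?_, ?_, ?_⟩
    · intro l hl
      simp only [List.mem_append, List.mem_map] at hl
      rcases hl with ⟨i, -, rfl⟩ | hl | hl
      exacts [σ.c_ne_zero i, hN l hl, hS.ne_zero l hl]
    · simp only [List.mem_cons, forall_eq_or_imp, List.mem_append]
      exact ⟨fun i => .inl (List.mem_map.2 ⟨i, by simp, rfl⟩), fun ρ hρ i => .inr (.inl (hBN ρ hρ i))⟩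
    · intro y hy
      have hyN : ∀ l ∈ N, l y ≠ 0 := fun l hl => hy l (by simp [hl])
      have hyM : ∀ l ∈ M, l y ≠ 0 := fun l hl => hy l (by simp [hl])
      have key : ((S.filter (fun τ => ¬ ∃ ρ ∈ B, ∀ i j, 0 ≤ ρ.c i (τ.v j))).map (ind y)).sum =
          if ∃ ρ ∈ B, ρ.Pos y then 0 else (S.map (ind y)).sum := by
        have hiff : ∀ τ ∈ S, τ.Pos y →
            ((∃ ρ ∈ B, ∀ i j, 0 ≤ ρ.c i (τ.v j)) ↔ ∃ ρ ∈ B, ρ.Pos y) := by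
          intro τ hτ hp
          refine exists_congr fun ρ => and_congr_right fun hρ => ?_
          exact (pos_iff_of_signConst (fun i => hs _ (memG ρ hρ i) τ hτ) hp
            fun i => hyN _ (hBN ρ hρ i)).symm
        clear hs hS
        induction S with
        | nil => simp
        | cons τ S ihS =>
          simp only [List.mem_cons, forall_eq_or_imp] at hiff
          have ihS := ihS hiff.2
          by_cases hp : τ.Pos y
          · have h1 := hiff.1 hp
            by_cases hB : ∃ ρ ∈ B, ρ.Pos y
            · rw [List.filter_cons_of_neg (by simpa using h1.2 hB), ihS]
              simp [hB]
            · rw [List.filter_cons_of_pos (by simpa using fun h => hB (h1.1 h)), List.map_cons,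
                List.sum_cons, ihS]
              simp [hB]
          · have h0 : ind y τ = 0 := by simp [ind, hp]
            rw [List.map_cons, List.sum_cons, h0, zero_add, ← ihS, List.filter_cons]
            split_ifs <;> simp [h0]
      rw [List.map_append, List.sum_append, hT y hyN, key, hS.sum_ind y hyM]
      simp only [List.mem_cons, exists_eq_or_imp, ind]
      by_cases hB : ∃ ρ ∈ B, ρ.Pos y
      · simp [hB]
      · simp [hB]

end RatSimplex

end Subdivision

section Counting

/-- The functions `f` and `g` on the positive integers are the values at `t`, and up to the sign
`(-1) ^ n` the values at `-t`, of a common quasi-polynomial of period `p`. -/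
def RecPair (n p : ℕ) (f g : ℕ → ℚ) : Prop :=
  ∃ q : ZMod p → Polynomial ℚ, ∀ t : ℕ, 0 < t →
    f t = (q (t : ZMod p)).eval (t : ℚ) ∧
    g t = (-1) ^ n * (q ((-(t : ℤ) : ℤ) : ZMod p)).eval (-(t : ℚ))

namespace RecPair

variable {n p : ℕ}

lemma zero : RecPair n p (fun _ => 0) (fun _ => 0) := ⟨fun _ => 0, by simp⟩

lemma add {f g f' g' : ℕ → ℚ} (h : RecPair n p f g) (h' : RecPair n p f' g') :
    RecPair n p (fun t => f t + f' t) (fun t => g t + g' t) := by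
  obtain ⟨q, hq⟩ := h
  obtain ⟨q', hq'⟩ := h'
  refine ⟨fun r => q r + q' r, fun t ht => ?_⟩
  simp only [Polynomial.eval_add, (hq t ht).1, (hq' t ht).1, (hq t ht).2, (hq' t ht).2, mul_add,
    and_self]

lemma finset_sum {α : Type*} (s : Finset α) {f g : α → ℕ → ℚ}
    (h : ∀ a ∈ s, RecPair n p (f a) (g a)) :
    RecPair n p (fun t => ∑ a ∈ s, f a t) (fun t => ∑ a ∈ s, g a t) := by
  classical
  induction s using Finset.induction_on with
  | empty => simpa using zero
  | insert a s ha ih =>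
    simp only [Finset.sum_insert ha]
    exact (h a (by simp)).add (ih fun b hb => h b (by simp [hb]))

lemma list_sum {α : Type*} (s : List α) {f g : α → ℕ → ℚ} (h : ∀ a ∈ s, RecPair n p (f a) (g a)) :
    RecPair n p (fun t => (s.map fun a => f a t).sum) (fun t => (s.map fun a => g a t).sum) := by
  induction s with
  | nil => simpa using zero
  | cons a s ih =>
    simp only [List.map_cons, List.sum_cons]
    exact (h a (by simp)).add (ih fun b hb => h b (by simp [hb]))

end RecPair

/-- The polynomial continuation of `k ↦ (k + n).choose n`. -/
def chooseContinuation (n : ℕ) (z : ℚ) : ℚ := (∏ j ∈ Finset.range n, (z + (j + 1))) / n.factorial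

lemma chooseContinuation_natCast (n k : ℕ) : chooseContinuation n k = (k + n).choose n := by
  have h := Nat.ascFactorial_eq_factorial_mul_choose k n
  rw [Nat.ascFactorial_eq_prod_range] at h
  have hn : (n.factorial : ℚ) ≠ 0 := by exact_mod_cast n.factorial_ne_zero
  rw [chooseContinuation, div_eq_iff hn, mul_comm]
  rw [← Nat.cast_mul, ← h]
  push_cast
  exact Finset.prod_congr rfl fun j _ => by ring

lemma chooseContinuation_reflect (n : ℕ) (z : ℚ) :
    chooseContinuation n z = (-1) ^ n * chooseContinuation n (-z - (n + 1)) := by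
  unfold chooseContinuation
  rw [← mul_div_assoc]
  congr 1
  rw [← Finset.prod_range_reflect (fun j : ℕ => -z - ((n : ℚ) + 1) + ((j : ℚ) + 1))]
  conv_rhs => rw [← Finset.card_range n, ← Finset.prod_const, Finset.card_range n,
    ← Finset.prod_mul_distrib]
  refine Finset.prod_congr rfl fun j hj => ?_
  have hj := Finset.mem_range.1 hj
  rw [Nat.sub_sub, Nat.cast_sub (by lia)]
  push_cast
  ring

/-- The number of ways to write `s` as an ordered sum of `n + 1` nonnegative multiples of `p`. -/
def multipleCount (n p : ℕ) (s : ℤ) : ℕ :=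
  if (p : ℤ) ∣ s ∧ 0 ≤ s then ((s / p).toNat + n).choose n else 0

lemma multipleCount_of_dvd {n p : ℕ} (hp : 0 < p) {s : ℤ} (hs : (p : ℤ) ∣ s)
    (hlt : -((p : ℤ) * (n + 1)) < s) :
    (multipleCount n p s : ℚ) = chooseContinuation n ((s : ℚ) / p) := by
  obtain ⟨k, rfl⟩ := hs
  have hp' : (p : ℚ) ≠ 0 := by exact_mod_cast hp.ne'
  have hpz : (0 : ℤ) < p := by exact_mod_cast hp
  have e : (((p : ℤ) * k : ℤ) : ℚ) / p = k := by push_cast; field_simp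
  rw [e]
  rcases le_or_gt 0 k with hk | hk
  · lift k to ℕ using hk
    rw [multipleCount, if_pos ⟨dvd_mul_right _ _, by positivity⟩,
      Int.mul_ediv_cancel_left _ hpz.ne']
    simp [chooseContinuation_natCast]
  · rw [multipleCount, if_neg fun h => by nlinarith [h.2]]
    have hk' : -((n : ℤ) + 1) < k := by
      rw [← mul_neg] at hlt
      exact lt_of_mul_lt_mul_left hlt hpz.le
    rw [chooseContinuation, Finset.prod_eq_zero (i := (-k - 1).toNat), Nat.cast_zero, zero_div]
    · rw [Finset.mem_range]; lia
    · have : (((-k - 1).toNat : ℤ) : ℚ) = ((-k - 1 : ℤ) : ℚ) := by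
        rw [Int.toNat_of_nonneg (by lia)]
      rw [Int.cast_natCast] at this
      rw [this]
      push_cast
      ring

lemma multipleCount_of_not_dvd {n p : ℕ} {s : ℤ} (hs : ¬ (p : ℤ) ∣ s) :
    multipleCount n p s = 0 := if_neg fun h => hs h.1

open Polynomial in
lemma recPair_multipleCount {n p : ℕ} (hp : 0 < p) {a : ℤ} (ha : 0 ≤ a)
    (ha' : a ≤ (p : ℤ) * (n + 1)) :
    RecPair n p (fun t => multipleCount n p (t - a))
      (fun t => multipleCount n p (t + a - p * (n + 1))) := by
  have hp' : (p : ℚ) ≠ 0 := by exact_mod_cast hp.ne'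
  refine ⟨fun r => if r = (a : ZMod p) then
    C ((n.factorial : ℚ)⁻¹) * ∏ j ∈ Finset.range n, (C ((p : ℚ)⁻¹) * (X - C (a : ℚ)) + C (j + 1 : ℚ))
    else 0, fun t ht => ⟨?_, ?_⟩⟩
  · have hiff : ((t : ZMod p) = (a : ZMod p)) ↔ (p : ℤ) ∣ (t - a) := by
      rw [← ZMod.intCast_zmod_eq_zero_iff_dvd]
      push_cast
      exact sub_eq_zero.symm
    by_cases h : (p : ℤ) ∣ (t - a)
    · simp only
      rw [if_pos (hiff.2 h), multipleCount_of_dvd hp h (by lia), chooseContinuation]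
      simp only [eval_mul, eval_C, eval_prod, eval_add, eval_sub, eval_X]
      push_cast
      rw [div_eq_inv_mul]
      congr 1
      exact Finset.prod_congr rfl fun j _ => by rw [div_eq_inv_mul]
    · simp only
      rw [if_neg fun h' => h (hiff.1 h'), multipleCount_of_not_dvd h]
      simp
  · have hiff : (((-(t : ℤ) : ℤ) : ZMod p) = (a : ZMod p)) ↔ (p : ℤ) ∣ (t + a - p * (n + 1)) := by
      rw [← ZMod.intCast_zmod_eq_zero_iff_dvd]
      push_cast
      rw [ZMod.natCast_self, zero_mul, sub_zero, neg_eq_iff_add_eq_zero]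
    by_cases h : (p : ℤ) ∣ (t + a - p * (n + 1))
    · simp only
      rw [if_pos (hiff.2 h), multipleCount_of_dvd hp h (by lia), chooseContinuation_reflect]
      congr 1
      rw [chooseContinuation]
      simp only [eval_mul, eval_C, eval_prod, eval_add, eval_sub, eval_X]
      push_cast
      rw [div_eq_inv_mul]
      congr 1
      refine Finset.prod_congr rfl fun j _ => ?_
      field_simp
      ring
    · simp only
      rw [if_neg fun h' => h (hiff.1 h'), multipleCount_of_not_dvd h]
      simp

/-- The tuples of natural numbers with `p * ∑ i, k i = s`. -/
noncomputable def multipleTuples (ι : Type*) [Fintype ι] [DecidableEq ι] (p : ℕ) (s : ℤ) :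
    Finset (ι →₀ ℕ) :=
  if (p : ℤ) ∣ s ∧ 0 ≤ s then Finset.univ.finsuppAntidiag (s / p).toNat else ∅

variable {ι : Type*} [Fintype ι] [DecidableEq ι]

lemma mem_multipleTuples {p : ℕ} (hp : 0 < p) {s : ℤ} {k : ι →₀ ℕ} :
    k ∈ multipleTuples ι p s ↔ (p : ℤ) * ∑ i, (k i : ℤ) = s := by
  have hpz : (0 : ℤ) < p := by exact_mod_cast hp
  unfold multipleTuples
  split_ifs with h
  · obtain ⟨⟨m, rfl⟩, h0⟩ := h
    have hm : 0 ≤ m := nonneg_of_mul_nonneg_right h0 hpz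
    lift m to ℕ using hm
    rw [Int.mul_ediv_cancel_left _ hpz.ne', mul_right_inj' hpz.ne']
    simp only [Finset.mem_finsuppAntidiag, Int.toNat_natCast, Finset.subset_univ, and_true]
    exact_mod_cast Iff.rfl
  · simp only [Finset.notMem_empty, false_iff]
    rintro rfl
    exact h ⟨dvd_mul_right _ _, by positivity⟩

lemma card_multipleTuples {n p : ℕ} (hι : Fintype.card ι = n + 1) (s : ℤ) :
    (multipleTuples ι p s).card = multipleCount n p s := by
  unfold multipleTuples multipleCount
  split_ifs with h
  · rw [Finset.card_finsuppAntidiag_nat_eq_choose, Finset.card_univ, hι,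
      show n + 1 + (s / p).toNat - 1 = (s / p).toNat + n by lia, Nat.choose_symm_add]
  · simp

namespace RatSimplex

variable {E : Type*} [AddCommGroup E] [Module ℝ E] [Module ℚ E] {R : Submodule ℚ E}
  {h : E →ₗ[ℝ] ℝ}

/-- The lattice points of height `t` in the cone over `σ` with the facets outside `I` removed. -/
def coneSet (σ : RatSimplex ι R h) (L : AddSubgroup E) (I : Set ι) (t : ℕ) : Set E :=
  {x | x ∈ L ∧ h x = t ∧ ∀ i, 0 < σ.c i x ∨ i ∈ I ∧ σ.c i x = 0}

/-- The lattice points in the half-open parallelepiped spanned by the `p • v i`. -/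
def boxSet (σ : RatSimplex ι R h) (L : AddSubgroup E) (I : Set ι) (p : ℕ) : Set E :=
  {x | x ∈ L ∧ ∀ i, (i ∈ I → 0 ≤ σ.c i x ∧ σ.c i x < p) ∧ (i ∉ I → 0 < σ.c i x ∧ σ.c i x ≤ p)}

lemma height_eq_sum (σ : RatSimplex ι R h) (x : E) : h x = ∑ i, σ.c i x := by
  simp [σ.apply_eq_sum h x, σ.h_v]

lemma c_sum_smul (σ : RatSimplex ι R h) (a : ι → ℝ) (i : ι) : σ.c i (∑ j, a j • σ.v j) = a i := by
  simp [σ.c_v]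

lemma ext_c (σ : RatSimplex ι R h) {x y : E} (hxy : ∀ i, σ.c i x = σ.c i y) : x = y := by
  rw [← σ.sum_c x, ← σ.sum_c y]
  simp [hxy]

lemma boxSet_c_mem_Icc {σ : RatSimplex ι R h} {L : AddSubgroup E} {I : Set ι} {p : ℕ} {x : E}
    (hx : x ∈ σ.boxSet L I p) (i : ι) : 0 ≤ σ.c i x ∧ σ.c i x ≤ p := by
  by_cases hi : i ∈ I
  · exact ⟨((hx.2 i).1 hi).1, ((hx.2 i).1 hi).2.le⟩
  · exact ⟨((hx.2 i).2 hi).1.le, ((hx.2 i).2 hi).2⟩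

/-- A lattice point of the box shifted by a nonnegative combination of the `p • v i`. -/
def shift (σ : RatSimplex ι R h) (p : ℕ) (u : Σ _ : E, ι →₀ ℕ) : E :=
  u.1 + ∑ i, ((p : ℝ) * u.2 i) • σ.v i

lemma c_shift (σ : RatSimplex ι R h) (p : ℕ) (u : Σ _ : E, ι →₀ ℕ) (i : ι) :
    σ.c i (σ.shift p u) = σ.c i u.1 + p * u.2 i := by
  rw [shift, map_add, c_sum_smul]

lemma sum_smul_mem (σ : RatSimplex ι R h) {L : AddSubgroup E} {p : ℕ}
    (hL : ∀ i, (p : ℝ) • σ.v i ∈ L) (k : ι → ℕ) : ∑ i, ((p : ℝ) * k i) • σ.v i ∈ L := by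
  refine L.sum_mem fun i _ => ?_
  rw [mul_comm, mul_smul, Nat.cast_smul_eq_nsmul]
  exact L.nsmul_mem (hL i) _

lemma eq_of_halfOpen {p : ℕ} {a a' : ℝ} {k k' : ℕ}
    (H : 0 ≤ a ∧ a < p ∧ 0 ≤ a' ∧ a' < p ∨ 0 < a ∧ a ≤ p ∧ 0 < a' ∧ a' ≤ p)
    (e : a + p * k = a' + p * k') : k = k' := by
  have main : ∀ {a a' : ℝ} {k k' : ℕ}, a - a' < p → a + p * k = a' + p * k' → k' ≤ k := by
    intro a a' k k' H e
    by_contra! hlt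
    have h1 : (k : ℝ) + 1 ≤ k' := by exact_mod_cast hlt
    have : (p : ℝ) * (k + 1) ≤ p * k' := mul_le_mul_of_nonneg_left h1 (by positivity)
    linarith
  rcases H with ⟨_, _, _, _⟩ | ⟨_, _, _, _⟩
  all_goals exact le_antisymm (main (by linarith) e.symm) (main (by linarith) e)

lemma exists_halfOpen_of_nonneg {p : ℕ} (hp : 0 < p) {a : ℝ} (ha : 0 ≤ a) :
    ∃ k : ℕ, 0 ≤ a - p * k ∧ a - p * k < p := by
  have hp' : (0 : ℝ) < p := by exact_mod_cast hp
  refine ⟨⌊a / p⌋₊, ?_, ?_⟩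
  · have := Nat.floor_le (div_nonneg ha hp'.le)
    rw [le_div_iff₀ hp'] at this
    linarith
  · have := Nat.lt_floor_add_one (a / p)
    rw [div_lt_iff₀ hp'] at this
    linarith

lemma exists_halfOpen_of_pos {p : ℕ} (hp : 0 < p) {a : ℝ} (ha : 0 < a) :
    ∃ k : ℕ, 0 < a - p * k ∧ a - p * k ≤ p := by
  have hp' : (0 : ℝ) < p := by exact_mod_cast hp
  have hc : 0 < ⌈a / p⌉₊ := Nat.ceil_pos.2 (div_pos ha hp')
  obtain ⟨m, hm⟩ := Nat.exists_eq_succ_of_ne_zero hc.ne'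
  refine ⟨m, ?_, ?_⟩
  · have : (m : ℝ) < a / p := Nat.lt_ceil.1 (by lia)
    rw [lt_div_iff₀ hp'] at this
    linarith
  · have := Nat.le_ceil (a / p)
    rw [hm, div_le_iff₀ hp'] at this
    push_cast at this
    linarith

lemma coneSet_eq_image (σ : RatSimplex ι R h) {L : AddSubgroup E} {I : Set ι} {p : ℕ} (hp : 0 < p)
    (hL : ∀ i, (p : ℝ) • σ.v i ∈ L) (hLh : ∀ x ∈ L, (⌊h x⌋ : ℝ) = h x)
    (hfin : (σ.boxSet L I p).Finite) (t : ℕ) :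
    σ.coneSet L I t = σ.shift p ''
      (hfin.toFinset.sigma fun u => multipleTuples ι p (t - ⌊h u⌋) : Finset (Σ _ : E, ι →₀ ℕ)) := by
  have hheight : ∀ (u : Σ _ : E, ι →₀ ℕ), u.1 ∈ L →
      (h (σ.shift p u) = t ↔ u.2 ∈ multipleTuples ι p (t - ⌊h u.1⌋)) := by
    intro u hu
    rw [mem_multipleTuples hp, height_eq_sum σ]
    simp only [c_shift, Finset.sum_add_distrib]
    rw [← height_eq_sum, ← hLh _ hu, ← Finset.mul_sum, eq_sub_iff_add_eq, add_comm,
      Int.floor_intCast]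
    exact_mod_cast Iff.rfl
  ext x
  simp only [Set.mem_image, Finset.mem_coe, Finset.mem_sigma, Set.Finite.mem_toFinset]
  constructor
  · rintro ⟨hxL, hxt, hx⟩
    have hk : ∀ i, ∃ k : ℕ, (i ∈ I → 0 ≤ σ.c i x - p * k ∧ σ.c i x - p * k < p) ∧
        (i ∉ I → 0 < σ.c i x - p * k ∧ σ.c i x - p * k ≤ p) := by
      intro i
      by_cases hi : i ∈ I
      · obtain ⟨k, hk⟩ := exists_halfOpen_of_nonneg hp (a := σ.c i x) (by
          rcases hx i with h | h
          exacts [h.le, h.2.ge])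
        exact ⟨k, fun _ => hk, fun h => absurd hi h⟩
      · obtain ⟨k, hk⟩ := exists_halfOpen_of_pos hp (a := σ.c i x) ((hx i).resolve_right
          fun h => hi h.1)
        exact ⟨k, fun h => absurd h hi, fun _ => hk⟩
    choose k hk using hk
    set u : E := x - ∑ i, ((p : ℝ) * k i) • σ.v i with hu
    have huL : u ∈ L := L.sub_mem hxL (σ.sum_smul_mem hL k)
    have hshift : σ.shift p ⟨u, Finsupp.equivFunOnFinite.symm k⟩ = x := by
      simp [shift, hu]
    refine ⟨⟨u, Finsupp.equivFunOnFinite.symm k⟩, ⟨⟨huL, fun i => ?_⟩, ?_⟩, hshift⟩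
    · have : σ.c i u = σ.c i x - p * k i := by rw [hu, map_sub, c_sum_smul]
      simp only [this]
      exact hk i
    · exact (hheight _ huL).1 (by rw [hshift, hxt])
  · rintro ⟨u, ⟨hu, hk⟩, rfl⟩
    refine ⟨L.add_mem hu.1 (σ.sum_smul_mem hL _), (hheight u hu.1).2 hk, fun i => ?_⟩
    rw [c_shift]
    have : (0 : ℝ) ≤ p * u.2 i := by positivity
    by_cases hi : i ∈ I
    · have := ((hu.2 i).1 hi).1
      rcases eq_or_lt_of_le (show 0 ≤ σ.c i u.1 + p * u.2 i by linarith) with h | h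
      · exact .inr ⟨hi, h.symm⟩
      · exact .inl h
    · have := ((hu.2 i).2 hi).1
      exact .inl (by linarith)

lemma shift_injOn (σ : RatSimplex ι R h) {L : AddSubgroup E} {I : Set ι} {p : ℕ} :
    Set.InjOn (σ.shift p) {u | u.1 ∈ σ.boxSet L I p} := by
  rintro ⟨u, k⟩ hu ⟨u', k'⟩ hu' e
  have hc : ∀ i, σ.c i u + p * k i = σ.c i u' + p * k' i := fun i => by
    simpa [c_shift] using congrArg (σ.c i) e
  have hk : ∀ i, k i = k' i := by
    intro i
    refine eq_of_halfOpen ?_ (hc i)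
    by_cases hi : i ∈ I
    · have h1 := (hu.2 i).1 hi
      have h2 := (hu'.2 i).1 hi
      exact .inl ⟨h1.1, h1.2, h2.1, h2.2⟩
    · have h1 := (hu.2 i).2 hi
      have h2 := (hu'.2 i).2 hi
      exact .inr ⟨h1.1, h1.2, h2.1, h2.2⟩
  obtain rfl : k = k' := Finsupp.ext hk
  obtain rfl : u = u' := σ.ext_c fun i => by simpa using hc i
  rfl

lemma finite_coneSet (σ : RatSimplex ι R h) {L : AddSubgroup E} {I : Set ι} {p : ℕ} (hp : 0 < p)
    (hL : ∀ i, (p : ℝ) • σ.v i ∈ L) (hLh : ∀ x ∈ L, (⌊h x⌋ : ℝ) = h x)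
    (hfin : (σ.boxSet L I p).Finite) (t : ℕ) : (σ.coneSet L I t).Finite := by
  rw [σ.coneSet_eq_image hp hL hLh hfin]
  exact (Finset.finite_toSet _).image _

lemma ncard_coneSet (σ : RatSimplex ι R h) {L : AddSubgroup E} {I : Set ι} {n p : ℕ} (hp : 0 < p)
    (hι : Fintype.card ι = n + 1)
    (hL : ∀ i, (p : ℝ) • σ.v i ∈ L) (hLh : ∀ x ∈ L, (⌊h x⌋ : ℝ) = h x)
    (hfin : (σ.boxSet L I p).Finite) (t : ℕ) :
    (σ.coneSet L I t).ncard = ∑ u ∈ hfin.toFinset, multipleCount n p (t - ⌊h u⌋) := by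
  rw [σ.coneSet_eq_image hp hL hLh hfin, Set.InjOn.ncard_image, Set.ncard_coe_finset,
    Finset.card_sigma]
  · exact Finset.sum_congr rfl fun u _ => card_multipleTuples hι _
  · refine (σ.shift_injOn (L := L) (I := I)).mono fun u hu => ?_
    simpa using (Finset.mem_sigma.1 (Finset.mem_coe.1 hu)).1

/-- Reciprocity for the half-open cones over a simplex. -/
lemma recPair_coneSet (σ : RatSimplex ι R h) {L : AddSubgroup E} (I : Set ι) {n p : ℕ} (hp : 0 < p)
    (hι : Fintype.card ι = n + 1)
    (hL : ∀ i, (p : ℝ) • σ.v i ∈ L) (hLh : ∀ x ∈ L, (⌊h x⌋ : ℝ) = h x)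
    (hfin : ∀ I, (σ.boxSet L I p).Finite) :
    RecPair n p (fun t => (σ.coneSet L I t).ncard) (fun t => (σ.coneSet L Iᶜ t).ncard) := by
  have hsum : ∀ t : ℕ, (σ.coneSet L Iᶜ t).ncard =
      ∑ u ∈ (hfin I).toFinset, multipleCount n p (t + ⌊h u⌋ - p * (n + 1)) := by
    intro t
    rw [σ.ncard_coneSet hp hι hL hLh (hfin Iᶜ)]
    set w : E := ∑ i, ((p : ℝ) * (1 : ℕ)) • σ.v i with hw
    have hwL : w ∈ L := σ.sum_smul_mem hL fun _ => 1
    have hcw : ∀ i, σ.c i w = p := fun i => by rw [hw, c_sum_smul]; simp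
    have hhw : h w = p * (n + 1) := by
      rw [σ.height_eq_sum]; simp [hcw, hι]; ring
    have hbox : ∀ (J : Set ι) (u : E), u ∈ σ.boxSet L J p → w - u ∈ σ.boxSet L Jᶜ p := by
      intro J u hu
      refine ⟨L.sub_mem hwL hu.1, fun i => ?_⟩
      rw [map_sub, hcw]
      constructor
      · intro hi
        have := (hu.2 i).2 hi
        constructor <;> linarith
      · intro hi
        have := (hu.2 i).1 (not_not.1 hi)
        constructor <;> linarith
    refine Finset.sum_bij' (fun u _ => w - u) (fun u _ => w - u) ?_ ?_ ?_ ?_ ?_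
    · intro u hu
      simpa using hbox _ _ ((hfin _).mem_toFinset.1 hu)
    · intro u hu
      simpa using hbox _ _ ((hfin _).mem_toFinset.1 hu)
    · simp
    · simp
    · intro u hu
      have huL := ((hfin _).mem_toFinset.1 hu).1
      congr 1
      have h1 := hLh _ (L.sub_mem hwL huL)
      rw [map_sub, hhw, ← hLh u huL] at h1
      rw [map_sub, hhw, ← hLh u huL]
      have : ⌊(p : ℝ) * (n + 1) - (⌊h u⌋ : ℝ)⌋ = p * (n + 1) - ⌊h u⌋ := by exact_mod_cast h1
      rw [this, Int.floor_intCast]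
      ring
  simp only [hsum, σ.ncard_coneSet hp hι hL hLh (hfin I), Nat.cast_sum]
  refine RecPair.finset_sum _ fun u hu => ?_
  have hu' := (hfin _).mem_toFinset.1 hu
  refine recPair_multipleCount hp ?_ ?_
  · rw [Int.floor_nonneg, σ.height_eq_sum]
    exact Finset.sum_nonneg fun i _ => (boxSet_c_mem_Icc hu' i).1
  · have : h u ≤ p * (n + 1) := by
      rw [σ.height_eq_sum]
      calc ∑ i, σ.c i u ≤ ∑ _i : ι, (p : ℝ) :=
            Finset.sum_le_sum fun i _ => (boxSet_c_mem_Icc hu' i).2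
        _ = p * (n + 1) := by simp [hι]; ring
    rw [← hLh _ hu'.1] at this
    exact_mod_cast this

end RatSimplex

end Counting

section Homogenization

open Filter Topology

variable {n : ℕ}

/-- The rational points of `ℝⁿ × ℝ`. -/
def ratPoints (n : ℕ) : Submodule ℚ ((Fin n → ℝ) × ℝ) where
  carrier := {x | (∀ i, ∃ q : ℚ, x.1 i = q) ∧ ∃ q : ℚ, x.2 = q}
  zero_mem' := ⟨fun _ => ⟨0, by simp⟩, 0, by simp⟩
  add_mem' := by
    rintro x y ⟨hx, a, ha⟩ ⟨hy, b, hb⟩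
    refine ⟨fun i => ?_, a + b, by simp [ha, hb]⟩
    obtain ⟨a, ha⟩ := hx i
    obtain ⟨b, hb⟩ := hy i
    exact ⟨a + b, by simp [ha, hb]⟩
  smul_mem' := by
    rintro c x ⟨hx, a, ha⟩
    refine ⟨fun i => ?_, c * a, by simp [ha, Rat.smul_def]⟩
    obtain ⟨a, ha⟩ := hx i
    exact ⟨c * a, by simp [ha, Rat.smul_def]⟩

/-- The integral points of `ℝⁿ × ℝ`. -/
def intPoints (n : ℕ) : AddSubgroup ((Fin n → ℝ) × ℝ) where
  carrier := {x | (∀ i, ∃ m : ℤ, x.1 i = m) ∧ ∃ m : ℤ, x.2 = m}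
  zero_mem' := ⟨fun _ => ⟨0, by simp⟩, 0, by simp⟩
  add_mem' := by
    rintro x y ⟨hx, a, ha⟩ ⟨hy, b, hb⟩
    refine ⟨fun i => ?_, a + b, by simp [ha, hb]⟩
    obtain ⟨a, ha⟩ := hx i
    obtain ⟨b, hb⟩ := hy i
    exact ⟨a + b, by simp [ha, hb]⟩
  neg_mem' := by
    rintro x ⟨hx, a, ha⟩
    refine ⟨fun i => ?_, -a, by simp [ha]⟩
    obtain ⟨a, ha⟩ := hx i
    exact ⟨-a, by simp [ha]⟩

lemma floor_snd_of_mem_intPoints {x : (Fin n → ℝ) × ℝ} (hx : x ∈ intPoints n) :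
    (⌊LinearMap.snd ℝ (Fin n → ℝ) ℝ x⌋ : ℝ) = LinearMap.snd ℝ (Fin n → ℝ) ℝ x := by
  obtain ⟨-, m, hm⟩ := hx
  simp [hm]

lemma finite_intPoints_norm_le (r : ℝ) : {x | x ∈ intPoints n ∧ ‖x‖ ≤ r}.Finite := by
  set f : (Fin n → ℤ) × ℤ → (Fin n → ℝ) × ℝ := fun x => (fun i => (x.1 i : ℝ), (x.2 : ℝ))
  have hle : ∀ (m : ℤ), |(m : ℝ)| ≤ r → -⌈r⌉ ≤ m ∧ m ≤ ⌈r⌉ := by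
    intro m hm
    have h1 : |(m : ℝ)| ≤ (⌈r⌉ : ℝ) := hm.trans (Int.le_ceil r)
    exact abs_le.1 (by exact_mod_cast h1)
  refine (((Set.finite_Icc (fun _ => -⌈r⌉ : Fin n → ℤ) (fun _ => ⌈r⌉)).prod
    (Set.finite_Icc (-⌈r⌉) ⌈r⌉)).image f).subset ?_
  rintro x ⟨⟨h1, m, hm⟩, hr⟩
  choose k hk using h1
  have hsnd : |(m : ℝ)| ≤ r := by
    rw [← hm, ← Real.norm_eq_abs]; exact (norm_snd_le x).trans hr
  have hfst : ∀ i, |(k i : ℝ)| ≤ r := fun i => by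
    rw [← hk, ← Real.norm_eq_abs]; exact (norm_le_pi_norm x.1 i).trans ((norm_fst_le x).trans hr)
  refine ⟨(k, m), ⟨⟨fun i => (hle _ (hfst i)).1, fun i => (hle _ (hfst i)).2⟩, hle _ hsnd⟩, ?_⟩
  exact Prod.ext (funext fun i => (hk i).symm) hm.symm

lemma exists_nsmul_mem_intPoints {x : (Fin n → ℝ) × ℝ} (hx : x ∈ ratPoints n) :
    ∃ m : ℕ, 0 < m ∧ (m : ℝ) • x ∈ intPoints n := by
  obtain ⟨h1, a, ha⟩ := hx
  choose k hk using h1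
  have hden : ∀ (q : ℚ) (m : ℕ), q.den ∣ m → ∃ z : ℤ, (m : ℝ) * q = z := by
    rintro q m ⟨d, rfl⟩
    refine ⟨d * q.num, ?_⟩
    have h2 : (q.den : ℝ) * (q : ℝ) = q.num := by exact_mod_cast Rat.den_mul_eq_num q
    push_cast
    rw [← h2]
    ring
  refine ⟨a.den * ∏ i, (k i).den, ?_, fun i => ?_, ?_⟩
  · exact Nat.mul_pos a.den_pos (Finset.prod_pos fun i _ => (k i).den_pos)
  · obtain ⟨z, hz⟩ := hden (k i) (a.den * ∏ i, (k i).den)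
      ((Finset.dvd_prod_of_mem _ (Finset.mem_univ i)).mul_left _)
    exact ⟨z, by simpa [hk] using hz⟩
  · obtain ⟨z, hz⟩ := hden a (a.den * ∏ i, (k i).den) (dvd_mul_right _ _)
    exact ⟨z, by simpa [ha] using hz⟩

lemma exists_common_nsmul_mem_intPoints (l : List ((Fin n → ℝ) × ℝ)) (hl : ∀ x ∈ l, x ∈ ratPoints n) :
    ∃ p : ℕ, 0 < p ∧ ∀ x ∈ l, (p : ℝ) • x ∈ intPoints n := by
  induction l with
  | nil => exact ⟨1, one_pos, by simp⟩
  | cons x l ih =>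
    simp only [List.mem_cons, forall_eq_or_imp] at hl ⊢
    obtain ⟨p, hp, hpl⟩ := ih hl.2
    obtain ⟨m, hm, hmx⟩ := exists_nsmul_mem_intPoints hl.1
    refine ⟨p * m, Nat.mul_pos hp hm, ?_, fun y hy => ?_⟩
    · rw [Nat.cast_mul, mul_smul, Nat.cast_smul_eq_nsmul ℝ p]
      exact AddSubgroup.nsmul_mem _ hmx _
    · rw [Nat.cast_mul, mul_comm, mul_smul, Nat.cast_smul_eq_nsmul ℝ m]
      exact AddSubgroup.nsmul_mem _ (hpl y hy) _

lemma finrank_homogenization (n : ℕ) : Module.finrank ℝ ((Fin n → ℝ) × ℝ) = n + 1 := by simp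

/-- The coordinates of a rational point with respect to a rational basis are rational. -/
lemma exists_rat_coord (b : Module.Basis (Fin (n + 1)) ℝ ((Fin n → ℝ) × ℝ))
    (hb : ∀ i, b i ∈ ratPoints n) (i : Fin (n + 1)) {x : (Fin n → ℝ) × ℝ} (hx : x ∈ ratPoints n) :
    ∃ q : ℚ, b.coord i x = q := by
  let φ : ((Fin n → ℚ) × ℚ) →ₗ[ℚ] ((Fin n → ℝ) × ℝ) :=
    { toFun := fun x => (fun i => (x.1 i : ℝ), (x.2 : ℝ))
      map_add' := fun x y => by ext <;> simp
      map_smul' := fun c x => by ext <;> simp [Rat.smul_def] }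
  have hφ : ∀ x ∈ ratPoints n, ∃ x', φ x' = x := by
    rintro x ⟨h1, a, ha⟩
    choose k hk using h1
    exact ⟨(k, a), Prod.ext (funext fun i => (hk i).symm) ha.symm⟩
  choose v hv using fun i => hφ (b i) (hb i)
  have hli : LinearIndependent ℚ v := by
    refine LinearIndependent.of_comp φ ?_
    have : φ ∘ v = b := funext hv
    rw [this]
    exact b.linearIndependent.restrict_scalars' ℚ
  let b' := basisOfLinearIndependentOfCardEqFinrank hli (by simp)
  obtain ⟨x', rfl⟩ := hφ x hx
  refine ⟨b'.repr x' i, ?_⟩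
  have hx' : φ x' = ∑ j, ((b'.repr x' j : ℚ) : ℝ) • b j := by
    conv_lhs => rw [← b'.sum_repr x']
    rw [map_sum]
    refine Finset.sum_congr rfl fun j _ => ?_
    rw [map_smul, coe_basisOfLinearIndependentOfCardEqFinrank, hv]
    rw [← algebraMap_smul ℝ (b'.repr x' j) (b j)]
    simp
  rw [hx']
  simp [Finsupp.single_apply]

/-- The simplex with given linearly independent rational vertices of height one. -/
noncomputable def RatSimplex.ofLinearIndependent (f : Fin (n + 1) → (Fin n → ℝ) × ℝ)
    (hf : LinearIndependent ℝ f) (hR : ∀ i, f i ∈ ratPoints n) (h1 : ∀ i, (f i).2 = 1) :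
    RatSimplex (Fin (n + 1)) (ratPoints n) (LinearMap.snd ℝ (Fin n → ℝ) ℝ) where
  v := f
  c := (basisOfLinearIndependentOfCardEqFinrank hf (by simp)).coord
  sum_c x := by
    conv_rhs => rw [← (basisOfLinearIndependentOfCardEqFinrank hf (by simp)).sum_repr x]
    simp
  c_v i j := by
    have := (basisOfLinearIndependentOfCardEqFinrank hf (by simp)).repr_self j
    rw [coe_basisOfLinearIndependentOfCardEqFinrank] at this
    simp [this, Finsupp.single_apply, eq_comm]
  v_mem := hR
  c_rat i x hx := exists_rat_coord _ (by simpa using hR) i hx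
  h_v := h1

/-- Carathéodory's theorem for a spanning set of points of height one. -/
lemma exists_linearIndependent_of_mem_convexHull {W : Set ((Fin n → ℝ) × ℝ)}
    (hW1 : ∀ w ∈ W, w.2 = 1) (hspan : Submodule.span ℝ W = ⊤) {x : (Fin n → ℝ) × ℝ}
    (hx : x ∈ convexHull ℝ W) :
    ∃ f : Fin (n + 1) → (Fin n → ℝ) × ℝ, LinearIndependent ℝ f ∧ (∀ i, f i ∈ W) ∧
      ∀ g : ((Fin n → ℝ) × ℝ) →ₗ[ℝ] ℝ, (∀ i, 0 ≤ g (f i)) → 0 ≤ g x := by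
  obtain ⟨κ, _, z, w, hzW, hz, hw, -, rfl⟩ := eq_pos_convex_span_of_mem_convexHull hx
  have hli : LinearIndependent ℝ z := by
    rw [Fintype.linearIndependent_iff]
    intro a ha
    have hs : ∑ i, a i = 0 := by
      have := congrArg (LinearMap.snd ℝ (Fin n → ℝ) ℝ) ha
      simpa [fun i => hW1 (z i) (hzW ⟨i, rfl⟩)] using this
    have := affineIndependent_iff.1 hz Finset.univ a hs ha
    exact fun i => this i (Finset.mem_univ i)
  obtain ⟨b, hbW, hzb, hWb, hb⟩ := exists_linearIndepOn_id_extension hli.linearIndepOn_id hzW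
  have hbspan : Submodule.span ℝ b = ⊤ := by
    rw [eq_top_iff, ← hspan, Submodule.span_le]
    exact hWb
  let B : Module.Basis b ℝ ((Fin n → ℝ) × ℝ) := Module.Basis.mk hb (by
    simp [hbspan])
  have : Fintype b := FiniteDimensional.fintypeBasisIndex B
  have hcard : Fintype.card b = n + 1 := by
    rw [← Module.finrank_eq_card_basis B, finrank_homogenization]
  let e : Fin (n + 1) ≃ b := (Fintype.equivFinOfCardEq hcard).symm
  refine ⟨fun i => (e i : (Fin n → ℝ) × ℝ), hb.comp e e.injective, fun i => hbW (e i).2,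
    fun g hg => ?_⟩
  rw [map_sum]
  refine Finset.sum_nonneg fun k _ => ?_
  rw [map_smul]
  have hk : 0 ≤ g (z k) := by
    have := hg (e.symm ⟨z k, hzb ⟨k, rfl⟩⟩)
    simpa using this
  exact mul_nonneg (hw k).le hk

/-- The radial projection to the hyperplane of height one. -/
noncomputable def proj (y : (Fin n → ℝ) × ℝ) : Fin n → ℝ := y.2⁻¹ • y.1

lemma continuousAt_proj {y : (Fin n → ℝ) × ℝ} (hy : y.2 ≠ 0) : ContinuousAt proj y :=
  (continuousAt_snd.inv₀ hy).smul continuousAt_fst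

open Classical in
/-- The cone over a rational polytope is generically a disjoint union of simplicial cones. -/
lemma exists_simplices (V : Finset (Fin n → ℝ)) (hV : ∀ v ∈ V, ∀ i, ∃ r : ℚ, v i = (r : ℝ))
    (hspan : Submodule.span ℝ ((V : Set (Fin n → ℝ)) ×ˢ {(1 : ℝ)}) = ⊤) :
    ∃ (T : List (RatSimplex (Fin (n + 1)) (ratPoints n) (LinearMap.snd ℝ (Fin n → ℝ) ℝ)))
      (N : List (((Fin n → ℝ) × ℝ) →ₗ[ℝ] ℝ)), (∀ l ∈ N, l ≠ 0) ∧
      ∀ y, (∀ l ∈ N, l y ≠ 0) → 0 < y.2 →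
        (T.map (RatSimplex.ind y)).sum = if proj y ∈ convexHull ℝ (V : Set (Fin n → ℝ)) then 1 else 0 := by
  set W : Set ((Fin n → ℝ) × ℝ) := (V : Set (Fin n → ℝ)) ×ˢ {(1 : ℝ)} with hW
  have hWfin : W.Finite := V.finite_toSet.prod (Set.finite_singleton _)
  have hW1 : ∀ w ∈ W, w.2 = 1 := fun w hw => hw.2
  have hWR : ∀ w ∈ W, w ∈ ratPoints n := fun w hw => ⟨hV _ hw.1, 1, by simpa using hw.2⟩
  have hhull : ∀ x : (Fin n → ℝ) × ℝ, x.2 = 1 →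
      (x ∈ convexHull ℝ W ↔ x.1 ∈ convexHull ℝ (V : Set (Fin n → ℝ))) := by
    intro x hx
    rw [hW, convexHull_prod, Set.mem_prod]
    simp [hx]
  have hF : {f : Fin (n + 1) → (Fin n → ℝ) × ℝ | ∀ i, f i ∈ W}.Finite := Set.Finite.pi' fun _ => hWfin
  let F : List (Fin (n + 1) → (Fin n → ℝ) × ℝ) := hF.toFinset.toList
  have hFmem : ∀ f, f ∈ F ↔ ∀ i, f i ∈ W := by simp [F]
  let B := F.flatMap fun f =>
    if hf : LinearIndependent ℝ f ∧ ∀ i, f i ∈ W then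
      [RatSimplex.ofLinearIndependent f hf.1 (fun i => hWR _ (hf.2 i)) (fun i => hW1 _ (hf.2 i))]
    else []
  have hB₁ : ∀ σ ∈ B, ∀ i, σ.v i ∈ W := by
    intro σ hσ
    obtain ⟨f, -, hσ⟩ := List.mem_flatMap.1 hσ
    split_ifs at hσ with hf
    · rw [List.mem_singleton.1 hσ]
      exact hf.2
    · simp at hσ
  have hB₂ : ∀ f : Fin (n + 1) → (Fin n → ℝ) × ℝ, LinearIndependent ℝ f → (∀ i, f i ∈ W) →
      ∃ σ ∈ B, σ.v = f := by
    intro f h1 h2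
    refine ⟨RatSimplex.ofLinearIndependent f h1 (fun i => hWR _ (h2 i)) (fun i => hW1 _ (h2 i)),
      List.mem_flatMap.2 ⟨f, (hFmem f).2 h2, ?_⟩, rfl⟩
    rw [dif_pos ⟨h1, h2⟩]
    simp
  obtain ⟨T, N, hN, hBN, hT⟩ := RatSimplex.exists_disjoint_union B
  refine ⟨T, N, hN, fun y hy hpos => ?_⟩
  rw [hT y hy]
  refine if_congr ?_ rfl rfl
  have hnorm : (y.2⁻¹ • y).2 = 1 := by simp [hpos.ne']
  rw [show proj y = (y.2⁻¹ • y).1 from rfl, ← hhull _ hnorm]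
  constructor
  · rintro ⟨σ, hσ, hp⟩
    have hsum : y.2⁻¹ • y = ∑ i, (y.2⁻¹ * σ.c i y) • σ.v i := by
      simp only [mul_smul, ← Finset.smul_sum, σ.sum_c]
    rw [hsum]
    refine (convex_convexHull ℝ W).sum_mem (fun i _ => ?_) ?_ fun i _ =>
      subset_convexHull ℝ W (hB₁ σ hσ i)
    · exact mul_nonneg (by positivity) (hp i).le
    · rw [← Finset.mul_sum, ← σ.height_eq_sum]
      simp [hpos.ne']
  · intro hx
    obtain ⟨f, hf, hfW, hg⟩ := exists_linearIndependent_of_mem_convexHull hW1 hspan hx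
    obtain ⟨σ, hσ, rfl⟩ := hB₂ f hf hfW
    refine ⟨σ, hσ, fun i => lt_of_le_of_ne ?_ (hy _ (hBN σ hσ i)).symm⟩
    have := hg (σ.c i) fun j => by rw [σ.c_v]; split_ifs <;> simp
    rw [map_smul] at this
    exact nonneg_of_mul_nonneg_right this (inv_pos.2 hpos)

/-- The open cone over the interior of `P`. -/
def openCone (P : Set (Fin n → ℝ)) : Set ((Fin n → ℝ) × ℝ) := {y | 0 < y.2 ∧ proj y ∈ interior P}

lemma isOpen_openCone (P : Set (Fin n → ℝ)) : IsOpen (openCone P) := by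
  have hc : ContinuousOn (proj (n := n)) {y | 0 < y.2} := fun y hy =>
    (continuousAt_proj (ne_of_gt hy)).continuousWithinAt
  exact hc.isOpen_inter_preimage (isOpen_lt continuous_const continuous_snd) isOpen_interior

lemma openCone_nonempty {P : Set (Fin n → ℝ)} (hP : (interior P).Nonempty) :
    (openCone P).Nonempty := by
  obtain ⟨z, hz⟩ := hP
  exact ⟨(z, 1), by simp, by simpa [proj] using hz⟩

lemma span_prod_one_eq_top {V : Set (Fin n → ℝ)} (hV : (interior (convexHull ℝ V)).Nonempty) :
    Submodule.span ℝ (V ×ˢ {(1 : ℝ)}) = ⊤ := by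
  refine Submodule.eq_top_of_nonempty_interior' _ ?_
  refine (openCone_nonempty hV).mono (interior_maximal ?_ (isOpen_openCone _))
  rintro y ⟨hy, hyP⟩
  have h1 : ((proj y, 1) : (Fin n → ℝ) × ℝ) ∈ convexHull ℝ (V ×ˢ {(1 : ℝ)}) := by
    rw [convexHull_prod, convexHull_singleton]
    exact ⟨interior_subset hyP, rfl⟩
  have h2 := convexHull_min Submodule.subset_span (Submodule.convex _) h1
  have h3 : y = y.2 • ((proj y, 1) : (Fin n → ℝ) × ℝ) := by
    ext <;> simp [proj, hy.ne']
  rw [h3]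
  exact Submodule.smul_mem _ _ h2

lemma exists_generic_mem {U : Set ((Fin n → ℝ) × ℝ)} (hU : IsOpen U) (hne : U.Nonempty)
    (N : List (((Fin n → ℝ) × ℝ) →ₗ[ℝ] ℝ)) (hN : ∀ l ∈ N, l ≠ 0) :
    ∃ ξ ∈ U, ∀ l ∈ N, l ξ ≠ 0 := by
  induction N generalizing U with
  | nil =>
    obtain ⟨x, hx⟩ := hne
    exact ⟨x, hx, by simp⟩
  | cons l N ih =>
    simp only [List.mem_cons, forall_eq_or_imp] at hN ⊢
    have hl : IsOpen {x | l x ≠ 0} :=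
      isOpen_ne_fun l.continuous_of_finiteDimensional continuous_const
    obtain ⟨ξ, hξ, hξN⟩ := ih (hU.inter hl) (by
      by_contra hemp
      rw [Set.not_nonempty_iff_eq_empty, Set.eq_empty_iff_forall_notMem] at hemp
      refine hN.1 (LinearMap.ker_eq_top.1 (Submodule.eq_top_of_nonempty_interior' _ ?_))
      refine hne.mono (interior_maximal (fun x hx => ?_) hU)
      by_contra hx'
      exact hemp x ⟨hx, hx'⟩) hN.2
    exact ⟨ξ, hξ.1, hξ.2, hξN⟩

lemma add_smul_mem_openCone {P : Set (Fin n → ℝ)} (hP : Convex ℝ P) {y ξ : (Fin n → ℝ) × ℝ}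
    (hy : 0 < y.2) (hyP : proj y ∈ P) (hξ : ξ ∈ openCone P) {ε : ℝ} (hε : 0 < ε) :
    y + ε • ξ ∈ openCone P := by
  obtain ⟨hξ1, hξP⟩ := hξ
  have hs : 0 < y.2 + ε * ξ.2 := by positivity
  refine ⟨by simpa using hs, ?_⟩
  have := hP.combo_self_interior_mem_interior hyP hξP (a := y.2 / (y.2 + ε * ξ.2))
    (b := ε * ξ.2 / (y.2 + ε * ξ.2)) (by positivity) (by positivity) (by field_simp)
  convert this using 1
  simp only [proj, Prod.snd_add, Prod.smul_snd, Prod.fst_add, Prod.smul_fst, smul_eq_mul]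
  match_scalars
  · field_simp
  · field_simp

lemma tendsto_proj_add_smul {y ξ : (Fin n → ℝ) × ℝ} (hy : 0 < y.2) :
    Tendsto (fun ε : ℝ => proj (y + ε • ξ)) (𝓝[>] 0) (𝓝 (proj y)) := by
  have h1 : ContinuousAt (fun ε : ℝ => y + ε • ξ) 0 := by fun_prop
  have h2 : ContinuousAt (fun ε : ℝ => proj (y + ε • ξ)) 0 :=
    ContinuousAt.comp (g := proj) (continuousAt_proj (by simpa using hy.ne')) h1
  have h3 := h2.tendsto.mono_left (nhdsWithin_le_nhds (s := Set.Ioi 0))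
  simpa using h3

lemma eventually_snd_pos {y : (Fin n → ℝ) × ℝ} (ξ : (Fin n → ℝ) × ℝ) (hy : 0 < y.2) :
    ∀ᶠ ε : ℝ in 𝓝[>] 0, 0 < (y + ε • ξ).2 := by
  have h1 : ContinuousAt (fun ε : ℝ => (y + ε • ξ).2) 0 := by fun_prop
  exact nhdsWithin_le_nhds (h1.eventually (lt_mem_nhds (by simpa using hy)))

lemma eventually_proj_mem_iff {P : Set (Fin n → ℝ)} (hP : Convex ℝ P) (hPc : IsClosed P)
    {y ξ : (Fin n → ℝ) × ℝ} (hy : 0 < y.2) (hξ : ξ ∈ openCone P) :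
    ∀ᶠ ε : ℝ in 𝓝[>] 0, (proj (y + ε • ξ) ∈ P ↔ proj y ∈ P) := by
  by_cases h : proj y ∈ P
  · filter_upwards [self_mem_nhdsWithin] with ε hε
    simp only [h, iff_true]
    exact interior_subset (add_smul_mem_openCone hP hy h hξ hε).2
  · filter_upwards [tendsto_proj_add_smul (ξ := ξ) hy (hPc.isOpen_compl.mem_nhds h)] with ε hε
    simp only [h, iff_false]
    exact hε

lemma eventually_proj_mem_iff_interior {P : Set (Fin n → ℝ)} (hP : Convex ℝ P)
    {y ξ : (Fin n → ℝ) × ℝ} (hy : 0 < y.2) (hξ : ξ ∈ openCone P) :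
    ∀ᶠ ε : ℝ in 𝓝[>] 0, (proj (y + ε • -ξ) ∈ P ↔ proj y ∈ interior P) := by
  by_cases h : proj y ∈ interior P
  · filter_upwards [tendsto_proj_add_smul (ξ := -ξ) hy (isOpen_interior.mem_nhds h)] with ε hε
    simp only [h, iff_true]
    exact interior_subset hε
  · filter_upwards [self_mem_nhdsWithin, eventually_snd_pos (-ξ) hy] with ε hε hpos
    simp only [h, iff_false]
    intro hm
    have := add_smul_mem_openCone hP hpos hm hξ hε
    simp only [smul_neg, neg_add_cancel_right] at this
    exact h this.2

lemma eventually_add_mul_pos_iff (a : ℝ) {b : ℝ} (hb : b ≠ 0) :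
    ∀ᶠ ε : ℝ in 𝓝[>] 0, a + ε * b ≠ 0 ∧ (0 < a + ε * b ↔ 0 < a ∨ 0 < b ∧ a = 0) := by
  have hc : ContinuousAt (fun ε : ℝ => a + ε * b) 0 := by fun_prop
  rcases lt_trichotomy a 0 with ha | rfl | ha
  · filter_upwards [nhdsWithin_le_nhds (hc.eventually (gt_mem_nhds (show a + 0 * b < 0 by simpa using ha)))]
      with ε hε
    exact ⟨hε.ne, by simp [hε.not_gt, ha.not_gt, ha.ne]⟩
  · filter_upwards [self_mem_nhdsWithin] with ε hε
    have hε : 0 < ε := hε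
    exact ⟨by simp [hε.ne', hb], by simp [hε]⟩
  · filter_upwards [nhdsWithin_le_nhds (hc.eventually (lt_mem_nhds (show 0 < a + 0 * b by simpa using ha)))]
      with ε hε
    exact ⟨hε.ne', by simp [hε, ha]⟩

lemma eventually_apply_pos_iff (N : List (((Fin n → ℝ) × ℝ) →ₗ[ℝ] ℝ)) (y : (Fin n → ℝ) × ℝ)
    {ξ : (Fin n → ℝ) × ℝ} (hξ : ∀ l ∈ N, l ξ ≠ 0) :
    ∀ᶠ ε : ℝ in 𝓝[>] 0, ∀ l ∈ N, l (y + ε • ξ) ≠ 0 ∧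
      (0 < l (y + ε • ξ) ↔ 0 < l y ∨ 0 < l ξ ∧ l y = 0) := by
  refine (Filter.eventually_all_finite (List.finite_toSet N)).2 fun l hl => ?_
  simpa using eventually_add_mul_pos_iff (l y) (hξ l hl)

open Classical in
lemma sum_indicator_eq
    {T : List (RatSimplex (Fin (n + 1)) (ratPoints n) (LinearMap.snd ℝ (Fin n → ℝ) ℝ))}
    {N : List (((Fin n → ℝ) × ℝ) →ₗ[ℝ] ℝ)} {P : Set (Fin n → ℝ)}
    (hT : ∀ y, (∀ l ∈ N, l y ≠ 0) → 0 < y.2 →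
      (T.map (RatSimplex.ind y)).sum = if proj y ∈ P then 1 else 0)
    (hTN : ∀ τ ∈ T, ∀ i, τ.c i ∈ N) {ξ : (Fin n → ℝ) × ℝ} (hξ : ∀ l ∈ N, l ξ ≠ 0)
    {y : (Fin n → ℝ) × ℝ} (hy : 0 < y.2) {Q : Prop}
    (hQ : ∀ᶠ ε : ℝ in 𝓝[>] 0, (proj (y + ε • ξ) ∈ P ↔ Q)) :
    (T.map fun τ => if ∀ i, 0 < τ.c i y ∨ i ∈ {i | 0 < τ.c i ξ} ∧ τ.c i y = 0 then 1 else 0).sum =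
      if Q then 1 else 0 := by
  obtain ⟨ε, h1, h2, h3⟩ := (hQ.and ((eventually_snd_pos ξ hy).and
    (eventually_apply_pos_iff N y hξ))).exists
  rw [← if_congr h1 rfl rfl, ← hT _ (fun l hl => (h3 l hl).1) h2]
  congr 1
  refine List.map_congr_left fun τ hτ => ?_
  unfold RatSimplex.ind
  refine if_congr (forall_congr' fun i => ?_) rfl rfl
  exact (h3 _ (hTN τ hτ i)).2.symm

open Classical in
lemma ncard_eq_list_sum {α β : Type*} (T : List β) (S : β → Set α) (A : Set α)
    (hS : ∀ b ∈ T, (S b).Finite)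
    (h : ∀ x, (T.map fun b => if x ∈ S b then 1 else 0).sum = if x ∈ A then 1 else 0) :
    A.ncard = (T.map fun b => (S b).ncard).sum := by
  have hfin : {x | ∃ b ∈ T, x ∈ S b}.Finite := by
    have : {x | ∃ b ∈ T, x ∈ S b} = ⋃ b ∈ {b | b ∈ T}, S b := by ext; simp
    rw [this]
    exact (List.finite_toSet T).biUnion hS
  have hcard : ∀ B : Set α, B ⊆ {x | ∃ b ∈ T, x ∈ S b} →
      B.ncard = ∑ x ∈ hfin.toFinset, if x ∈ B then 1 else 0 := by
    intro B hB
    rw [← Finset.card_filter, ← Set.ncard_coe_finset]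
    congr 1
    ext x
    simpa using @hB x
  have hA : A ⊆ {x | ∃ b ∈ T, x ∈ S b} := by
    intro x hx
    by_contra hn
    have hx' := h x
    rw [if_pos hx, List.sum_eq_zero] at hx'
    · exact zero_ne_one hx'
    · intro m hm
      obtain ⟨b, hb, rfl⟩ := List.mem_map.1 hm
      exact if_neg fun hxb => hn ⟨b, hb, hxb⟩
  rw [hcard A hA]
  simp only [← h]
  rw [List.map_congr_left fun b hb => hcard (S b) fun x hx => ⟨b, hb, hx⟩]
  generalize hfin.toFinset = Z
  clear hcard hA h hfin hS
  induction T with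
  | nil => simp
  | cons b T ih => simp only [List.map_cons, List.sum_cons, Finset.sum_add_distrib, ih]

lemma RatSimplex.finite_boxSet {ι : Type*} [Fintype ι] [DecidableEq ι]
    (σ : RatSimplex ι (ratPoints n) (LinearMap.snd ℝ (Fin n → ℝ) ℝ)) (I : Set ι) (p : ℕ) :
    (σ.boxSet (intPoints n) I p).Finite := by
  refine (finite_intPoints_norm_le (∑ i, p * ‖σ.v i‖)).subset fun x hx => ⟨hx.1, ?_⟩
  conv_lhs => rw [← σ.sum_c x]
  refine (norm_sum_le _ _).trans (Finset.sum_le_sum fun i _ => ?_)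
  have h := boxSet_c_mem_Icc hx i
  rw [norm_smul, Real.norm_eq_abs, abs_of_nonneg h.1]
  exact mul_le_mul_of_nonneg_right h.2 (norm_nonneg _)

open Classical in
lemma ncard_intPoints_eq_list_sum
    {T : List (RatSimplex (Fin (n + 1)) (ratPoints n) (LinearMap.snd ℝ (Fin n → ℝ) ℝ))}
    {p : ℕ} (hp : 0 < p) (hL : ∀ τ ∈ T, ∀ i, (p : ℝ) • τ.v i ∈ intPoints n)
    (I : RatSimplex (Fin (n + 1)) (ratPoints n) (LinearMap.snd ℝ (Fin n → ℝ) ℝ) → Set (Fin (n + 1)))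
    {Q : Set (Fin n → ℝ)} {t : ℕ} (ht : 0 < t)
    (h : ∀ y : (Fin n → ℝ) × ℝ, 0 < y.2 →
      (T.map fun τ => if ∀ i, 0 < τ.c i y ∨ i ∈ I τ ∧ τ.c i y = 0 then 1 else 0).sum =
        if proj y ∈ Q then 1 else 0) :
    {x : Fin n → ℝ | x ∈ (t : ℝ) • Q ∧ ∀ i, ∃ m : ℤ, x i = (m : ℝ)}.ncard =
      (T.map fun τ => (τ.coneSet (intPoints n) (I τ) t).ncard).sum := by
  have ht' : (0 : ℝ) < t := by exact_mod_cast ht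
  have hinj : Function.Injective fun x : Fin n → ℝ => (x, (t : ℝ)) := fun x y hxy =>
    congrArg Prod.fst hxy
  rw [← Set.ncard_image_of_injective _ hinj]
  refine ncard_eq_list_sum T _ _ (fun τ hτ => τ.finite_coneSet hp (hL τ hτ)
    (fun x hx => floor_snd_of_mem_intPoints hx) (τ.finite_boxSet _ p) t) fun y => ?_
  have hA : y ∈ (fun x : Fin n → ℝ => (x, (t : ℝ))) ''
      {x : Fin n → ℝ | x ∈ (t : ℝ) • Q ∧ ∀ i, ∃ m : ℤ, x i = (m : ℝ)} ↔
      (y ∈ intPoints n ∧ y.2 = t) ∧ proj y ∈ Q := by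
    constructor
    · rintro ⟨x, ⟨hx, hxi⟩, rfl⟩
      rw [Set.mem_smul_set_iff_inv_smul_mem₀ ht'.ne'] at hx
      exact ⟨⟨⟨hxi, t, by simp⟩, rfl⟩, hx⟩
    · rintro ⟨⟨hy, hyt⟩, hyQ⟩
      refine ⟨y.1, ⟨?_, hy.1⟩, Prod.ext rfl hyt.symm⟩
      rw [Set.mem_smul_set_iff_inv_smul_mem₀ ht'.ne', ← hyt]
      exact hyQ
  by_cases hy : y ∈ intPoints n ∧ y.2 = t
  · rw [if_congr (hA.trans (and_iff_right hy)) rfl rfl, ← h y (by rw [hy.2]; exact ht')]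
    congr 1
    refine List.map_congr_left fun τ _ => if_congr ?_ rfl rfl
    exact ⟨fun h => h.2.2, fun h => ⟨hy.1, hy.2, h⟩⟩
  · rw [if_neg fun h => hy (hA.1 h).1]
    refine List.sum_eq_zero fun m hm => ?_
    obtain ⟨τ, -, rfl⟩ := List.mem_map.1 hm
    exact if_neg fun h => hy ⟨h.1, h.2.1⟩

end Homogenization

/-- **Ehrhart–Macdonald reciprocity.**
If `P ⊆ ℝⁿ` is an `n`-dimensional rational polytope, then there are a positive
integer `p` and polynomials `q_r ∈ ℚ[x]`, indexed by `r ∈ ℤ/p`, such that for every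
positive integer `t` the number of lattice points in the interior of `t • P` equals
`q_{t mod p}(t)` while the number of lattice points in `t • P` equals
`(-1)^n ⬝ q_{(-t) mod p}(-t)`. -/
theorem ehrhart_macdonald_reciprocity
    (n : ℕ) (V : Finset (Fin n → ℝ))
    (hV : ∀ v ∈ V, ∀ i, ∃ r : ℚ, v i = (r : ℝ))
    (P : Set (Fin n → ℝ)) (hP : P = convexHull ℝ (V : Set (Fin n → ℝ)))
    (hdim : (interior P).Nonempty) :
    ∃ p : ℕ, 0 < p ∧ ∃ q : ZMod p → Polynomial ℚ,
      ∀ t : ℕ, 0 < t →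
        (({x : Fin n → ℝ | x ∈ interior ((t : ℝ) • P) ∧ ∀ i, ∃ m : ℤ, x i = (m : ℝ)}.ncard : ℚ)
          = (q (t : ZMod p)).eval (t : ℚ)) ∧
        (({x : Fin n → ℝ | x ∈ (t : ℝ) • P ∧ ∀ i, ∃ m : ℤ, x i = (m : ℝ)}.ncard : ℚ)
          = (-1) ^ n * (q ((-(t : ℤ) : ℤ) : ZMod p)).eval (-(t : ℚ))) := by
  subst hP
  set P := convexHull ℝ (V : Set (Fin n → ℝ)) with hP
  have hPc : IsClosed P := V.finite_toSet.isClosed_convexHull ℝ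
  have hPx : Convex ℝ P := convex_convexHull ℝ _
  obtain ⟨T, N, hN, hT⟩ := exists_simplices V hV (span_prod_one_eq_top hdim)
  set M := N ++ T.flatMap fun τ => Finset.univ.toList.map τ.c with hM
  have hM0 : ∀ l ∈ M, l ≠ 0 := by
    intro l hl
    rcases List.mem_append.1 hl with hl | hl
    · exact hN l hl
    · obtain ⟨τ, -, hl⟩ := List.mem_flatMap.1 hl
      obtain ⟨i, -, rfl⟩ := List.mem_map.1 hl
      exact τ.c_ne_zero i
  have hTM : ∀ τ ∈ T, ∀ i, τ.c i ∈ M := fun τ hτ i =>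
    List.mem_append_right _ (List.mem_flatMap.2 ⟨τ, hτ, List.mem_map.2 ⟨i, by simp, rfl⟩⟩)
  have hT' := fun y (hy : ∀ l ∈ M, l y ≠ 0) =>
    hT y fun l hl => hy l (List.mem_append_left _ hl)
  obtain ⟨ξ, hξ, hξM⟩ := exists_generic_mem (isOpen_openCone P) (openCone_nonempty hdim) M hM0
  have hξM' : ∀ l ∈ M, l (-ξ) ≠ 0 := fun l hl => by simpa using hξM l hl
  obtain ⟨p, hp, hpT⟩ := exists_common_nsmul_mem_intPoints
    (T.flatMap fun τ => Finset.univ.toList.map τ.v) (by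
      intro x hx
      obtain ⟨τ, -, hx⟩ := List.mem_flatMap.1 hx
      obtain ⟨i, -, rfl⟩ := List.mem_map.1 hx
      exact τ.v_mem i)
  have hL : ∀ τ ∈ T, ∀ i, (p : ℝ) • τ.v i ∈ intPoints n := fun τ hτ i =>
    hpT _ (List.mem_flatMap.2 ⟨τ, hτ, List.mem_map.2 ⟨i, by simp, rfl⟩⟩)
  obtain ⟨q, hq⟩ := RecPair.list_sum T fun τ hτ => τ.recPair_coneSet {i | 0 < τ.c i (-ξ)} hp
    (Fintype.card_fin (n + 1)) (hL τ hτ) (fun x hx => floor_snd_of_mem_intPoints hx)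
    fun I => τ.finite_boxSet I p
  refine ⟨p, hp, q, fun t ht => ?_⟩
  have ht' : (t : ℝ) ≠ 0 := by exact_mod_cast ht.ne'
  rw [← (hq t ht).1, ← (hq t ht).2, interior_smul₀ ht',
    ncard_intPoints_eq_list_sum hp hL (fun τ => {i | 0 < τ.c i (-ξ)}) ht fun y hy =>
      sum_indicator_eq hT' hTM hξM' hy (eventually_proj_mem_iff_interior hPx hy hξ),
    ncard_intPoints_eq_list_sum hp hL (fun τ => {i | 0 < τ.c i ξ}) ht fun y hy =>
      sum_indicator_eq hT' hTM hξM hy (eventually_proj_mem_iff hPx hPc hy hξ)]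
  have hcompl : ∀ τ ∈ T, {i | 0 < τ.c i ξ} = {i | 0 < τ.c i (-ξ)}ᶜ := by
    intro τ hτ
    ext i
    have := hξM _ (hTM τ hτ i)
    simp only [Set.mem_ofPred_eq, Set.mem_compl_iff, map_neg, Left.neg_pos_iff, not_lt]
    exact ⟨le_of_lt, fun h => lt_of_le_of_ne h this.symm⟩
  refine ⟨by simp [Nat.cast_list_sum, Function.comp_def], ?_⟩
  rw [List.map_congr_left fun τ hτ => by rw [hcompl τ hτ]]
  simp [Nat.cast_list_sum, Function.comp_def]
end
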